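/- arXiv:1906.03162 — 4 statements merged into one kernel-verified Lean document; each statement's English description precedes it below -/
import Mathlib

section
/- For any two subsets S₁, S₂ of C, each of cardinality 11 and each satisfying d·e ∈ {1, 2} for all distinct d, e in the subset, there exists σ ∈ W with σ(S₁) = S₂. -/
/-- The bilinear form on `Λ = ℤ⁹`: `d·e = d₀e₀ − Σ_{i=1}^{8} dᵢeᵢ`. -/
def dot (d e : Fin 9 → ℤ) : ℤ := d 0 * e 0 - ∑ i : Fin 8, d i.succ * e i.succ

/-- The canonical class `K = (−3, 1, 1, 1, 1, 1, 1, 1, 1)`. -/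
def KK : Fin 9 → ℤ := ![-3, 1, 1, 1, 1, 1, 1, 1, 1]

/-- A vector is exceptional if `d·d = −1` and `d·K = −1`. -/
def IsExceptional (d : Fin 9 → ℤ) : Prop := dot d d = -1 ∧ dot d KK = -1

/-- The set `C` of exceptional vectors. -/
def Cset : Set (Fin 9 → ℤ) := {d | IsExceptional d}

/-- `σ` belongs to the group `W` of permutations of `C` preserving the pairing. -/
def MemW (σ : (Fin 9 → ℤ) → (Fin 9 → ℤ)) : Prop :=
  Set.BijOn σ Cset Cset ∧ ∀ d ∈ Cset, ∀ e ∈ Cset, dot (σ d) (σ e) = dot d e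

namespace ExceptionalVectors

/-- The ambient lattice. -/
abbrev Lat := Fin 9 → ℤ

/-- The negative of the intersection form, which is positive definite on the complement of `KK`. -/
def pair : Lat →ₗ[ℤ] Lat →ₗ[ℤ] ℤ :=
  LinearMap.mk₂ ℤ (fun d e => -dot d e)
    (by intro a b c; simp only [dot, Pi.add_apply, add_mul, Finset.sum_add_distrib]; ring)
    (by intro a b c
        simp only [dot, Pi.smul_apply, smul_eq_mul, mul_assoc, ← Finset.mul_sum]; ring)
    (by intro a b c; simp only [dot, Pi.add_apply, mul_add, Finset.sum_add_distrib]; ring)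
    (by intro a b c
        simp only [dot, Pi.smul_apply, smul_eq_mul, mul_left_comm _ a, ← Finset.mul_sum]; ring)

lemma pair_apply (d e : Lat) : pair d e = -dot d e := rfl

lemma pair_comm (d e : Lat) : pair d e = pair e d := by
  simp only [pair_apply, dot, mul_comm]

lemma pair_KK : pair KK KK = -1 := by
  simp [pair_apply, dot, KK, Fin.sum_univ_succ]

lemma three_mul_zero_coord {z : Lat} (hz : pair z KK = 0) :
    3 * z 0 = -∑ i : Fin 8, z i.succ := by
  simp only [pair_apply, dot, KK, Fin.sum_univ_succ] at hz ⊢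
  simp at hz ⊢
  linarith

lemma sq_zero_coord_le {z : Lat} (hz : pair z KK = 0) :
    9 * z 0 ^ 2 ≤ 8 * ∑ i : Fin 8, z i.succ ^ 2 := by
  have h := three_mul_zero_coord hz
  have := sq_sum_le_card_mul_sum_sq (s := (Finset.univ : Finset (Fin 8))) (f := fun i => z i.succ)
  simp only [Finset.card_univ, Fintype.card_fin] at this
  have h2 : (3 * z 0) ^ 2 = (∑ i : Fin 8, z i.succ) ^ 2 := by rw [h]; ring
  push_cast at this
  nlinarith

lemma pair_self (z : Lat) : pair z z = ∑ i : Fin 8, z i.succ ^ 2 - z 0 ^ 2 := by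
  simp only [pair_apply, dot, pow_two]; ring

lemma pair_self_nonneg {z : Lat} (hz : pair z KK = 0) : 0 ≤ pair z z := by
  have h := sq_zero_coord_le hz
  have h2 : 0 ≤ ∑ i : Fin 8, z i.succ ^ 2 := Finset.sum_nonneg fun i _ => sq_nonneg _
  rw [pair_self]; nlinarith

lemma eq_zero_of_pair_self {z : Lat} (hz : pair z KK = 0) (h0 : pair z z = 0) : z = 0 := by
  have h := sq_zero_coord_le hz
  rw [pair_self] at h0
  have h2 : 0 ≤ ∑ i : Fin 8, z i.succ ^ 2 := Finset.sum_nonneg fun i _ => sq_nonneg _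
  have h3 : ∑ i : Fin 8, z i.succ ^ 2 = 0 := by nlinarith [sq_nonneg (z 0)]
  have h4 : z 0 = 0 := by
    have : z 0 ^ 2 = 0 := by linarith
    simpa using this
  rw [Finset.sum_eq_zero_iff_of_nonneg fun i _ => sq_nonneg _] at h3
  funext i
  refine Fin.cases h4 (fun j => ?_) i
  simpa using h3 j (Finset.mem_univ _)

/-- The finite set `T` satisfies a nontrivial linear relation. -/
def Dep (T : Finset Lat) : Prop :=
  ∃ c : Lat → ℤ, ∑ r ∈ T, c r • r = 0 ∧ ∃ r ∈ T, c r ≠ 0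

/-- Roots with pairwise products `0` or `-1`. -/
structure IsRootSet (R : Finset Lat) : Prop where
  orth : ∀ r ∈ R, pair r KK = 0
  norm : ∀ r ∈ R, pair r r = 2
  prod : ∀ r ∈ R, ∀ s ∈ R, r ≠ s → pair r s = 0 ∨ pair r s = -1

/-- A minimal dependent subset. -/
structure IsCircuit (T : Finset Lat) : Prop where
  dep : Dep T
  minimal : ∀ T' ⊂ T, ¬ Dep T'

lemma dep_of_card {T : Finset Lat} (hT : ∀ r ∈ T, pair r KK = 0) (hc : 9 ≤ T.card) : Dep T := by
  have hK : KK ∉ T := fun h => by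
    have := hT _ h
    rw [pair_KK] at this; omega
  have hlt : Module.finrank ℤ Lat < (insert KK T).card := by
    rw [Finset.card_insert_of_notMem hK]; simp; omega
  obtain ⟨f, hf, x, hx, hfx⟩ := Module.exists_nontrivial_relation_of_finrank_lt_card hlt
  rw [Finset.sum_insert hK] at hf
  have h1 := congrArg (fun v => pair v KK) hf
  have h2 : ∑ r ∈ T, f r * pair r KK = 0 :=
    Finset.sum_eq_zero fun r hr => by rw [hT r hr, mul_zero]
  simp [pair_KK, h2, -zsmul_eq_mul] at h1
  refine ⟨f, by simpa [h1, -zsmul_eq_mul] using hf, x, ?_, hfx⟩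
  rcases Finset.mem_insert.1 hx with rfl | h
  · exact absurd h1 hfx
  · exact h

lemma Dep.exists_isCircuit {X : Finset Lat} (hX : Dep X) : ∃ T ⊆ X, IsCircuit T := by
  induction X using Finset.strongInduction with
  | H X ih =>
    by_cases h : ∃ T' ⊂ X, Dep T'
    · obtain ⟨T', hT', hd⟩ := h
      obtain ⟨T, hT, hc⟩ := ih T' hT' hd
      exact ⟨T, hT.trans hT'.1, hc⟩
    · push Not at h
      exact ⟨X, subset_rfl, hX, h⟩

lemma pair_sum_sum (T U : Finset Lat) (c d : Lat → ℤ) :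
    pair (∑ r ∈ T, c r • r) (∑ s ∈ U, d s • s) = ∑ r ∈ T, ∑ s ∈ U, c r * d s * pair r s := by
  simp only [map_sum, LinearMap.sum_apply, map_smul, LinearMap.smul_apply, smul_eq_mul,
    Finset.mul_sum]
  refine Finset.sum_comm.trans
    (Finset.sum_congr rfl fun r _ => Finset.sum_congr rfl fun s _ => ?_)
  ring

lemma pair_sum_KK {T : Finset Lat} (hT : ∀ r ∈ T, pair r KK = 0) (c : Lat → ℤ) :
    pair (∑ r ∈ T, c r • r) KK = 0 := by
  simp only [map_sum, LinearMap.sum_apply, map_smul, LinearMap.smul_apply, smul_eq_mul]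
  exact Finset.sum_eq_zero fun r hr => by rw [hT r hr, mul_zero]

lemma IsCircuit.exists_pos {R T : Finset Lat} (hR : IsRootSet R) (hTR : T ⊆ R)
    (hT : IsCircuit T) : ∃ c : Lat → ℤ, (∀ r ∈ T, 0 < c r) ∧ ∑ r ∈ T, c r • r = 0 := by
  obtain ⟨f, hf, x, hx, hfx⟩ := hT.dep
  have hne : ∀ r ∈ T, f r ≠ 0 := by
    intro r hr h0
    refine hT.minimal (T.erase r) (Finset.erase_ssubset hr) ⟨f, ?_, x, ?_, hfx⟩
    · rw [← Finset.add_sum_erase _ _ hr, h0] at hf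
      simpa using hf
    · exact Finset.mem_erase.2 ⟨fun h => hfx (h ▸ h0), hx⟩
  refine ⟨fun r => |f r|, fun r hr => abs_pos.2 (hne r hr), ?_⟩
  have hK := pair_sum_KK (fun r hr => hR.orth r (hTR hr)) (fun r => |f r|)
  refine eq_zero_of_pair_self hK (le_antisymm ?_ (pair_self_nonneg hK))
  have h0 : pair (∑ r ∈ T, f r • r) (∑ r ∈ T, f r • r) = 0 := by rw [hf]; simp
  rw [pair_sum_sum] at h0 ⊢
  rw [← h0]
  refine Finset.sum_le_sum fun r hr => Finset.sum_le_sum fun s hs => ?_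
  rw [← abs_mul]
  by_cases hrs : r = s
  · subst hrs
    rw [abs_mul_self]
  · have h1 := le_abs_self (f r * f s)
    rcases hR.prod r (hTR hr) s (hTR hs) hrs with h | h <;> rw [h] <;> linarith

lemma IsCircuit.orth {R T : Finset Lat} (hR : IsRootSet R) (hTR : T ⊆ R)
    (hT : IsCircuit T) {r s : Lat} (hr : r ∈ T) (hs : s ∈ R) (hsT : s ∉ T) : pair r s = 0 := by
  obtain ⟨c, hc, h⟩ := hT.exists_pos hR hTR
  have h1 := congrArg (fun v => pair v s) h
  simp only [map_sum, LinearMap.sum_apply, map_smul, LinearMap.smul_apply, smul_eq_mul, map_zero,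
    LinearMap.zero_apply] at h1
  rw [Finset.sum_eq_zero_iff_of_nonpos] at h1
  · simpa [(hc r hr).ne'] using h1 r hr
  · intro t ht
    have := hc t ht
    rcases hR.prod t (hTR ht) s hs (fun e => hsT (e ▸ ht)) with h | h <;> rw [h] <;> linarith

lemma IsCircuit.disjoint {R T U : Finset Lat} (hR : IsRootSet R) (hTR : T ⊆ R) (hUR : U ⊆ R)
    (hT : IsCircuit T) (hU : IsCircuit U) {x : Lat} (hxT : x ∈ T) (hxU : x ∉ U) :
    Disjoint T U := by
  rw [Finset.disjoint_left]
  intro y hyT hyU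
  obtain ⟨c, hc, h⟩ := hT.exists_pos hR hTR
  have hss : T ∩ U ⊂ T := by
    refine ⟨Finset.inter_subset_left, fun hh => hxU (Finset.mem_inter.1 (hh hxT)).2⟩
  refine hT.minimal _ hss ⟨c, ?_, y, Finset.mem_inter.2 ⟨hyT, hyU⟩, (hc y hyT).ne'⟩
  rw [← Finset.sum_inter_add_sum_sdiff T U] at h
  refine eq_zero_of_pair_self
    (pair_sum_KK (fun r hr => hR.orth r (hTR (Finset.mem_inter.1 hr).1)) c) ?_
  have h1 := congrArg (pair (∑ r ∈ T ∩ U, c r • r)) h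
  rw [map_add, map_zero, pair_sum_sum _ (T \ U)] at h1
  have h2 : ∑ r ∈ T ∩ U, ∑ s ∈ T \ U, c r * c s * pair r s = 0 := by
    refine Finset.sum_eq_zero fun r hr => Finset.sum_eq_zero fun s hs => ?_
    rw [Finset.mem_sdiff] at hs
    rw [hU.orth hR hUR (Finset.mem_inter.1 hr).2 (hTR hs.1) hs.2, mul_zero]
  rwa [h2, add_zero] at h1

lemma eq_zero_of_orth {I : Finset Lat} (hK : ∀ r ∈ I, pair r KK = 0) (hI : ¬ Dep I)
    (hc : I.card = 8) {z : Lat} (hzK : pair z KK = 0) (hz : ∀ r ∈ I, pair z r = 0) : z = 0 := by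
  by_contra hne
  have hzz : pair z z ≠ 0 := fun h => hne (eq_zero_of_pair_self hzK h)
  have hzI : z ∉ I := fun h => hzz (hz z h)
  obtain ⟨c, h, x, hx, hcx⟩ := dep_of_card (T := insert z I)
    (by simpa [hzK] using hK) (by rw [Finset.card_insert_of_notMem hzI, hc])
  rw [Finset.sum_insert hzI] at h
  have h1 := congrArg (pair z) h
  have h2 : ∑ r ∈ I, c r * pair z r = 0 :=
    Finset.sum_eq_zero fun r hr => by rw [hz r hr, mul_zero]
  simp [h2, hzz, -zsmul_eq_mul] at h1
  refine hI ⟨c, by simpa [h1, -zsmul_eq_mul] using h, x, ?_, hcx⟩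
  rcases Finset.mem_insert.1 hx with rfl | h
  · exact absurd h1 hcx
  · exact h

/-- Mutually orthogonal pairs `r i, s i` of type `A₂`, and vectors `x j` orthogonal to them,
which together span the complement of `KK` rationally. -/
structure IsFrame {κ ι : Type} (r s : κ → Lat) (x : ι → Lat) : Prop where
  r_KK : ∀ i, pair (r i) KK = 0
  s_KK : ∀ i, pair (s i) KK = 0
  x_KK : ∀ j, pair (x j) KK = 0
  rr : ∀ i, pair (r i) (r i) = 2
  ss : ∀ i, pair (s i) (s i) = 2
  rs : ∀ i, pair (r i) (s i) = -1
  r_r : ∀ i j, i ≠ j → pair (r i) (r j) = 0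
  s_s : ∀ i j, i ≠ j → pair (s i) (s j) = 0
  r_s : ∀ i j, i ≠ j → pair (r i) (s j) = 0
  r_x : ∀ i j, pair (r i) (x j) = 0
  s_x : ∀ i j, pair (s i) (x j) = 0
  span : ∀ z, pair z KK = 0 → (∀ i, pair z (r i) = 0) → (∀ i, pair z (s i) = 0) →
    (∀ j, pair z (x j) = 0) → z = 0

/-- The Gram matrix of a family. -/
def gram {ι : Type} (x : ι → Lat) : Matrix ι ι ℤ := Matrix.of fun i j => pair (x i) (x j)

lemma exists_proj {ι : Type} [Fintype ι] [DecidableEq ι] (x : ι → Lat) (v : Lat) :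
    ∃ p, (∀ j, pair p (x j) = (gram x).det * pair v (x j)) ∧
      ∀ y, (∀ j, pair (x j) y = 0) → pair p y = 0 := by
  set h : ι → ℤ := fun j => pair v (x j) with hh
  refine ⟨∑ i, ((gram x).adjugate.mulVec h) i • x i, fun k => ?_, fun y hy => ?_⟩
  · have h1 : (gram x).mulVec ((gram x).adjugate.mulVec h) = (gram x).det • h := by
      rw [Matrix.mulVec_mulVec, Matrix.mul_adjugate, Matrix.smul_mulVec, Matrix.one_mulVec]
    have h2 := congrFun h1 k
    rw [Pi.smul_apply, smul_eq_mul] at h2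
    rw [← h2]
    simp only [map_sum, LinearMap.sum_apply, map_smul, LinearMap.smul_apply, smul_eq_mul]
    rw [Matrix.mulVec, dotProduct]
    refine Finset.sum_congr rfl fun i _ => ?_
    rw [pair_comm (x i)]
    simp only [gram, Matrix.of_apply]
    ring
  · simp only [map_sum, LinearMap.sum_apply, map_smul, LinearMap.smul_apply, smul_eq_mul]
    exact Finset.sum_eq_zero fun i _ => by rw [hy, mul_zero]

namespace IsFrame

variable {κ ι : Type} {r s : κ → Lat} {x : ι → Lat}

lemma s_r (h : IsFrame r s x) (i j : κ) (hij : i ≠ j) : pair (s i) (r j) = 0 := by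
  rw [pair_comm]; exact h.r_s j i hij.symm

lemma sr (h : IsFrame r s x) (i : κ) : pair (s i) (r i) = -1 := by
  rw [pair_comm]; exact h.rs i

variable [Fintype κ]

/-- Three times the projection of `v` to the span of the `A₂` pairs. -/
def proj (r s : κ → Lat) (v : Lat) : Lat :=
  ∑ i, ((2 * pair v (r i) + pair v (s i)) • r i + (pair v (r i) + 2 * pair v (s i)) • s i)

lemma pair_proj (v y : Lat) : pair (proj r s v) y =
    ∑ i, ((2 * pair v (r i) + pair v (s i)) * pair (r i) y
      + (pair v (r i) + 2 * pair v (s i)) * pair (s i) y) := by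
  simp only [proj, map_sum, map_add, LinearMap.sum_apply, map_smul, LinearMap.add_apply,
    LinearMap.smul_apply, smul_eq_mul]

lemma pair_proj_r (h : IsFrame r s x) (v : Lat) (k : κ) :
    pair (proj r s v) (r k) = 3 * pair v (r k) := by
  classical
  rw [pair_proj, Finset.sum_eq_single k]
  · rw [h.rr, h.sr]; ring
  · intro i _ hik
    rw [h.r_r i k hik, h.s_r i k hik]; ring
  · simp

lemma pair_proj_s (h : IsFrame r s x) (v : Lat) (k : κ) :
    pair (proj r s v) (s k) = 3 * pair v (s k) := by
  classical
  rw [pair_proj, Finset.sum_eq_single k]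
  · rw [h.rs, h.ss]; ring
  · intro i _ hik
    rw [h.r_s i k hik, h.s_s i k hik]; ring
  · simp

lemma pair_proj_eq_zero (v : Lat) {y : Lat} (hr : ∀ i, pair (r i) y = 0)
    (hs : ∀ i, pair (s i) y = 0) : pair (proj r s v) y = 0 := by
  rw [pair_proj]
  exact Finset.sum_eq_zero fun i _ => by rw [hr, hs]; ring

lemma pair_proj_self (v : Lat) : pair (proj r s v) v =
    2 * ∑ i, (pair v (r i) - pair v (s i)) ^ 2 + 3 * ∑ i, 2 * (pair v (r i) * pair v (s i)) := by
  rw [pair_proj, Finset.mul_sum, Finset.mul_sum, ← Finset.sum_add_distrib]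
  refine Finset.sum_congr rfl fun i _ => ?_
  rw [pair_comm (r i) v, pair_comm (s i) v]; ring

lemma three_dvd [Fintype ι] [DecidableEq ι] (h : IsFrame r s x) {v : Lat} (hv : pair v KK = 0) :
    3 ∣ (gram x).det * ∑ i, (pair v (r i) - pair v (s i)) ^ 2 := by
  obtain ⟨p, hp, hp0⟩ := exists_proj x v
  set D := (gram x).det
  have hz : (3 * D) • v - D • proj r s v - (3 : ℤ) • p = 0 := by
    apply h.span
    · simp only [map_sub, map_smul, LinearMap.sub_apply, LinearMap.smul_apply, smul_eq_mul, hv,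
        pair_proj_eq_zero v h.r_KK h.s_KK, hp0 _ h.x_KK]
      ring
    · intro i
      simp only [map_sub, map_smul, LinearMap.sub_apply, LinearMap.smul_apply, smul_eq_mul,
        h.pair_proj_r, hp0 (r i) fun j => by rw [pair_comm]; exact h.r_x i j]
      ring
    · intro i
      simp only [map_sub, map_smul, LinearMap.sub_apply, LinearMap.smul_apply, smul_eq_mul,
        h.pair_proj_s, hp0 (s i) fun j => by rw [pair_comm]; exact h.s_x i j]
      ring
    · intro j
      simp only [map_sub, map_smul, LinearMap.sub_apply, LinearMap.smul_apply, smul_eq_mul,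
        pair_proj_eq_zero v (fun i => h.r_x i j) (fun i => h.s_x i j), hp]
      ring
  have h1 := congrArg (fun z => pair z v) hz
  simp only [map_sub, map_smul, LinearMap.sub_apply, LinearMap.smul_apply, smul_eq_mul,
    pair_proj_self, map_zero, LinearMap.zero_apply] at h1
  rw [mul_add, mul_left_comm D 2, mul_left_comm D 3, mul_assoc] at h1
  omega

lemma exists_glue [IsEmpty ι] (h : IsFrame r s x) {v : Lat} (hv : pair v KK = 0) :
    ∃ w, (3 : ℤ) • w = ∑ i, (pair v (r i) - pair v (s i)) • (r i - s i) := by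
  have hz : (3 : ℤ) • v - proj r s v = 0 := by
    apply h.span
    · simp only [map_sub, map_smul, LinearMap.sub_apply, LinearMap.smul_apply, smul_eq_mul, hv,
        pair_proj_eq_zero v h.r_KK h.s_KK]
      ring
    · intro i
      simp only [map_sub, map_smul, LinearMap.sub_apply, LinearMap.smul_apply, smul_eq_mul,
        h.pair_proj_r]
      ring
    · intro i
      simp only [map_sub, map_smul, LinearMap.sub_apply, LinearMap.smul_apply, smul_eq_mul,
        h.pair_proj_s]
      ring
    · exact fun j => isEmptyElim j
  refine ⟨∑ i, (pair v (r i) • r i + pair v (s i) • s i) - v, ?_⟩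
  rw [smul_sub, sub_eq_zero.1 hz, proj, Finset.smul_sum, ← Finset.sum_sub_distrib]
  refine Finset.sum_congr rfl fun i _ => ?_
  module

end IsFrame

/-- A vector pairing to a coordinate, up to sign. -/
lemma exists_coord (i : Fin 9) : ∃ e : Lat, ∀ u, pair e u = u i := by
  refine Fin.cases ⟨Pi.single 0 (-1), fun u => ?_⟩
    (fun j => ⟨Pi.single j.succ 1, fun u => ?_⟩) i
  · simp [pair_apply, dot]
  · simp [pair_apply, dot, Pi.single_apply, Fin.succ_inj]

lemma exists_orth_KK (v : Lat) :
    ∃ v', pair v' KK = 0 ∧ ∀ u, pair u KK = 0 → pair v' u = pair v u := by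
  refine ⟨v + pair v KK • KK, ?_, fun u hu => ?_⟩
  · simp [pair_KK, -zsmul_eq_mul]
  · simp [pair_comm KK u, hu, -zsmul_eq_mul]

lemma nine_dvd_of_three_dvd_coord {u : Lat} (h : ∀ i, (3 : ℤ) ∣ u i) : 9 ∣ pair u u := by
  choose f hf using h
  obtain rfl : u = (3 : ℤ) • f := by
    funext i; simp [hf]
  exact ⟨pair f f, by simp [-zsmul_eq_mul]; ring⟩

lemma exists_not_three_dvd {u : Lat} (huK : pair u KK = 0) (hu : pair u u = 6) :
    ∃ v, pair v KK = 0 ∧ ¬ 3 ∣ pair v u := by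
  by_contra! hc
  have := nine_dvd_of_three_dvd_coord (u := u) fun i => by
    obtain ⟨e, he⟩ := exists_coord i
    obtain ⟨v, hv, hvu⟩ := exists_orth_KK e
    rw [← he u, ← hvu u huK]
    exact hc v hv
  omega

lemma exists_pair_emod {u w : Lat} (huK : pair u KK = 0) (hwK : pair w KK = 0)
    (hu : pair u u = 6) (hw : pair w w = 6) (huw : pair u w = 0) :
    ∃ v, pair v KK = 0 ∧ pair v u % 3 = 1 ∧ pair v w = 0 := by
  have key : ∃ i j, ¬ (3 : ℤ) ∣ u i * w j - u j * w i := by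
    by_contra! hc
    obtain ⟨i, hi⟩ : ∃ i, ¬ (3 : ℤ) ∣ u i := by
      by_contra! h
      have := nine_dvd_of_three_dvd_coord h
      omega
    have h9 := nine_dvd_of_three_dvd_coord (u := w - (u i * w i) • u) fun j => by
      have h1 : (3 : ℤ) ∣ u i * u i - 1 := by
        have : u i % 3 = 1 ∨ u i % 3 = 2 := by omega
        rcases this with h | h <;> apply Int.dvd_of_emod_eq_zero <;>
          simp [Int.sub_emod, Int.mul_emod, h]
      have h2 : (w - (u i * w i) • u) j
          = u i * (u i * w j - u j * w i) - (u i * u i - 1) * w j := by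
        simp; ring
      rw [h2]
      exact dvd_sub ((hc i j).mul_left _) (h1.mul_right _)
    have h3 : pair (w - (u i * w i) • u) (w - (u i * w i) • u) = 6 + 6 * (u i * w i) ^ 2 := by
      simp [huw, pair_comm w u, hu, hw, -zsmul_eq_mul]; ring
    rw [h3] at h9
    generalize u i * w i = t at h9
    have h4 : (3 : ℤ) ∣ 1 + t ^ 2 := by omega
    have h5 : t % 3 = 0 ∨ t % 3 = 1 ∨ t % 3 = 2 := by omega
    have h6 := Int.emod_eq_zero_of_dvd h4
    rcases h5 with h | h | h <;> simp [Int.add_emod, pow_two, Int.mul_emod, h] at h6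
  obtain ⟨i, j, hij⟩ := key
  obtain ⟨e, he⟩ := exists_coord i
  obtain ⟨f, hf⟩ := exists_coord j
  obtain ⟨v, hv, hvu⟩ := exists_orth_KK (w j • e - w i • f)
  have h1 : pair v u = u i * w j - u j * w i := by
    rw [hvu u huK]; simp [he, hf, -zsmul_eq_mul]; ring
  have h2 : pair v w = 0 := by
    rw [hvu w hwK]; simp [he, hf, -zsmul_eq_mul]; ring
  rw [← h1] at hij
  by_cases h : pair v u % 3 = 1
  · exact ⟨v, hv, h, h2⟩
  · refine ⟨-v, by simp [hv], ?_, by simp [h2]⟩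
    simp; omega

lemma IsRootSet.pair_mem {R : Finset Lat} (hR : IsRootSet R) {r s : Lat} (hr : r ∈ R) (hs : s ∈ R)
    (h : r ≠ s) : pair r s = 0 ∨ pair r s = -1 := hR.prod r hr s hs h

lemma sum_three {M : Type} [AddCommMonoid M] {a b c : Lat} (f : Lat → M) (hab : a ≠ b)
    (hac : a ≠ c) (hbc : b ≠ c) : ∑ y ∈ ({a, b, c} : Finset Lat), f y = f a + (f b + f c) := by
  rw [Finset.sum_insert (by simp [hab, hac]), Finset.sum_pair hbc]

lemma IsCircuit.three_le_card {R T : Finset Lat} (hR : IsRootSet R) (hTR : T ⊆ R)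
    (hT : IsCircuit T) : 3 ≤ T.card := by
  obtain ⟨c, hc, h⟩ := hT.exists_pos hR hTR
  obtain ⟨-, -, x, hx, -⟩ := hT.dep
  by_contra! hlt
  have hpos := Finset.card_pos.2 ⟨x, hx⟩
  have hcase : T.card = 1 ∨ T.card = 2 := by omega
  rcases hcase with h1 | h2
  · obtain ⟨a, rfl⟩ := Finset.card_eq_one.1 h1
    have ha := congrArg (pair a) h
    have := hc a (by simp)
    simp [hR.norm a (hTR (by simp)), -zsmul_eq_mul] at ha
    omega
  · obtain ⟨a, b, hab, rfl⟩ := Finset.card_eq_two.1 h2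
    rw [Finset.sum_pair hab] at h
    have ha := congrArg (pair a) h
    have hb := congrArg (pair b) h
    have h1 := hc a (by simp)
    have h2 := hc b (by simp)
    have haR := hTR (show a ∈ ({a, b} : Finset Lat) by simp)
    have hbR := hTR (show b ∈ ({a, b} : Finset Lat) by simp)
    simp [hR.norm a haR, hR.norm b hbR, pair_comm b a, -zsmul_eq_mul] at ha hb
    rcases hR.pair_mem haR hbR hab with h3 | h3 <;> rw [h3] at ha hb <;> omega

lemma IsCircuit.of_card_eq_three {R T : Finset Lat} (hR : IsRootSet R) (hTR : T ⊆ R)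
    (hT : IsCircuit T) (h3 : T.card = 3) :
    ∃ r s, r ≠ s ∧ r ≠ -(r + s) ∧ s ≠ -(r + s) ∧ T = {r, s, -(r + s)} ∧ pair r s = -1 := by
  obtain ⟨c, hc, h⟩ := hT.exists_pos hR hTR
  obtain ⟨r, s, t, hrs, hrt, hst, rfl⟩ := Finset.card_eq_three.1 h3
  rw [sum_three _ hrs hrt hst] at h
  have hr := hTR (show r ∈ ({r, s, t} : Finset Lat) by simp)
  have hs := hTR (show s ∈ ({r, s, t} : Finset Lat) by simp)
  have ht := hTR (show t ∈ ({r, s, t} : Finset Lat) by simp)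
  have er := congrArg (pair r) h
  have es := congrArg (pair s) h
  have et := congrArg (pair t) h
  have cr := hc r (by simp)
  have cs := hc s (by simp)
  have ct := hc t (by simp)
  simp only [map_add, map_smul, smul_eq_mul, map_zero, hR.norm r hr, hR.norm s hs,
    hR.norm t ht, pair_comm s r, pair_comm t r, pair_comm t s] at er es et
  have key : pair r s = -1 ∧ pair r t = -1 ∧ pair s t = -1 := by
    rcases hR.pair_mem hr hs hrs with h1 | h1 <;> rcases hR.pair_mem hr ht hrt with h2 | h2 <;>
      rcases hR.pair_mem hs ht hst with h3 | h3 <;> rw [h1, h2] at er <;> rw [h1, h3] at es <;>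
      rw [h2, h3] at et <;> first | exact ⟨h1, h2, h3⟩ | (exfalso; omega)
  obtain ⟨k1, k2, k3⟩ := key
  have hsum : r + s + t = 0 := by
    refine eq_zero_of_pair_self ?_ ?_
    · simp [hR.orth r hr, hR.orth s hs, hR.orth t ht]
    · simp [hR.norm r hr, hR.norm s hs, hR.norm t ht, pair_comm s r, pair_comm t r, pair_comm t s,
        k1, k2, k3]
  obtain rfl : t = -(r + s) := (neg_eq_of_add_eq_zero_right hsum).symm
  exact ⟨r, s, hrs, hrt, hst, rfl, k1⟩

lemma card_eq_four {T : Finset Lat} (h : T.card = 4) : ∃ a b c d, a ≠ b ∧ a ≠ c ∧ a ≠ d ∧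
    b ≠ c ∧ b ≠ d ∧ c ≠ d ∧ T = {a, b, c, d} := by
  obtain ⟨a, U, haU, rfl, hU⟩ := Finset.card_eq_succ.1 h
  obtain ⟨b, c, d, hbc, hbd, hcd, rfl⟩ := Finset.card_eq_three.1 hU
  simp only [Finset.mem_insert, Finset.mem_singleton, not_or] at haU
  exact ⟨a, b, c, d, haU.1, haU.2.1, haU.2.2, hbc, hbd, hcd, rfl⟩

lemma IsCircuit.of_card_eq_four {R T : Finset Lat} (hR : IsRootSet R) (hTR : T ⊆ R)
    (hT : IsCircuit T) (h4 : T.card = 4) :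
    ∃ a b c d, a ≠ d ∧ b ≠ d ∧ c ≠ d ∧ T = {a, b, c, d} ∧ ¬ 3 ∣ (gram ![a, b, c]).det := by
  obtain ⟨f, hf, h⟩ := hT.exists_pos hR hTR
  obtain ⟨a, b, c, d, hab, hac, had, hbc, hbd, hcd, rfl⟩ := card_eq_four h4
  refine ⟨a, b, c, d, had, hbd, hcd, rfl, ?_⟩
  rw [Finset.sum_insert (by simp [hab, hac, had]), sum_three _ hbc hbd hcd] at h
  have ha := hTR (show a ∈ ({a, b, c, d} : Finset Lat) by simp)
  have hb := hTR (show b ∈ ({a, b, c, d} : Finset Lat) by simp)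
  have hc := hTR (show c ∈ ({a, b, c, d} : Finset Lat) by simp)
  have hd := hTR (show d ∈ ({a, b, c, d} : Finset Lat) by simp)
  have ea := congrArg (pair a) h
  have eb := congrArg (pair b) h
  have ec := congrArg (pair c) h
  have ed := congrArg (pair d) h
  have fa := hf a (by simp)
  have fb := hf b (by simp)
  have fc := hf c (by simp)
  have fd := hf d (by simp)
  simp only [map_add, map_smul, smul_eq_mul, map_zero, hR.norm a ha, hR.norm b hb,
    hR.norm c hc, hR.norm d hd, pair_comm b a, pair_comm c a, pair_comm c b,
    pair_comm d a, pair_comm d b, pair_comm d c] at ea eb ec ed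
  have hdet : (gram ![a, b, c]).det = 8 + 2 * pair a b * pair b c * pair a c
      - 2 * (pair a b ^ 2 + pair b c ^ 2 + pair a c ^ 2) := by
    rw [Matrix.det_fin_three]
    simp [gram, hR.norm a ha, hR.norm b hb, hR.norm c hc, pair_comm b a, pair_comm c a,
      pair_comm c b]
    ring
  rw [hdet]
  rcases hR.pair_mem ha hb hab with h1 | h1 <;> rcases hR.pair_mem hb hc hbc with h2 | h2 <;>
    rcases hR.pair_mem ha hc hac with h3 | h3 <;> rw [h1, h3] at ea <;> rw [h1, h2] at eb <;>
    rw [h2, h3] at ec <;> rw [h1, h2, h3] <;> first | norm_num; done | skip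
  all_goals
    rcases hR.pair_mem ha hd had with h4 | h4 <;> rcases hR.pair_mem hb hd hbd with h5 | h5 <;>
      rcases hR.pair_mem hc hd hcd with h6 | h6 <;> rw [h4] at ea <;> rw [h5] at eb <;>
      rw [h6] at ec <;> rw [h4, h5, h6] at ed <;> omega

lemma exists_circuits {R : Finset Lat} (hR : IsRootSet R) (hc : R.card = 11) :
    ∃ T₁ T₂ T₃, (T₁ ⊆ R ∧ T₂ ⊆ R ∧ T₃ ⊆ R) ∧ (IsCircuit T₁ ∧ IsCircuit T₂ ∧ IsCircuit T₃) ∧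
      (Disjoint T₁ T₂ ∧ Disjoint T₁ T₃ ∧ Disjoint T₂ T₃) ∧
      T₁.card = 3 ∧ (T₂.card = 3 ∨ T₂.card = 4 ∧ T₃.card = 4) ∧
      ∀ x₁ ∈ T₁, ∀ x₂ ∈ T₂, ∀ x₃ ∈ T₃, ¬ Dep (((R.erase x₁).erase x₂).erase x₃) := by
  have hdep : ∀ X ⊆ R, 9 ≤ X.card → Dep X := fun X hX h =>
    dep_of_card (fun r hr => hR.orth r (hX hr)) h
  have aux : ∀ T ⊆ R, ∀ U ⊆ R, IsCircuit T → IsCircuit U → ∀ x ∈ T, x ∉ U → Disjoint T U :=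
    fun T hT U hU cT cU x hx hxU => cT.disjoint hR hT hU cU hx hxU
  have hne : ∀ T, IsCircuit T → ∃ x, x ∈ T := fun T hT => by
    obtain ⟨-, -, x, hx, -⟩ := hT.dep
    exact ⟨x, hx⟩
  obtain ⟨T, hT, cT⟩ := (hdep R subset_rfl (by omega)).exists_isCircuit
  obtain ⟨x, hx⟩ := hne T cT
  have c1 := Finset.card_erase_add_one (hT hx)
  have s1 : R.erase x ⊆ R := Finset.erase_subset _ _
  obtain ⟨U, hU, cU⟩ := (hdep (R.erase x) s1 (by omega)).exists_isCircuit
  have dTU := aux T hT U (hU.trans s1) cT cU x hx fun h => by simpa using hU h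
  obtain ⟨y, hy⟩ := hne U cU
  have c2 := Finset.card_erase_add_one (hU hy)
  have s2 : (R.erase x).erase y ⊆ R := (Finset.erase_subset _ _).trans s1
  obtain ⟨V, hV, cV⟩ := (hdep ((R.erase x).erase y) s2 (by omega)).exists_isCircuit
  have dTV := aux T hT V (hV.trans s2) cT cV x hx fun h => by simpa using hV h
  have dUV := aux U (hU.trans s1) V (hV.trans s2) cU cV y hy fun h => by simpa using hV h
  replace hU := hU.trans s1
  replace hV := hV.trans s2
  have dTU_V : Disjoint (T ∪ U) V := Finset.disjoint_union_left.2 ⟨dTV, dUV⟩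
  have hle := Finset.card_le_card (Finset.union_subset (Finset.union_subset hT hU) hV)
  rw [Finset.card_union_of_disjoint dTU_V, Finset.card_union_of_disjoint dTU] at hle
  have hind : ∀ x₁ ∈ T, ∀ x₂ ∈ U, ∀ x₃ ∈ V, ¬ Dep (((R.erase x₁).erase x₂).erase x₃) := by
    intro x₁ h₁ x₂ h₂ x₃ h₃ hD
    obtain ⟨W, hW, cW⟩ := hD.exists_isCircuit
    have hWR : W ⊆ R := fun w hw => by
      have := hW hw
      simp only [Finset.mem_erase] at this
      exact this.2.2.2
    have e1 := aux T hT W hWR cT cW x₁ h₁ fun h => by simpa using hW h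
    have e2 := aux U hU W hWR cU cW x₂ h₂ fun h => by simpa using hW h
    have e3 := aux V hV W hWR cV cW x₃ h₃ fun h => by simpa using hW h
    have hd : Disjoint (T ∪ U ∪ V) W :=
      Finset.disjoint_union_left.2 ⟨Finset.disjoint_union_left.2 ⟨e1, e2⟩, e3⟩
    have hle := Finset.card_le_card
      (Finset.union_subset (Finset.union_subset (Finset.union_subset hT hU) hV) hWR)
    rw [Finset.card_union_of_disjoint hd, Finset.card_union_of_disjoint dTU_V,
      Finset.card_union_of_disjoint dTU] at hle
    have := cT.three_le_card hR hT
    have := cU.three_le_card hR hU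
    have := cV.three_le_card hR hV
    have := cW.three_le_card hR hWR
    omega
  have hTc := cT.three_le_card hR hT
  have hUc := cU.three_le_card hR hU
  have hVc := cV.three_le_card hR hV
  have hcomm : ∀ a b c : Lat, ((R.erase a).erase b).erase c = ((R.erase b).erase a).erase c :=
    fun a b c => by rw [Finset.erase_right_comm (a := a) (b := b)]
  have hcomm' : ∀ a b c : Lat, ((R.erase a).erase b).erase c = ((R.erase a).erase c).erase b :=
    fun a b c => Finset.erase_right_comm
  by_cases t3 : T.card = 3
  · by_cases u3 : U.card = 3
    · exact ⟨T, U, V, ⟨hT, hU, hV⟩, ⟨cT, cU, cV⟩, ⟨dTU, dTV, dUV⟩, t3, .inl u3, hind⟩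
    · exact ⟨T, V, U, ⟨hT, hV, hU⟩, ⟨cT, cV, cU⟩, ⟨dTV, dTU, dUV.symm⟩, t3, by omega,
        fun a ha b hb c hc => by rw [hcomm']; exact hind a ha c hc b hb⟩
  · by_cases u3 : U.card = 3
    · by_cases v3 : V.card = 3
      · exact ⟨U, V, T, ⟨hU, hV, hT⟩, ⟨cU, cV, cT⟩, ⟨dUV, dTU.symm, dTV.symm⟩, u3, .inl v3,
          fun a ha b hb c hc => by rw [hcomm', hcomm]; exact hind c hc a ha b hb⟩
      · exact ⟨U, T, V, ⟨hU, hT, hV⟩, ⟨cU, cT, cV⟩, ⟨dTU.symm, dUV, dTV⟩, u3, by omega,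
          fun a ha b hb c hc => by rw [hcomm]; exact hind b hb a ha c hc⟩
    · exact ⟨V, T, U, ⟨hV, hT, hU⟩, ⟨cV, cT, cU⟩, ⟨dTV.symm, dUV.symm, dTU⟩, by omega, by omega,
        fun a ha b hb c hc => by rw [hcomm, hcomm']; exact hind b hb c hc a ha⟩

lemma card_erase_three {R T₁ T₂ T₃ : Finset Lat} (h₁ : T₁ ⊆ R) (h₂ : T₂ ⊆ R) (h₃ : T₃ ⊆ R)
    (d₁₂ : Disjoint T₁ T₂) (d₁₃ : Disjoint T₁ T₃) (d₂₃ : Disjoint T₂ T₃) {x y z : Lat}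
    (hx : x ∈ T₁) (hy : y ∈ T₂) (hz : z ∈ T₃) :
    (((R.erase x).erase y).erase z).card = R.card - 3 := by
  rw [Finset.card_erase_of_mem, Finset.card_erase_of_mem, Finset.card_erase_of_mem (h₁ hx)]
  · rfl
  · exact Finset.mem_erase.2 ⟨fun h => Finset.disjoint_left.1 d₁₂ hx (h ▸ hy), h₂ hy⟩
  · exact Finset.mem_erase.2 ⟨fun h => Finset.disjoint_left.1 d₂₃ hy (h ▸ hz),
      Finset.mem_erase.2 ⟨fun h => Finset.disjoint_left.1 d₁₃ hx (h ▸ hz), h₃ hz⟩⟩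

lemma false_of_three_four_four {R T₁ T₂ T₃ : Finset Lat} (hR : IsRootSet R) (hc : R.card = 11)
    (h₁ : T₁ ⊆ R) (h₂ : T₂ ⊆ R) (h₃ : T₃ ⊆ R)
    (c₁ : IsCircuit T₁) (c₂ : IsCircuit T₂) (c₃ : IsCircuit T₃)
    (d₁₂ : Disjoint T₁ T₂) (d₁₃ : Disjoint T₁ T₃) (d₂₃ : Disjoint T₂ T₃)
    (k₁ : T₁.card = 3) (k₂ : T₂.card = 4) (k₃ : T₃.card = 4)
    (hind : ∀ x₁ ∈ T₁, ∀ x₂ ∈ T₂, ∀ x₃ ∈ T₃, ¬ Dep (((R.erase x₁).erase x₂).erase x₃)) :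
    False := by
  have hdisj : Disjoint (T₁ ∪ T₂) T₃ := Finset.disjoint_union_left.2 ⟨d₁₃, d₂₃⟩
  have hunion : T₁ ∪ T₂ ∪ T₃ = R := by
    refine Finset.eq_of_subset_of_card_le
      (Finset.union_subset (Finset.union_subset h₁ h₂) h₃) ?_
    rw [Finset.card_union_of_disjoint hdisj, Finset.card_union_of_disjoint d₁₂]
    omega
  have o₁₂ : ∀ y ∈ T₁, ∀ z ∈ T₂, pair y z = 0 := fun y hy z hz =>
    c₁.orth hR h₁ hy (h₂ hz) (Finset.disjoint_right.1 d₁₂ hz)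
  have o₁₃ : ∀ y ∈ T₁, ∀ z ∈ T₃, pair y z = 0 := fun y hy z hz =>
    c₁.orth hR h₁ hy (h₃ hz) (Finset.disjoint_right.1 d₁₃ hz)
  have o₂₃ : ∀ y ∈ T₂, ∀ z ∈ T₃, pair y z = 0 := fun y hy z hz =>
    c₂.orth hR h₂ hy (h₃ hz) (Finset.disjoint_right.1 d₂₃ hz)
  obtain ⟨r, s, hrs, hrt, hst, e₁, prs⟩ := c₁.of_card_eq_three hR h₁ k₁
  obtain ⟨a, b, c, d, had, hbd, hcd, e₂, hdet₂⟩ := c₂.of_card_eq_four hR h₂ k₂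
  obtain ⟨a', b', c', d', had', hbd', hcd', e₃, hdet₃⟩ := c₃.of_card_eq_four hR h₃ k₃
  have hI := hind (-(r + s)) (by simp [e₁]) d (by simp [e₂]) d' (by simp [e₃])
  have hrm : r ∈ T₁ := by simp [e₁]
  have hsm : s ∈ T₁ := by simp [e₁]
  have htm : -(r + s) ∈ T₁ := by simp [e₁]
  have hdm : d ∈ T₂ := by simp [e₂]
  have hdm' : d' ∈ T₃ := by simp [e₃]
  have hx : ∀ i, ![a, b, c] i ∈ T₂ := by simp [e₂, Fin.forall_fin_succ]
  have hx' : ∀ i, ![a', b', c'] i ∈ T₃ := by simp [e₃, Fin.forall_fin_succ]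
  have hIcard : (((R.erase (-(r + s))).erase d).erase d').card = 8 := by
    rw [card_erase_three h₁ h₂ h₃ d₁₂ d₁₃ d₂₃ htm hdm hdm', hc]
  have hF : IsFrame (fun _ : Fin 1 => r) (fun _ => s) (Sum.elim ![a, b, c] ![a', b', c']) := by
    refine ⟨fun _ => hR.orth _ (h₁ hrm), fun _ => hR.orth _ (h₁ hsm), ?_,
      fun _ => hR.norm _ (h₁ hrm), fun _ => hR.norm _ (h₁ hsm), fun _ => prs, fun i j h => absurd (Subsingleton.elim i j) h,
      fun i j h => absurd (Subsingleton.elim i j) h,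
      fun i j h => absurd (Subsingleton.elim i j) h, fun _ => ?_, fun _ => ?_, ?_⟩
    · rintro (j | j)
      exacts [hR.orth _ (h₂ (hx j)), hR.orth _ (h₃ (hx' j))]
    · rintro (j | j)
      exacts [o₁₂ _ hrm _ (hx j), o₁₃ _ hrm _ (hx' j)]
    · rintro (j | j)
      exacts [o₁₂ _ hsm _ (hx j), o₁₃ _ hsm _ (hx' j)]
    · intro z hz zr zs zx
      refine eq_zero_of_orth ?_ hI hIcard hz ?_
      · intro y hy
        simp only [Finset.mem_erase] at hy
        exact hR.orth y hy.2.2.2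
      · intro y hy
        simp only [Finset.mem_erase, ← hunion, Finset.mem_union, e₁, e₂, e₃, Finset.mem_insert,
          Finset.mem_singleton] at hy
        obtain ⟨n₁, n₂, n₃, ((h | h | h) | h | h | h | h) | h | h | h | h⟩ := hy
        · rw [h]; exact zr 0
        · rw [h]; exact zs 0
        · exact absurd h n₃
        · rw [h]; exact zx (.inl 0)
        · rw [h]; exact zx (.inl 1)
        · rw [h]; exact zx (.inl 2)
        · exact absurd h n₂
        · rw [h]; exact zx (.inr 0)
        · rw [h]; exact zx (.inr 1)
        · rw [h]; exact zx (.inr 2)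
        · exact absurd h n₁
  obtain ⟨v, hv, hvu⟩ := exists_not_three_dvd (u := r - s)
    (by simp [hR.orth _ (h₁ hrm), hR.orth _ (h₁ hsm)])
    (by simp [hR.norm _ (h₁ hrm), hR.norm _ (h₁ hsm), pair_comm s r, prs])
  have h := hF.three_dvd hv
  have hblock : gram (Sum.elim ![a, b, c] ![a', b', c']) =
      Matrix.fromBlocks (gram ![a, b, c]) 0 0 (gram ![a', b', c']) := by
    ext (i | i) (j | j)
    · rfl
    · exact o₂₃ _ (hx i) _ (hx' j)
    · exact (pair_comm _ _).trans (o₂₃ _ (hx j) _ (hx' i))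
    · rfl
  rw [hblock, Matrix.det_fromBlocks_zero₁₂, Fin.sum_univ_one, ← map_sub] at h
  rcases Int.prime_three.dvd_or_dvd h with h | h
  · rcases Int.prime_three.dvd_or_dvd h with h | h
    exacts [hdet₂ h, hdet₃ h]
  · exact hvu (Int.prime_three.dvd_of_dvd_pow h)

lemma forall_fin_ne_iff {n : ℕ} {P : Fin n → Fin n → Prop} (hs : ∀ i j, P i j → P j i)
    (h : ∀ i j, i < j → P i j) : ∀ i j, i ≠ j → P i j := fun i j hij =>
  (lt_or_gt_of_ne hij).elim (h i j) fun hlt => hs _ _ (h j i hlt)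

/-- Two orthogonal `A₂` pairs and four more roots orthogonal to them, spanning rationally. -/
structure IsOcta (r s : Fin 2 → Lat) (a b c d : Lat) : Prop where
  frame : IsFrame r s ![a, b, c, d]
  aa : pair a a = 2
  bb : pair b b = 2
  cc : pair c c = 2
  dd : pair d d = 2

namespace IsOcta

variable {r s : Fin 2 → Lat} {a b c d : Lat}

lemma three_dvd_det (h : IsOcta r s a b c d) : 3 ∣ (gram ![a, b, c, d]).det := by
  have hF := h.frame
  have h01 : (0 : Fin 2) ≠ 1 := by decide
  obtain ⟨v, hv, hvu⟩ := exists_not_three_dvd (u := r 0 - s 0)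
    (by simp [hF.r_KK, hF.s_KK]) (by simp [hF.rr, hF.ss, hF.rs, hF.sr])
  have h := hF.three_dvd hv
  rw [Fin.sum_univ_two, ← map_sub] at h
  refine (Int.prime_three.dvd_or_dvd h).resolve_right fun h => ?_
  generalize pair v (r 0 - s 0) = x at h hvu
  generalize pair v (r 1) - pair v (s 1) = y at h
  have hx : x % 3 = 1 ∨ x % 3 = 2 := by omega
  have hy : y % 3 = 0 ∨ y % 3 = 1 ∨ y % 3 = 2 := by omega
  have h' := Int.emod_eq_zero_of_dvd h
  rcases hx with hx | hx <;> rcases hy with hy | hy | hy <;>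
    simp [Int.add_emod, pow_two, Int.mul_emod, hx, hy] at h'

lemma perm (h : IsOcta r s a b c d) (σ : Equiv.Perm (Fin 4)) :
    IsOcta r s (![a, b, c, d] (σ 0)) (![a, b, c, d] (σ 1)) (![a, b, c, d] (σ 2))
      (![a, b, c, d] (σ 3)) := by
  have hx : ![![a, b, c, d] (σ 0), ![a, b, c, d] (σ 1), ![a, b, c, d] (σ 2), ![a, b, c, d] (σ 3)]
      = fun j => ![a, b, c, d] (σ j) := by
    funext j; fin_cases j <;> rfl
  have hn : ∀ j, pair (![a, b, c, d] j) (![a, b, c, d] j) = 2 := by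
    simp [Fin.forall_fin_succ, h.aa, h.bb, h.cc, h.dd]
  have hF := h.frame
  refine ⟨⟨hF.r_KK, hF.s_KK, ?_, hF.rr, hF.ss, hF.rs, hF.r_r, hF.s_s, hF.r_s, ?_, ?_, ?_⟩,
    hn _, hn _, hn _, hn _⟩ <;> rw [hx]
  · exact fun j => hF.x_KK _
  · exact fun i j => hF.r_x _ _
  · exact fun i j => hF.s_x _ _
  · exact fun z h1 h2 h3 h4 => hF.span z h1 h2 h3 fun j => by simpa using h4 (σ.symm j)

lemma swap₁₂ (h : IsOcta r s a b c d) : IsOcta r s b a c d := h.perm (Equiv.swap 0 1)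

lemma swap₂₃ (h : IsOcta r s a b c d) : IsOcta r s a c b d := h.perm (Equiv.swap 1 2)

lemma swap₃₄ (h : IsOcta r s a b c d) : IsOcta r s a b d c := h.perm (Equiv.swap 2 3)

/-- The pair `a, b` extends the frame to three `A₂` pairs. -/
lemma frame_three (h : IsOcta r s a b c d) (hab : pair a b = -1) (hac : pair a c = 0)
    (had : pair a d = 0) (hbc : pair b c = 0) (hbd : pair b d = 0) :
    IsFrame ![r 0, r 1, a] ![s 0, s 1, b] ![c, d] := by
  have hF := h.frame
  have e1 := hF.x_KK
  have e2 := hF.r_x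
  have e3 := hF.s_x
  have h01 : (0 : Fin 2) ≠ 1 := by decide
  have e4 := hF.r_r 0 1 h01
  have e5 := hF.s_s 0 1 h01
  have e6 := hF.r_s 0 1 h01
  have e7 := hF.r_s 1 0 h01.symm
  simp [Fin.forall_fin_succ] at e1 e2 e3
  obtain ⟨⟨f0, f1, f2, f3⟩, g0, g1, g2, g3⟩ := e2
  obtain ⟨⟨p0, p1, p2, p3⟩, q0, q1, q2, q3⟩ := e3
  refine ⟨?_, ?_, ?_, ?_, ?_, ?_, ?_, ?_, ?_, ?_, ?_, ?_⟩
  · simp [Fin.forall_fin_succ, hF.r_KK, e1]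
  · simp [Fin.forall_fin_succ, hF.s_KK, e1]
  · simp [Fin.forall_fin_succ, e1]
  · simp [Fin.forall_fin_succ, hF.rr, h.aa]
  · simp [Fin.forall_fin_succ, hF.ss, h.bb]
  · simp [Fin.forall_fin_succ, hF.rs, hab]
  · refine forall_fin_ne_iff (fun i j h => by rw [pair_comm, h]) ?_
    simp [Fin.forall_fin_succ, *]
  · refine forall_fin_ne_iff (fun i j h => by rw [pair_comm, h]) ?_
    simp [Fin.forall_fin_succ, *]
  · simp [Fin.forall_fin_succ, pair_comm a (s _), *]
  · simp [Fin.forall_fin_succ, *]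
  · simp [Fin.forall_fin_succ, *]
  · intro z h1 h2 h3 h4
    simp [Fin.forall_fin_succ] at h2 h3 h4
    refine hF.span z h1 ?_ ?_ ?_
    · simp [Fin.forall_fin_succ, h2]
    · simp [Fin.forall_fin_succ, h3]
    · simp [Fin.forall_fin_succ, h2, h3, h4]

/-- The configuration `A₂³ + A₁²` does not occur. -/
lemma false_of_isolated (h : IsOcta r s a b c d) (hab : pair a b = -1) (hac : pair a c = 0)
    (had : pair a d = 0) (hbc : pair b c = 0) (hbd : pair b d = 0) (hcd : pair c d = 0) :
    False := by
  have hF := h.frame_three hab hac had hbc hbd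
  have hG := h.frame
  have h01 : (0 : Fin 2) ≠ 1 := by decide
  obtain ⟨v, hv, h1, h2⟩ := exists_pair_emod (u := r 0 - s 0) (w := r 1 - s 1)
    (by simp [hG.r_KK, hG.s_KK]) (by simp [hG.r_KK, hG.s_KK])
    (by simp [hG.rr, hG.ss, hG.rs, hG.sr])
    (by simp [hG.rr, hG.ss, hG.rs, hG.sr])
    (by simp [hG.r_r 0 1 h01, hG.s_s 0 1 h01, hG.r_s 0 1 h01, hG.s_r 0 1 h01])
  have h3 := hF.three_dvd hv
  have hdet : (gram ![c, d]).det = 4 := by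
    rw [Matrix.det_fin_two]
    simp [gram, h.cc, h.dd, hcd]
  rw [hdet, Fin.sum_univ_three] at h3
  simp only [Matrix.cons_val_zero, Matrix.cons_val_one, Matrix.cons_val, ← map_sub, h2] at h3
  generalize pair v (r 0 - s 0) = x at h3 h1
  generalize pair v (a - b) = y at h3
  have hy : y % 3 = 0 ∨ y % 3 = 1 ∨ y % 3 = 2 := by omega
  have h' := Int.emod_eq_zero_of_dvd h3
  rcases hy with hy | hy | hy <;>
    simp [Int.add_emod, pow_two, Int.mul_emod, h1, hy] at h'

lemma frame_four (h : IsOcta r s a b c d) (hab : pair a b = -1) (hac : pair a c = 0)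
    (had : pair a d = 0) (hbc : pair b c = 0) (hbd : pair b d = 0) (hcd : pair c d = -1) :
    IsFrame ![r 0, r 1, a, c] ![s 0, s 1, b, d] (![] : Fin 0 → Lat) := by
  have hF := h.frame_three hab hac had hbc hbd
  have e1 := hF.x_KK
  have e2 := hF.r_x
  have e3 := hF.s_x
  have e4 := hF.r_r
  have e5 := hF.s_s
  have e6 := hF.r_s
  have e7 := hF.r_KK
  have e8 := hF.s_KK
  have e9 := hF.rr
  have e10 := hF.ss
  have e11 := hF.rs
  simp [Fin.forall_fin_succ] at e1 e2 e3 e4 e5 e6 e7 e8 e9 e10 e11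
  refine ⟨?_, ?_, isEmptyElim, ?_, ?_, ?_, ?_, ?_, ?_, fun _ => isEmptyElim, fun _ => isEmptyElim,
    ?_⟩
  · simp [Fin.forall_fin_succ, *]
  · simp [Fin.forall_fin_succ, *]
  · simp [Fin.forall_fin_succ, h.cc, *]
  · simp [Fin.forall_fin_succ, h.dd, *]
  · simp [Fin.forall_fin_succ, *]
  · refine forall_fin_ne_iff (fun i j h => by rw [pair_comm, h]) ?_
    simp [Fin.forall_fin_succ, *]
  · refine forall_fin_ne_iff (fun i j h => by rw [pair_comm, h]) ?_
    simp [Fin.forall_fin_succ, *]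
  · simp [Fin.forall_fin_succ, pair_comm c (s _), pair_comm c b, *]
  · intro z h1 h2 h3 _
    simp [Fin.forall_fin_succ] at h2 h3
    refine hF.span z h1 ?_ ?_ ?_
    · simp [Fin.forall_fin_succ, h2]
    · simp [Fin.forall_fin_succ, h3]
    · simp [Fin.forall_fin_succ, h2, h3]

lemma det_gram (h : IsOcta r s a b c d) : (gram ![a, b, c, d]).det =
    16 - 4 * (pair a b ^ 2 + pair a c ^ 2 + pair a d ^ 2
      + pair b c ^ 2 + pair b d ^ 2 + pair c d ^ 2) + 4 * (pair a b * pair a c * pair b c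
      + pair a b * pair a d * pair b d + pair a c * pair a d * pair c d
      + pair b c * pair b d * pair c d) + (pair a b * pair c d) ^ 2 + (pair a c * pair b d) ^ 2
      + (pair a d * pair b c) ^ 2 - 2 * (pair a b * pair c d * (pair a c * pair b d)
      + pair a b * pair c d * (pair a d * pair b c)
      + pair a c * pair b d * (pair a d * pair b c)) := by
  rw [Matrix.det_succ_row_zero, Fin.sum_univ_four]
  simp [Matrix.det_fin_three, gram, Fin.succAbove, h.aa, h.bb, h.cc, h.dd, pair_comm b a,
    pair_comm c a, pair_comm c b, pair_comm d a, pair_comm d b, pair_comm d c]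
  ring

end IsOcta

/-- A forest on four vertices whose Gram determinant is divisible by three has a perfect matching
or a single edge. -/
lemma forest_pattern {x₁ x₂ x₃ x₄ x₅ x₆ : ℤ} (h₁ : x₁ = 0 ∨ x₁ = -1) (h₂ : x₂ = 0 ∨ x₂ = -1)
    (h₃ : x₃ = 0 ∨ x₃ = -1) (h₄ : x₄ = 0 ∨ x₄ = -1) (h₅ : x₅ = 0 ∨ x₅ = -1)
    (h₆ : x₆ = 0 ∨ x₆ = -1) (h₁₂₄ : -2 ≤ x₁ + x₂ + x₄) (h₁₃₅ : -2 ≤ x₁ + x₃ + x₅)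
    (h₂₃₆ : -2 ≤ x₂ + x₃ + x₆) (h₄₅₆ : -2 ≤ x₄ + x₅ + x₆)
    (hs : -3 ≤ x₁ + x₂ + x₃ + x₄ + x₅ + x₆)
    (hd : 3 ∣ 16 - 4 * (x₁ ^ 2 + x₂ ^ 2 + x₃ ^ 2 + x₄ ^ 2 + x₅ ^ 2 + x₆ ^ 2)
      + 4 * (x₁ * x₂ * x₄ + x₁ * x₃ * x₅ + x₂ * x₃ * x₆ + x₄ * x₅ * x₆) + (x₁ * x₆) ^ 2
      + (x₂ * x₅) ^ 2 + (x₃ * x₄) ^ 2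
      - 2 * (x₁ * x₆ * (x₂ * x₅) + x₁ * x₆ * (x₃ * x₄) + x₂ * x₅ * (x₃ * x₄))) :
    (x₂ = 0 ∧ x₃ = 0 ∧ x₄ = 0 ∧ x₅ = 0 ∧ (x₁ = -1 ∨ x₆ = -1)) ∨
    (x₁ = 0 ∧ x₃ = 0 ∧ x₄ = 0 ∧ x₆ = 0 ∧ (x₂ = -1 ∨ x₅ = -1)) ∨
    (x₁ = 0 ∧ x₂ = 0 ∧ x₅ = 0 ∧ x₆ = 0 ∧ (x₃ = -1 ∨ x₄ = -1)) := by
  rcases h₁ with rfl | rfl <;> rcases h₂ with rfl | rfl <;> rcases h₃ with rfl | rfl <;>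
    rcases h₄ with rfl | rfl <;> rcases h₅ with rfl | rfl <;> rcases h₆ with rfl | rfl <;>
    revert h₁₂₄ h₁₃₅ h₂₃₆ h₄₅₆ hs hd <;> decide

namespace IsOcta

variable {r s : Fin 2 → Lat} {a b c d : Lat}

lemma both_edges (h : IsOcta r s a b c d) (hab : pair a b = 0 ∨ pair a b = -1)
    (hcd : pair c d = 0 ∨ pair c d = -1) (hac : pair a c = 0) (had : pair a d = 0)
    (hbc : pair b c = 0) (hbd : pair b d = 0) (hor : pair a b = -1 ∨ pair c d = -1) :
    pair a b = -1 ∧ pair c d = -1 := by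
  rcases hab with h1 | h1
  · have h2 : pair c d = -1 := by omega
    exact (h.swap₂₃.swap₁₂.swap₃₄.swap₂₃.false_of_isolated h2 ((pair_comm _ _).trans hac)
      ((pair_comm _ _).trans hbc) ((pair_comm _ _).trans had) ((pair_comm _ _).trans hbd) h1).elim
  · rcases hcd with h2 | h2
    · exact (h.false_of_isolated h1 hac had hbc hbd h2).elim
    · exact ⟨h1, h2⟩

/-- If the four extra roots contain no circuit, they form two orthogonal `A₂` pairs. -/
lemma exists_pairs (h : IsOcta r s a b c d)
    (hab : pair a b = 0 ∨ pair a b = -1) (hac : pair a c = 0 ∨ pair a c = -1)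
    (had : pair a d = 0 ∨ pair a d = -1) (hbc : pair b c = 0 ∨ pair b c = -1)
    (hbd : pair b d = 0 ∨ pair b d = -1) (hcd : pair c d = 0 ∨ pair c d = -1)
    (habc : -2 ≤ pair a b + pair a c + pair b c) (habd : -2 ≤ pair a b + pair a d + pair b d)
    (hacd : -2 ≤ pair a c + pair a d + pair c d) (hbcd : -2 ≤ pair b c + pair b d + pair c d)
    (habcd : -3 ≤ pair a b + pair a c + pair a d + pair b c + pair b d + pair c d) :
    ∃ a' b' c' d', ({a, b, c, d} : Finset Lat) = {a', b', c', d'} ∧ IsOcta r s a' b' c' d' ∧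
      pair a' b' = -1 ∧ pair a' c' = 0 ∧ pair a' d' = 0 ∧ pair b' c' = 0 ∧ pair b' d' = 0 ∧
      pair c' d' = -1 := by
  have hcb := pair_comm c b
  have hdb := pair_comm d b
  have hdc := pair_comm d c
  have h3 := h.three_dvd_det
  rw [h.det_gram] at h3
  rcases forest_pattern hab hac had hbc hbd hcd habc habd hacd hbcd habcd h3 with
    ⟨h1, h2, h4, h5, h6⟩ | ⟨h1, h2, h4, h5, h6⟩ | ⟨h1, h2, h4, h5, h6⟩
  · obtain ⟨p, q⟩ := h.both_edges hab hcd h1 h2 h4 h5 h6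
    exact ⟨a, b, c, d, rfl, h, p, h1, h2, h4, h5, q⟩
  · obtain ⟨p, q⟩ := h.swap₂₃.both_edges hac hbd h1 h2 (hcb.trans h4) h5 h6
    exact ⟨a, c, b, d, by rw [Finset.insert_comm b c], h.swap₂₃, p, h1, h2, hcb.trans h4, h5, q⟩
  · obtain ⟨p, q⟩ := h.swap₃₄.swap₂₃.both_edges had hbc h1 h2 (hdb.trans h4) (hdc.trans h5) h6
    exact ⟨a, d, b, c, by rw [Finset.pair_comm c d, Finset.insert_comm b d], h.swap₃₄.swap₂₃,
      p, h1, h2, hdb.trans h4, hdc.trans h5, q⟩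

end IsOcta

lemma Dep.mono {T U : Finset Lat} (hTU : T ⊆ U) (hT : Dep T) : Dep U := by
  obtain ⟨c, hc, x, hx, hcx⟩ := hT
  refine ⟨fun r => if r ∈ T then c r else 0, ?_, x, hTU hx, by simpa [hx] using hcx⟩
  simp only [ite_smul, zero_smul]
  rw [Finset.sum_ite_mem, Finset.inter_eq_right.2 hTU, hc]

lemma triple_bound {R I : Finset Lat} (hR : IsRootSet R) (hIR : I ⊆ R) (hI : ¬ Dep I) {a b c : Lat}
    (ha : a ∈ I) (hb : b ∈ I) (hc : c ∈ I) (hab : a ≠ b) (hac : a ≠ c) (hbc : b ≠ c) :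
    -2 ≤ pair a b + pair a c + pair b c := by
  have h3 : pair (a + b + c) (a + b + c) = 6 + 2 * (pair a b + pair a c + pair b c) := by
    simp [hR.norm a (hIR ha), hR.norm b (hIR hb), hR.norm c (hIR hc), pair_comm b a,
      pair_comm c a, pair_comm c b]
    ring
  have hK : pair (a + b + c) KK = 0 := by
    simp [hR.orth a (hIR ha), hR.orth b (hIR hb), hR.orth c (hIR hc)]
  by_contra! hlt
  have h0 := eq_zero_of_pair_self hK (le_antisymm (by omega) (pair_self_nonneg hK))
  refine hI (Dep.mono (T := {a, b, c}) ?_ ⟨fun _ => 1, ?_, a, by simp, one_ne_zero⟩)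
  · simp [Finset.insert_subset_iff, ha, hb, hc]
  · rw [sum_three _ hab hac hbc, ← h0]; module

lemma quadruple_bound {R I : Finset Lat} (hR : IsRootSet R) (hIR : I ⊆ R) (hI : ¬ Dep I)
    {a b c d : Lat} (ha : a ∈ I) (hb : b ∈ I) (hc : c ∈ I) (hd : d ∈ I) (hab : a ≠ b)
    (hac : a ≠ c) (had : a ≠ d) (hbc : b ≠ c) (hbd : b ≠ d) (hcd : c ≠ d) :
    -3 ≤ pair a b + pair a c + pair a d + pair b c + pair b d + pair c d := by
  have h3 : pair (a + b + c + d) (a + b + c + d) =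
      8 + 2 * (pair a b + pair a c + pair a d + pair b c + pair b d + pair c d) := by
    simp [hR.norm a (hIR ha), hR.norm b (hIR hb), hR.norm c (hIR hc), hR.norm d (hIR hd),
      pair_comm b a, pair_comm c a, pair_comm c b, pair_comm d a, pair_comm d b, pair_comm d c]
    ring
  have hK : pair (a + b + c + d) KK = 0 := by
    simp [hR.orth a (hIR ha), hR.orth b (hIR hb), hR.orth c (hIR hc), hR.orth d (hIR hd)]
  by_contra! hlt
  have h0 := eq_zero_of_pair_self hK (le_antisymm (by omega) (pair_self_nonneg hK))
  refine hI (Dep.mono (T := {a, b, c, d}) ?_ ⟨fun _ => 1, ?_, a, by simp, one_ne_zero⟩)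
  · simp [Finset.insert_subset_iff, ha, hb, hc, hd]
  · rw [Finset.sum_insert (by simp [hab, hac, had]), sum_three _ hbc hbd hcd, ← h0]; module

/-- A root depending on two orthogonal `A₂` pairs completes one of them to a triangle. -/
lemma fifth_root {R : Finset Lat} (hR : IsRootSet R) {a b c d e : Lat} (ha : a ∈ R) (hb : b ∈ R)
    (hc : c ∈ R) (hd : d ∈ R) (he : e ∈ R) (hae : a ≠ e) (hbe : b ≠ e) (hce : c ≠ e)
    (hde : d ≠ e) (hab : pair a b = -1) (hac : pair a c = 0) (had : pair a d = 0)
    (hbc : pair b c = 0) (hbd : pair b d = 0) (hcd : pair c d = -1) {fa fb fc fd fe : ℤ}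
    (hfe : fe ≠ 0) (h : fa • a + fb • b + fc • c + fd • d + fe • e = 0) :
    e = -(a + b) ∨ e = -(c + d) := by
  have ea := congrArg (pair a) h
  have eb := congrArg (pair b) h
  have ec := congrArg (pair c) h
  have ed := congrArg (pair d) h
  have ee := congrArg (pair e) h
  simp only [map_add, map_smul, smul_eq_mul, map_zero, hR.norm a ha, hR.norm b hb,
    hR.norm c hc, hR.norm d hd, hR.norm e he, pair_comm b a, pair_comm c a, pair_comm c b,
    pair_comm d a, pair_comm d b, pair_comm d c, pair_comm e a, pair_comm e b, pair_comm e c,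
    pair_comm e d, hab, hac, had, hbc, hbd, hcd]
    at ea eb ec ed ee
  have hQ : fe * (3 - (pair a e ^ 2 + pair a e * pair b e + pair b e ^ 2)
      - (pair c e ^ 2 + pair c e * pair d e + pair d e ^ 2)) = 0 := by
    refine (mul_eq_zero.1 (?_ : (2 : ℤ) * _ = 0)).resolve_left two_ne_zero
    linear_combination 3 * ee - (2 * pair a e + pair b e) * ea - (pair a e + 2 * pair b e) * eb
      - (2 * pair c e + pair d e) * ec - (pair c e + 2 * pair d e) * ed
  have hQ' := (mul_eq_zero.1 hQ).resolve_left hfe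
  have key : (pair a e = -1 ∧ pair b e = -1) ∨ (pair c e = -1 ∧ pair d e = -1) := by
    clear hQ ea eb ec ed ee
    rcases hR.pair_mem ha he hae with h1 | h1 <;> rcases hR.pair_mem hb he hbe with h2 | h2 <;>
      rcases hR.pair_mem hc he hce with h3 | h3 <;> rcases hR.pair_mem hd he hde with h4 | h4 <;>
      rw [h1, h2, h3, h4] at hQ' ⊢ <;> revert hQ' <;> decide
  have sum_zero : ∀ x ∈ R, ∀ y ∈ R, pair x y = -1 → pair x e = -1 → pair y e = -1 →
      e = -(x + y) := by
    intro x hx y hy h1 h2 h3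
    refine (neg_eq_of_add_eq_zero_right (eq_zero_of_pair_self ?_ ?_)).symm
    · simp [hR.orth x hx, hR.orth y hy, hR.orth e he]
    · simp [hR.norm x hx, hR.norm y hy, hR.norm e he, pair_comm e x, pair_comm e y,
        pair_comm y x, h1, h2, h3]
  rcases key with ⟨h1, h2⟩ | ⟨h1, h2⟩
  exacts [.inl (sum_zero a ha b hb hab h1 h2), .inr (sum_zero c hc d hd hcd h1 h2)]

set_option maxHeartbeats 1000000 in
lemma exists_octa {R : Finset Lat} (hR : IsRootSet R) (hc : R.card = 11) :
    ∃ r s : Fin 2 → Lat, ∃ a b c d e, IsOcta r s a b c d ∧ pair a b = -1 ∧ pair a c = 0 ∧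
      pair a d = 0 ∧ pair b c = 0 ∧ pair b d = 0 ∧ pair c d = -1 ∧
      (e = -(a + b) ∨ e = -(c + d)) ∧
      ∀ y, y ∈ R ↔ (∃ i, y = r i ∨ y = s i ∨ y = -(r i + s i)) ∨
        y = a ∨ y = b ∨ y = c ∨ y = d ∨ y = e := by
  obtain ⟨T₁, T₂, T₃, ⟨h₁, h₂, h₃⟩, ⟨c₁, c₂, c₃⟩, ⟨d₁₂, d₁₃, d₂₃⟩, k₁, k₂, hind⟩ :=
    exists_circuits hR hc
  rcases k₂ with k₂ | ⟨k₂, k₃⟩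
  swap
  · exact (false_of_three_four_four hR hc h₁ h₂ h₃ c₁ c₂ c₃ d₁₂ d₁₃ d₂₃ k₁ k₂ k₃ hind).elim
  obtain ⟨r₁, s₁, hrs₁, hrt₁, hst₁, e₁, p₁⟩ := c₁.of_card_eq_three hR h₁ k₁
  obtain ⟨r₂, s₂, hrs₂, hrt₂, hst₂, e₂, p₂⟩ := c₂.of_card_eq_three hR h₂ k₂
  obtain ⟨f, hf, hfs⟩ := c₃.exists_pos hR h₃
  obtain ⟨e, heT⟩ : ∃ e, e ∈ T₃ := by
    obtain ⟨-, -, e, he, -⟩ := c₃.dep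
    exact ⟨e, he⟩
  have o₁ : ∀ x ∈ T₁, ∀ y ∈ R, y ∉ T₁ → pair x y = 0 := fun x hx y => c₁.orth hR h₁ hx
  have o₂ : ∀ x ∈ T₂, ∀ y ∈ R, y ∉ T₂ → pair x y = 0 := fun x hx y => c₂.orth hR h₂ hx
  have hrm₁ : r₁ ∈ T₁ := by simp [e₁]
  have hsm₁ : s₁ ∈ T₁ := by simp [e₁]
  have htm₁ : -(r₁ + s₁) ∈ T₁ := by simp [e₁]
  have hrm₂ : r₂ ∈ T₂ := by simp [e₂]
  have hsm₂ : s₂ ∈ T₂ := by simp [e₂]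
  have htm₂ : -(r₂ + s₂) ∈ T₂ := by simp [e₂]
  have hI := hind _ htm₁ _ htm₂ e heT
  have hIcard := card_erase_three h₁ h₂ h₃ d₁₂ d₁₃ d₂₃ htm₁ htm₂ heT
  rw [hc] at hIcard
  have hIR : ((R.erase (-(r₁ + s₁))).erase (-(r₂ + s₂))).erase e ⊆ R :=
    (Finset.erase_subset _ _).trans ((Finset.erase_subset _ _).trans (Finset.erase_subset _ _))
  have hmem : ∀ x, x ∈ ((R.erase (-(r₁ + s₁))).erase (-(r₂ + s₂))).erase e ↔
      x ≠ e ∧ x ≠ -(r₂ + s₂) ∧ x ≠ -(r₁ + s₁) ∧ x ∈ R := by simp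
  generalize ((R.erase (-(r₁ + s₁))).erase (-(r₂ + s₂))).erase e = I at hI hIcard hIR hmem
  have heX : e ∈ (R \ T₁) \ T₂ := by
    simp only [Finset.mem_sdiff]
    exact ⟨⟨h₃ heT, Finset.disjoint_right.1 d₁₃ heT⟩, Finset.disjoint_right.1 d₂₃ heT⟩
  have hYcard : (((R \ T₁) \ T₂).erase e).card = 4 := by
    rw [Finset.card_erase_of_mem heX, Finset.card_sdiff_of_subset, Finset.card_sdiff_of_subset h₁,
      hc, k₁, k₂]
    exact Finset.subset_sdiff.2 ⟨h₂, d₁₂.symm⟩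
  obtain ⟨a, b, c, d, hab, hac, had, hbc, hbd, hcd, hY⟩ := card_eq_four hYcard
  have hYm : ∀ x, x ∈ ({a, b, c, d} : Finset Lat) → x ≠ e ∧ x ∈ R ∧ x ∉ T₁ ∧ x ∉ T₂ := by
    intro x hx
    simpa [← hY, and_assoc] using hx
  have hYI : ∀ x, x ∈ ({a, b, c, d} : Finset Lat) → x ∈ I := fun x hx => by
    obtain ⟨g₁, g₂, g₃, g₄⟩ := hYm x hx
    exact (hmem x).2 ⟨g₁, fun h => g₄ (h ▸ htm₂), fun h => g₃ (h ▸ htm₁), g₂⟩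
  have haY : a ∈ ({a, b, c, d} : Finset Lat) := by simp
  have hbY : b ∈ ({a, b, c, d} : Finset Lat) := by simp
  have hcY : c ∈ ({a, b, c, d} : Finset Lat) := by simp
  have hdY : d ∈ ({a, b, c, d} : Finset Lat) := by simp
  have hRm : ∀ y, y ∈ R ↔ y ∈ T₁ ∨ y ∈ T₂ ∨ y ∈ ({a, b, c, d} : Finset Lat) ∨ y = e := by
    intro y
    rw [← hY]
    simp only [Finset.mem_erase, Finset.mem_sdiff]
    constructor
    · intro hy
      by_cases g₁ : y ∈ T₁
      · exact .inl g₁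
      by_cases g₂ : y ∈ T₂
      · exact .inr (.inl g₂)
      by_cases g₃ : y = e
      · exact .inr (.inr (.inr g₃))
      · exact .inr (.inr (.inl ⟨g₃, ⟨hy, g₁⟩, g₂⟩))
    · rintro (h | h | h | rfl)
      exacts [h₁ h, h₂ h, h.2.1.1, h₃ heT]
  have hocta : IsOcta ![r₁, r₂] ![s₁, s₂] a b c d := by
    have z₁ : ∀ x ∈ T₁, ∀ j, pair x (![a, b, c, d] j) = 0 := fun x hx j => by
      have := hYm (![a, b, c, d] j) (by fin_cases j <;> simp)
      exact o₁ x hx _ this.2.1 this.2.2.1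
    have z₂ : ∀ x ∈ T₂, ∀ j, pair x (![a, b, c, d] j) = 0 := fun x hx j => by
      have := hYm (![a, b, c, d] j) (by fin_cases j <;> simp)
      exact o₂ x hx _ this.2.1 this.2.2.2
    have o₁₂ : ∀ y ∈ T₁, ∀ z ∈ T₂, pair y z = 0 := fun y hy z hz =>
      o₁ y hy z (h₂ hz) (Finset.disjoint_right.1 d₁₂ hz)
    have nR : ∀ x ∈ ({a, b, c, d} : Finset Lat), pair x x = 2 := fun x hx =>
      hR.norm x (hYm x hx).2.1
    refine ⟨⟨?_, ?_, ?_, ?_, ?_, ?_, ?_, ?_, ?_, ?_, ?_, ?_⟩, nR a haY, nR b hbY, nR c hcY,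
      nR d hdY⟩
    · simp [Fin.forall_fin_succ, hR.orth _ (h₁ hrm₁), hR.orth _ (h₂ hrm₂)]
    · simp [Fin.forall_fin_succ, hR.orth _ (h₁ hsm₁), hR.orth _ (h₂ hsm₂)]
    · exact fun j => hR.orth _ (hYm (![a, b, c, d] j) (by fin_cases j <;> simp)).2.1
    · simp [Fin.forall_fin_succ, hR.norm _ (h₁ hrm₁), hR.norm _ (h₂ hrm₂)]
    · simp [Fin.forall_fin_succ, hR.norm _ (h₁ hsm₁), hR.norm _ (h₂ hsm₂)]
    · simp [Fin.forall_fin_succ, p₁, p₂]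
    · simp [Fin.forall_fin_succ, o₁₂ _ hrm₁ _ hrm₂, pair_comm r₂ r₁]
    · simp [Fin.forall_fin_succ, o₁₂ _ hsm₁ _ hsm₂, pair_comm s₂ s₁]
    · simp [Fin.forall_fin_succ, o₁₂ _ hrm₁ _ hsm₂, o₁₂ _ hsm₁ _ hrm₂, pair_comm r₂ s₁]
    · intro i
      fin_cases i
      exacts [z₁ _ hrm₁, z₂ _ hrm₂]
    · intro i
      fin_cases i
      exacts [z₁ _ hsm₁, z₂ _ hsm₂]
    · intro z hz zr zs zx
      refine eq_zero_of_orth (fun y hy => hR.orth y (hIR hy)) hI hIcard hz fun y hy => ?_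
      obtain ⟨n₁, n₂, n₃, hy⟩ := (hmem y).1 hy
      rw [hRm, e₁, e₂] at hy
      simp only [Finset.mem_insert, Finset.mem_singleton] at hy
      rcases hy with (h | h | h) | (h | h | h) | (h | h | h | h) | h
      · rw [h]; exact zr 0
      · rw [h]; exact zs 0
      · exact absurd h n₃
      · rw [h]; exact zr 1
      · rw [h]; exact zs 1
      · exact absurd h n₂
      · rw [h]; exact zx 0
      · rw [h]; exact zx 1
      · rw [h]; exact zx 2
      · rw [h]; exact zx 3
      · exact absurd h n₁
  have pm : ∀ x ∈ ({a, b, c, d} : Finset Lat), ∀ y ∈ ({a, b, c, d} : Finset Lat), x ≠ y →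
      pair x y = 0 ∨ pair x y = -1 := fun x hx y hy =>
    hR.prod x (hYm x hx).2.1 y (hYm y hy).2.1
  obtain ⟨a', b', c', d', hset, hocta', q₁, q₂, q₃, q₄, q₅, q₆⟩ := hocta.exists_pairs
    (pm a haY b hbY hab) (pm a haY c hcY hac) (pm a haY d hdY had) (pm b hbY c hcY hbc)
    (pm b hbY d hdY hbd) (pm c hcY d hdY hcd)
    (triple_bound hR hIR hI (hYI a haY) (hYI b hbY) (hYI c hcY) hab hac hbc)
    (triple_bound hR hIR hI (hYI a haY) (hYI b hbY) (hYI d hdY) hab had hbd)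
    (triple_bound hR hIR hI (hYI a haY) (hYI c hcY) (hYI d hdY) hac had hcd)
    (triple_bound hR hIR hI (hYI b hbY) (hYI c hcY) (hYI d hdY) hbc hbd hcd)
    (quadruple_bound hR hIR hI (hYI a haY) (hYI b hbY) (hYI c hcY) (hYI d hdY) hab hac had hbc
      hbd hcd)
  rw [hset] at hYm hRm
  refine ⟨_, _, a', b', c', d', e, hocta', q₁, q₂, q₃, q₄, q₅, q₆, ?_, fun y => ?_⟩
  · obtain ⟨ga, ha, -⟩ := hYm a' (by simp)
    obtain ⟨gb, hb, -⟩ := hYm b' (by simp)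
    obtain ⟨gc, hc, -⟩ := hYm c' (by simp)
    obtain ⟨gd, hd, -⟩ := hYm d' (by simp)
    have nab : a' ≠ b' := fun h => by rw [h, hocta'.bb] at q₁; omega
    have nac : a' ≠ c' := fun h => by rw [h, hocta'.cc] at q₂; omega
    have nad : a' ≠ d' := fun h => by rw [h, hocta'.dd] at q₃; omega
    have nbc : b' ≠ c' := fun h => by rw [h, hocta'.cc] at q₄; omega
    have nbd : b' ≠ d' := fun h => by rw [h, hocta'.dd] at q₅; omega
    have ncd : c' ≠ d' := fun h => by rw [h, hocta'.dd] at q₆; omega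
    have hsub : T₃ ⊆ {a', b', c', d', e} := by
      intro y hy
      have := (hRm y).1 (h₃ hy)
      have g₁ := Finset.disjoint_right.1 d₁₃ hy
      have g₂ := Finset.disjoint_right.1 d₂₃ hy
      simpa [g₁, g₂, or_assoc] using this
    have hsum : ∑ y ∈ ({a', b', c', d', e} : Finset Lat), (if y ∈ T₃ then f y else 0) • y = 0 := by
      simp only [ite_smul, zero_smul]
      rw [Finset.sum_ite_mem, Finset.inter_eq_right.2 hsub, hfs]
    rw [Finset.sum_insert (by simp [nab, nac, nad, ga]), Finset.sum_insert (by simp [nbc, nbd, gb]),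
      sum_three _ ncd gc gd, ← add_assoc, ← add_assoc, ← add_assoc] at hsum
    refine fifth_root hR ha hb hc hd (h₃ heT) ga gb gc gd q₁ q₂ q₃ q₄ q₅ q₆ ?_ hsum
    rw [if_pos heT]
    exact (hf e heT).ne'
  · rw [hRm, e₁, e₂]
    simp [Fin.exists_fin_two, or_assoc]

/-- Eleven roots with pairwise products `0` or `-1` consist of three triangles and an `A₂` pair. -/
lemma exists_frame {R : Finset Lat} (hR : IsRootSet R) (hc : R.card = 11) :
    ∃ r s : Fin 4 → Lat, IsFrame r s (![] : Fin 0 → Lat) ∧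
      ∀ y, y ∈ R ↔ (∃ i, y = r i ∨ y = s i) ∨ ∃ i, i ≠ 3 ∧ y = -(r i + s i) := by
  obtain ⟨r, s, a, b, c, d, e, h, hab, hac, had, hbc, hbd, hcd, he | he, hm⟩ := exists_octa hR hc
  · refine ⟨_, _, h.frame_four hab hac had hbc hbd hcd, fun y => ?_⟩
    rw [hm, he]
    simp only [Fin.exists_fin_succ, Fin.isValue]
    simp
    tauto
  · have h' : IsOcta r s c d a b := h.swap₂₃.swap₁₂.swap₃₄.swap₂₃
    refine ⟨_, _, h'.frame_four hcd ((pair_comm _ _).trans hac) ((pair_comm _ _).trans hbc)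
      ((pair_comm _ _).trans had) ((pair_comm _ _).trans hbd) hab, fun y => ?_⟩
    rw [hm, he]
    simp only [Fin.exists_fin_succ, Fin.isValue]
    simp
    tauto

/-- Swapping the members of some of the `A₂` pairs of a frame. -/
lemma IsFrame.swap {κ ι : Type} {r s : κ → Lat} {x : ι → Lat} (h : IsFrame r s x) (ε : κ → Bool) :
    IsFrame (fun i => cond (ε i) (s i) (r i)) (fun i => cond (ε i) (r i) (s i)) x := by
  refine ⟨?_, ?_, h.x_KK, ?_, ?_, ?_, ?_, ?_, ?_, ?_, ?_, fun z hz h1 h2 h3 => ?_⟩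
  · intro i; cases ε i <;> simp [h.r_KK, h.s_KK]
  · intro i; cases ε i <;> simp [h.r_KK, h.s_KK]
  · intro i; cases ε i <;> simp [h.rr, h.ss]
  · intro i; cases ε i <;> simp [h.rr, h.ss]
  · intro i; cases ε i <;> simp [h.rs, h.sr]
  · intro i j hij; cases ε i <;> cases ε j <;>
      simp [h.r_r i j hij, h.s_s i j hij, h.r_s i j hij, h.s_r i j hij]
  · intro i j hij; cases ε i <;> cases ε j <;>
      simp [h.r_r i j hij, h.s_s i j hij, h.r_s i j hij, h.s_r i j hij]
  · intro i j hij; cases ε i <;> cases ε j <;>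
      simp [h.r_r i j hij, h.s_s i j hij, h.r_s i j hij, h.s_r i j hij]
  · intro i j; cases ε i <;> simp [h.r_x, h.s_x]
  · intro i j; cases ε i <;> simp [h.r_x, h.s_x]
  · refine h.span z hz (fun i => ?_) (fun i => ?_) h3
    · have h1 := h1 i
      have h2 := h2 i
      cases hε : ε i <;> simp_all
    · have h1 := h1 i
      have h2 := h2 i
      cases hε : ε i <;> simp_all

/-- The root set `R` consists of three triangles and an `A₂` pair given by a frame. -/
structure IsEleven (R : Finset Lat) (r s : Fin 4 → Lat) : Prop where
  frame : IsFrame r s (![] : Fin 0 → Lat)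
  mem_iff : ∀ y, y ∈ R ↔ (∃ i, y = r i ∨ y = s i) ∨ ∃ i, i ≠ 3 ∧ y = -(r i + s i)

lemma IsEleven.swap {R : Finset Lat} {r s : Fin 4 → Lat} (h : IsEleven R r s) (ε : Fin 4 → Bool) :
    IsEleven R (fun i => cond (ε i) (s i) (r i)) (fun i => cond (ε i) (r i) (s i)) := by
  refine ⟨h.frame.swap ε, fun y => ?_⟩
  rw [h.mem_iff]
  refine or_congr (exists_congr fun i => ?_) (exists_congr fun i => ?_)
  · cases ε i <;> simp [or_comm]
  · cases ε i <;> simp [add_comm]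

lemma IsFrame.pair_sub_sub {κ ι : Type} {r s : κ → Lat} {x : ι → Lat} (h : IsFrame r s x)
    (i j : κ) (hij : i ≠ j) : pair (r i - s i) (r j - s j) = 0 := by
  simp [h.r_r i j hij, h.s_s i j hij, h.r_s i j hij, h.s_r i j hij]

lemma IsFrame.pair_sub_self {κ ι : Type} {r s : κ → Lat} {x : ι → Lat} (h : IsFrame r s x)
    (i : κ) : pair (r i - s i) (r i - s i) = 6 := by
  simp [h.rr, h.ss, h.rs, h.sr]

lemma IsFrame.exists_glue_sign {r s : Fin 4 → Lat} (h : IsFrame r s (![] : Fin 0 → Lat))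
    {i j : Fin 4} (hij : i = 0 ∧ j = 1 ∨ i = 1 ∧ j = 0) :
    ∃ w : Lat, ∃ f g : ℤ, (f = 1 ∨ f = -1) ∧ (g = 1 ∨ g = -1) ∧
      (3 : ℤ) • w = (r i - s i) + f • (r 2 - s 2) + g • (r 3 - s 3) := by
  have hne : i ≠ j := by rcases hij with ⟨rfl, rfl⟩ | ⟨rfl, rfl⟩ <;> decide
  obtain ⟨v, hv, hi, hj⟩ := exists_pair_emod (u := r i - s i) (w := r j - s j)
    (by simp [h.r_KK, h.s_KK]) (by simp [h.r_KK, h.s_KK]) (h.pair_sub_self i) (h.pair_sub_self j)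
    (h.pair_sub_sub i j hne)
  have hd := h.three_dvd hv
  obtain ⟨w, hw⟩ := h.exists_glue hv
  rw [Matrix.det_isEmpty, one_mul] at hd
  simp only [← map_sub] at hd hw
  have hsum : (3 : ℤ) • w = pair v (r i - s i) • (r i - s i) + pair v (r 2 - s 2) • (r 2 - s 2)
      + pair v (r 3 - s 3) • (r 3 - s 3) := by
    rcases hij with ⟨rfl, rfl⟩ | ⟨rfl, rfl⟩ <;> rw [hw, Fin.sum_univ_four, hj] <;> module
  have hd' : 3 ∣ pair v (r i - s i) ^ 2 + pair v (r 2 - s 2) ^ 2 + pair v (r 3 - s 3) ^ 2 := by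
    rcases hij with ⟨rfl, rfl⟩ | ⟨rfl, rfl⟩ <;> rw [Fin.sum_univ_four, hj] at hd <;> simpa using hd
  generalize pair v (r i - s i) = x at hi hsum hd'
  generalize pair v (r 2 - s 2) = y at hsum hd'
  generalize pair v (r 3 - s 3) = z at hsum hd'
  have key : ∀ t : ℤ, t % 3 = 1 ∨ t % 3 = 2 → ∃ f m, (f = 1 ∨ f = -1) ∧ t = f + 3 * m := by
    rintro t (ht | ht)
    · exact ⟨1, t / 3, .inl rfl, by omega⟩
    · exact ⟨-1, t / 3 + 1, .inr rfl, by omega⟩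
  have hyz : (y % 3 = 1 ∨ y % 3 = 2) ∧ (z % 3 = 1 ∨ z % 3 = 2) := by
    have h' := Int.emod_eq_zero_of_dvd hd'
    have hy : y % 3 = 0 ∨ y % 3 = 1 ∨ y % 3 = 2 := by omega
    have hz : z % 3 = 0 ∨ z % 3 = 1 ∨ z % 3 = 2 := by omega
    rcases hy with hy | hy | hy <;> rcases hz with hz | hz | hz <;>
      simp [Int.add_emod, pow_two, Int.mul_emod, hi, hy, hz] at h' ⊢
  obtain ⟨f, m, hf, rfl⟩ := key y hyz.1
  obtain ⟨g, n, hg, rfl⟩ := key z hyz.2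
  obtain ⟨k, rfl⟩ : ∃ k, x = 1 + 3 * k := ⟨x / 3, by omega⟩
  refine ⟨w - k • (r i - s i) - m • (r 2 - s 2) - n • (r 3 - s 3), f, g, hf, hg, ?_⟩
  simp only [smul_sub (3 : ℤ) w, smul_sub (3 : ℤ) (_ - _), hsum]
  module

/-- An eleven-element root set has a frame with standard glue vectors. -/
lemma exists_glue_frame {R : Finset Lat} (hR : IsRootSet R) (hc : R.card = 11) :
    ∃ r s : Fin 4 → Lat, ∃ w₁ w₂ : Lat, IsEleven R r s ∧
      (3 : ℤ) • w₁ = (r 0 - s 0) + (r 2 - s 2) + (r 3 - s 3) ∧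
      (3 : ℤ) • w₂ = (r 1 - s 1) + (r 2 - s 2) - (r 3 - s 3) := by
  obtain ⟨r, s, w₁, h, hw₁⟩ : ∃ r s : Fin 4 → Lat, ∃ w₁ : Lat, IsEleven R r s ∧
      (3 : ℤ) • w₁ = (r 0 - s 0) + (r 2 - s 2) + (r 3 - s 3) := by
    obtain ⟨r, s, hF, hm⟩ := exists_frame hR hc
    obtain ⟨w, f, g, hf, hg, hw⟩ := hF.exists_glue_sign (.inl ⟨rfl, rfl⟩)
    refine ⟨_, _, w, IsEleven.swap ⟨hF, hm⟩ ![false, false, f = -1, g = -1], ?_⟩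
    rw [hw]
    rcases hf with rfl | rfl <;> rcases hg with rfl | rfl <;> simp
  obtain ⟨w, f, g, hf, hg, hw⟩ := h.frame.exists_glue_sign (.inr ⟨rfl, rfl⟩)
  have h9 : pair ((3 : ℤ) • w₁) ((3 : ℤ) • w) = 6 * (f + g) := by
    rw [hw₁, hw]
    simp only [map_add, map_smul, LinearMap.add_apply, smul_eq_mul, h.frame.pair_sub_self,
      h.frame.pair_sub_sub 0 1 (by decide), h.frame.pair_sub_sub 0 2 (by decide),
      h.frame.pair_sub_sub 0 3 (by decide), h.frame.pair_sub_sub 2 1 (by decide),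
      h.frame.pair_sub_sub 2 3 (by decide), h.frame.pair_sub_sub 3 1 (by decide),
      h.frame.pair_sub_sub 3 2 (by decide)]
    ring
  simp only [map_smul, LinearMap.smul_apply, smul_eq_mul] at h9
  rcases hf with rfl | rfl <;> rcases hg with rfl | rfl
  · omega
  · exact ⟨r, s, w₁, w, h, hw₁, by rw [hw]; module⟩
  · refine ⟨_, _, w₁, -w, h.swap ![false, true, false, false], ?_, ?_⟩
    · simpa using hw₁
    · rw [smul_neg, hw]
      simp
      abel
  · omega

lemma isUnit_det_of_gram {b : Fin 9 → Lat} (h : IsUnit (gram b).det) :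
    IsUnit ((Pi.basisFun ℤ (Fin 9)).det b) := by
  set J : Matrix (Fin 9) (Fin 9) ℤ := Matrix.diagonal (Fin.cons (-1) fun _ => 1)
  have hJ : gram b = Matrix.of b * (J * (Matrix.of b).transpose) := by
    ext i j
    rw [Matrix.mul_apply, Fin.sum_univ_succ]
    simp [gram, pair_apply, dot, J, Matrix.diagonal_mul]
    ring
  rw [hJ, Matrix.det_mul] at h
  rw [Pi.basisFun_det_apply]
  exact isUnit_of_mul_isUnit_left h

/-- Unimodular families with the same Gram matrix are related by an isometry. -/
lemma exists_isometry {b b' : Fin 9 → Lat} (h : IsUnit (gram b).det) (hbb : gram b' = gram b) :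
    ∃ φ : Lat ≃ₗ[ℤ] Lat, (∀ v u, pair (φ v) (φ u) = pair v u) ∧ ∀ i, φ (b i) = b' i := by
  obtain ⟨li, sp⟩ := (Module.Basis.is_basis_iff_det _).2 (isUnit_det_of_gram h)
  obtain ⟨li', sp'⟩ := (Module.Basis.is_basis_iff_det _).2 (isUnit_det_of_gram (hbb ▸ h))
  set B := Module.Basis.mk li sp.ge
  set B' := Module.Basis.mk li' sp'.ge
  have hφ : ∀ i, B.equiv B' (Equiv.refl _) (b i) = b' i := by
    intro i
    have := B.equiv_apply (b' := B') i (Equiv.refl _)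
    simpa [B, B'] using this
  refine ⟨B.equiv B' (Equiv.refl _), fun v u => ?_, hφ⟩
  set φ := B.equiv B' (Equiv.refl _)
  have hext : pair.compl₁₂ φ.toLinearMap φ.toLinearMap = pair := by
    refine LinearMap.BilinForm.ext_basis B fun i j => ?_
    simp only [B, Module.Basis.mk_apply, LinearMap.compl₁₂_apply, LinearEquiv.coe_coe, hφ]
    exact congrFun (congrFun hbb i) j
  exact LinearMap.congr_fun₂ hext v u

/-- The Gram matrix of the basis attached to a frame with glue vectors. -/
def glueGram : Matrix (Fin 9) (Fin 9) ℤ :=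
  !![2, -1, 0, 0, 1, -1, 1, -1, 0;
    -1, 2, 0, 0, 0, 0, 0, 0, 0;
    0, 0, 2, -1, 1, -1, -1, 1, 0;
    0, 0, -1, 2, 0, 0, 0, 0, 0;
    1, 0, 1, 0, 2, -1, 0, 0, 0;
    -1, 0, -1, 0, -1, 2, 0, 0, 0;
    1, 0, -1, 0, 0, 0, 2, -1, 0;
    -1, 0, 1, 0, 0, 0, -1, 2, 0;
    0, 0, 0, 0, 0, 0, 0, 0, -1]

lemma isUnit_det_glueGram : IsUnit glueGram.det := by
  refine Matrix.isUnit_det_of_right_inverse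
    (B := !![6, 3, 0, 0, -2, 2, -2, 2, 0;
      3, 2, 0, 0, -1, 1, -1, 1, 0;
      0, 0, 6, 3, -2, 2, 2, -2, 0;
      0, 0, 3, 2, -1, 1, 1, -1, 0;
      -2, -1, -2, -1, 2, -1, 0, 0, 0;
      2, 1, 2, 1, -1, 2, 0, 0, 0;
      -2, -1, 2, 1, 0, 0, 2, -1, 0;
      2, 1, -2, -1, 0, 0, -1, 2, 0;
      0, 0, 0, 0, 0, 0, 0, 0, -1]) ?_
  decide +kernel

/-- The basis attached to a frame with glue vectors. -/
def glueBasis (r s : Fin 4 → Lat) (w₁ w₂ : Lat) : Fin 9 → Lat :=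
  ![w₁, s 0, w₂, s 1, r 2, s 2, r 3, s 3, KK]

set_option maxHeartbeats 1000000 in
lemma gram_glueBasis {r s : Fin 4 → Lat} {w₁ w₂ : Lat} (h : IsFrame r s (![] : Fin 0 → Lat))
    (h₁ : (3 : ℤ) • w₁ = (r 0 - s 0) + (r 2 - s 2) + (r 3 - s 3))
    (h₂ : (3 : ℤ) • w₂ = (r 1 - s 1) + (r 2 - s 2) - (r 3 - s 3)) :
    gram (glueBasis r s w₁ w₂) = glueGram := by
  have p₁ : ∀ y, 3 * pair w₁ y = pair (r 0 - s 0) y + pair (r 2 - s 2) y + pair (r 3 - s 3) y := by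
    intro y
    simpa [-zsmul_eq_mul] using congrArg (fun v => pair v y) h₁
  have p₂ : ∀ y, 3 * pair w₂ y = pair (r 1 - s 1) y + pair (r 2 - s 2) y - pair (r 3 - s 3) y := by
    intro y
    simpa [-zsmul_eq_mul] using congrArg (fun v => pair v y) h₂
  have hrr := h.r_r
  have hss := h.s_s
  have hrs := h.r_s
  have hsr := h.s_r
  simp [Fin.forall_fin_succ] at hrr hss hrs hsr
  have w₁r : ∀ i, pair w₁ (r i) = ![1, 0, 1, 1] i := fun i => by
    have := p₁ (r i)
    fin_cases i <;> simp [hrr, hsr, h.rr, h.sr] at this ⊢ <;> omega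
  have w₁s : ∀ i, pair w₁ (s i) = ![-1, 0, -1, -1] i := fun i => by
    have := p₁ (s i)
    fin_cases i <;> simp [hss, hrs, h.rs, h.ss] at this ⊢ <;> omega
  have w₂r : ∀ i, pair w₂ (r i) = ![0, 1, 1, -1] i := fun i => by
    have := p₂ (r i)
    fin_cases i <;> simp [hrr, hsr, h.rr, h.sr] at this ⊢ <;> omega
  have w₂s : ∀ i, pair w₂ (s i) = ![0, -1, -1, 1] i := fun i => by
    have := p₂ (s i)
    fin_cases i <;> simp [hss, hrs, h.rs, h.ss] at this ⊢ <;> omega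
  have w₁K : pair w₁ KK = 0 := by
    have := p₁ KK
    simp [h.r_KK, h.s_KK] at this
    omega
  have w₂K : pair w₂ KK = 0 := by
    have := p₂ KK
    simp [h.r_KK, h.s_KK] at this
    omega
  have w₁w₁ : pair w₁ w₁ = 2 := by
    have := p₁ w₁
    simp [pair_comm (r _) w₁, pair_comm (s _) w₁, w₁r, w₁s] at this
    omega
  have w₁w₂ : pair w₁ w₂ = 0 := by
    have := p₁ w₂
    simp [pair_comm (r _) w₂, pair_comm (s _) w₂, w₂r, w₂s] at this
    omega
  have w₂w₂ : pair w₂ w₂ = 2 := by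
    have := p₂ w₂
    simp [pair_comm (r _) w₂, pair_comm (s _) w₂, w₂r, w₂s] at this
    omega
  clear p₁ p₂ h₁ h₂
  ext i j
  fin_cases i <;> fin_cases j <;>
    simp [gram, glueGram, glueBasis, pair_comm (r _) w₁, pair_comm (s _) w₁,
      pair_comm (r _) w₂, pair_comm (s _) w₂, pair_comm w₂ w₁, pair_comm KK w₁, pair_comm KK w₂,
      pair_comm KK (r _), pair_comm KK (s _), pair_KK,
      h.rr, h.ss, h.rs, h.sr, h.r_KK, h.s_KK, w₁r, w₁s, w₂r, w₂s, w₁K, w₂K, w₁w₁, w₁w₂, w₂w₂,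
      hrr, hss, hrs, hsr]

/-- Any two eleven-element root sets are related by an isometry of the lattice fixing `KK`. -/
lemma exists_isometry_of_isRootSet {R R' : Finset Lat} (hR : IsRootSet R) (hc : R.card = 11)
    (hR' : IsRootSet R') (hc' : R'.card = 11) :
    ∃ φ : Lat ≃ₗ[ℤ] Lat, (∀ v u, pair (φ v) (φ u) = pair v u) ∧ φ KK = KK ∧
      ∀ y, φ y ∈ R' ↔ y ∈ R := by
  obtain ⟨r, s, w₁, w₂, h, h₁, h₂⟩ := exists_glue_frame hR hc
  obtain ⟨r', s', w₁', w₂', h', h₁', h₂'⟩ := exists_glue_frame hR' hc'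
  have hG := gram_glueBasis h.frame h₁ h₂
  obtain ⟨φ, hφ, hb⟩ := exists_isometry (hG ▸ isUnit_det_glueGram)
    ((gram_glueBasis h'.frame h₁' h₂').trans hG.symm)
  have hw₁ : φ w₁ = w₁' := hb 0
  have hs₀ : φ (s 0) = s' 0 := hb 1
  have hw₂ : φ w₂ = w₂' := hb 2
  have hs₁ : φ (s 1) = s' 1 := hb 3
  have hr₂ : φ (r 2) = r' 2 := hb 4
  have hs₂ : φ (s 2) = s' 2 := hb 5
  have hr₃ : φ (r 3) = r' 3 := hb 6
  have hs₃ : φ (s 3) = s' 3 := hb 7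
  have hr₀ : φ (r 0) = r' 0 := by
    have e : r 0 = (3 : ℤ) • w₁ + s 0 - (r 2 - s 2) - (r 3 - s 3) := by rw [h₁]; abel
    have e' : r' 0 = (3 : ℤ) • w₁' + s' 0 - (r' 2 - s' 2) - (r' 3 - s' 3) := by rw [h₁']; abel
    rw [e, e']
    simp only [map_sub, map_add, map_smul, hw₁, hs₀, hr₂, hs₂, hr₃, hs₃]
  have hr₁ : φ (r 1) = r' 1 := by
    have e : r 1 = (3 : ℤ) • w₂ + s 1 - (r 2 - s 2) + (r 3 - s 3) := by rw [h₂]; abel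
    have e' : r' 1 = (3 : ℤ) • w₂' + s' 1 - (r' 2 - s' 2) + (r' 3 - s' 3) := by rw [h₂']; abel
    rw [e, e']
    simp only [map_sub, map_add, map_smul, hw₂, hs₁, hr₂, hs₂, hr₃, hs₃]
  have hr : ∀ i, φ (r i) = r' i := by simp [Fin.forall_fin_succ, *]
  have hs : ∀ i, φ (s i) = s' i := by simp [Fin.forall_fin_succ, *]
  refine ⟨φ, hφ, hb 8, fun y => ?_⟩
  rw [h.mem_iff, h'.mem_iff]
  simp only [← hr, ← hs, ← map_add, ← map_neg, φ.injective.eq_iff]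

lemma isExceptional_iff {d : Lat} : IsExceptional d ↔ pair d d = 1 ∧ pair d KK = 1 := by
  rw [IsExceptional, pair_apply, pair_apply]
  omega

/-- Translation by `KK` turns exceptional vectors into roots. -/
lemma isRootSet_image {S : Finset Lat} (hS : ∀ d ∈ S, IsExceptional d)
    (h : ∀ d ∈ S, ∀ e ∈ S, d ≠ e → dot d e = 1 ∨ dot d e = 2) :
    IsRootSet (S.image (· + KK)) := by
  refine ⟨?_, ?_, ?_⟩
  · simp only [Finset.forall_mem_image]
    intro d hd
    simp [(isExceptional_iff.1 (hS d hd)).2, pair_KK]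
  · simp only [Finset.forall_mem_image]
    intro d hd
    simp [(isExceptional_iff.1 (hS d hd)).2, (isExceptional_iff.1 (hS d hd)).1,
      pair_comm KK d, pair_KK]
  · simp only [Finset.forall_mem_image]
    intro d hd e he hde
    simp only [map_add, LinearMap.add_apply, pair_apply d e,
      (isExceptional_iff.1 (hS d hd)).2, (isExceptional_iff.1 (hS e he)).2, pair_comm KK e,
      pair_KK]
    rcases h d hd e he (fun hh => hde (by rw [hh])) with h | h <;> omega

end ExceptionalVectors

open ExceptionalVectors

/-- `W` acts transitively on the sets of 11 exceptional vectors whose pairwise products all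
lie in {1, 2}. -/
theorem stmt_12 (S₁ S₂ : Finset (Fin 9 → ℤ))
    (h₁exc : ∀ d ∈ S₁, IsExceptional d) (h₂exc : ∀ d ∈ S₂, IsExceptional d)
    (h₁ : ∀ d ∈ S₁, ∀ e ∈ S₁, d ≠ e → dot d e = 1 ∨ dot d e = 2)
    (h₂ : ∀ d ∈ S₂, ∀ e ∈ S₂, d ≠ e → dot d e = 1 ∨ dot d e = 2)
    (h₁card : S₁.card = 11) (h₂card : S₂.card = 11) :
    ∃ σ : (Fin 9 → ℤ) → (Fin 9 → ℤ), MemW σ ∧ σ '' (S₁ : Set (Fin 9 → ℤ)) = S₂ := by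
  obtain ⟨φ, hφ, hK, hm⟩ := exists_isometry_of_isRootSet (isRootSet_image h₁exc h₁)
    (by rw [Finset.card_image_of_injective _ (add_left_injective KK), h₁card])
    (isRootSet_image h₂exc h₂)
    (by rw [Finset.card_image_of_injective _ (add_left_injective KK), h₂card])
  have hmem : ∀ d, φ d ∈ S₂ ↔ d ∈ S₁ := fun d => by
    have := hm (d + KK)
    rw [map_add, hK] at this
    simpa using this
  have hexc : ∀ d, IsExceptional (φ d) ↔ IsExceptional d := fun d => by
    have := hφ d KK
    rw [hK] at this
    rw [isExceptional_iff, isExceptional_iff, hφ, this]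
  refine ⟨φ, ⟨⟨fun d hd => (hexc d).2 hd, φ.injective.injOn, fun d hd => ?_⟩, fun d _ e _ => ?_⟩,
    ?_⟩
  · exact ⟨φ.symm d, (hexc _).1 (by rwa [φ.apply_symm_apply]), φ.apply_symm_apply d⟩
  · exact neg_injective (hφ d e)
  · ext d
    rw [← φ.apply_symm_apply d, φ.injective.mem_set_image]
    exact (hmem _).symm
end

section
/- Let R₁, …, R₉ ∈ k³ ∖ {0} represent nine points of ℙ²(k). For i ∈ {7, 8, 9} let αᵢ, βᵢ, γᵢ be variables with {αᵢ, βᵢ, γᵢ} = {x, y, z}. Let H be the 15×15 matrix whose i-th row, for i ≤ 9, consists of the monomials Mon₄ (the 15 degree-4 monomials in x, y, z in lexicographic order with x > y > z) evaluated at Rᵢ, and whose remaining six rows are the partial derivatives of the monomials in Mon₄ with respect to β₇ and γ₇ evaluated at R₇, with respect to β₈ and γ₈ evaluated at R₈, and with respect to β₉ and γ₉ evaluated at R₉. If there is a nonzero homogeneous quartic F ∈ k[x, y, z] vanishing at R₁, …, R₉ and singular at each of R₇, R₈, R₉, then det(H) = 0; conversely, if for each i ∈ {7, 8, 9} the αᵢ-coordinate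 of Rᵢ is nonzero and det(H) = 0, then such a quartic exists. -/
open MvPolynomial

/-- `Mon₄`, the fifteen degree-4 monomials in `x, y, z` in lexicographic order with
`x > y > z`. -/
noncomputable def mon4 (k : Type*) [CommSemiring k] : Fin 15 → MvPolynomial (Fin 3) k :=
  ![X 0 ^ 4, X 0 ^ 3 * X 1, X 0 ^ 3 * X 2, X 0 ^ 2 * X 1 ^ 2, X 0 ^ 2 * X 1 * X 2,
    X 0 ^ 2 * X 2 ^ 2, X 0 * X 1 ^ 3, X 0 * X 1 ^ 2 * X 2, X 0 * X 1 * X 2 ^ 2,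
    X 0 * X 2 ^ 3, X 1 ^ 4, X 1 ^ 3 * X 2, X 1 ^ 2 * X 2 ^ 2, X 1 * X 2 ^ 3, X 2 ^ 4]

/-- The 15×15 matrix `H` for points `R₁, …, R₉`, where for `t ∈ {0,1,2}` the permutation
`a t` of the variables records `(α, β, γ)` for the point `R₇`, `R₈`, `R₉` respectively:
rows 1–9 are `Mon₄` evaluated at `R₁, …, R₉`, and rows 10–15 are the derivatives of `Mon₄`
with respect to `β₇, γ₇` at `R₇`, `β₈, γ₈` at `R₈`, and `β₉, γ₉` at `R₉`. -/
noncomputable def Hmat {k : Type*} [CommSemiring k] (R : Fin 9 → Fin 3 → k)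
    (a : Fin 3 → Equiv.Perm (Fin 3)) : Matrix (Fin 15) (Fin 15) k :=
  Matrix.of fun i j =>
    if h : (i : ℕ) < 9 then MvPolynomial.eval (R ⟨i, h⟩) (mon4 k j)
    else if (i : ℕ) = 9 then MvPolynomial.eval (R 6) (pderiv (a 0 1) (mon4 k j))
    else if (i : ℕ) = 10 then MvPolynomial.eval (R 6) (pderiv (a 0 2) (mon4 k j))
    else if (i : ℕ) = 11 then MvPolynomial.eval (R 7) (pderiv (a 1 1) (mon4 k j))
    else if (i : ℕ) = 12 then MvPolynomial.eval (R 7) (pderiv (a 1 2) (mon4 k j))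
    else if (i : ℕ) = 13 then MvPolynomial.eval (R 8) (pderiv (a 2 1) (mon4 k j))
    else MvPolynomial.eval (R 8) (pderiv (a 2 2) (mon4 k j))

/-- The exponent vectors of the monomials in `mon4`. -/
def mon4Exponent : Fin 15 → Fin 3 → ℕ :=
  ![![4, 0, 0], ![3, 1, 0], ![3, 0, 1], ![2, 2, 0], ![2, 1, 1], ![2, 0, 2], ![1, 3, 0],
    ![1, 2, 1], ![1, 1, 2], ![1, 0, 3], ![0, 4, 0], ![0, 3, 1], ![0, 2, 2], ![0, 1, 3],
    ![0, 0, 4]]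

theorem mon4Exponent_injective : Function.Injective mon4Exponent := by
  decide

theorem sum_mon4Exponent (j : Fin 15) : ∑ s, mon4Exponent j s = 4 := by
  revert j; decide

theorem exists_mon4Exponent_eq (d : Fin 3 → ℕ) (hd : ∑ s, d s = 4) :
    ∃ j, mon4Exponent j = d := by
  have key : ∀ a b : Fin 5, (a : ℕ) + b ≤ 4 →
      ∃ j, mon4Exponent j 0 = a ∧ mon4Exponent j 1 = b := by decide
  rw [Fin.sum_univ_three] at hd
  obtain ⟨j, h0, h1⟩ := key ⟨d 0, by omega⟩ ⟨d 1, by omega⟩ (by simp only; omega)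
  have h2 := sum_mon4Exponent j
  rw [Fin.sum_univ_three] at h2
  simp only at h0 h1
  refine ⟨j, funext fun s => ?_⟩
  fin_cases s
  · exact h0
  · exact h1
  · change mon4Exponent j 2 = d 2
    omega

theorem mon4_eq_monomial (k : Type*) [CommSemiring k] (j : Fin 15) :
    mon4 k j = monomial (Finsupp.equivFunOnFinite.symm (mon4Exponent j)) 1 := by
  rw [monomial_eq, Finsupp.prod_fintype _ _ (fun _ => pow_zero _), Fin.prod_univ_three]
  fin_cases j <;> simp [mon4, mon4Exponent]

theorem coeff_sum_smul_mon4 {k : Type*} [CommSemiring k] (v : Fin 15 → k) (j : Fin 15) :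
    coeff (Finsupp.equivFunOnFinite.symm (mon4Exponent j)) (∑ i, v i • mon4 k i) = v j := by
  simp [coeff_sum, mon4_eq_monomial, coeff_monomial, mon4Exponent_injective.eq_iff]

theorem isHomogeneous_sum_smul_mon4 {k : Type*} [CommSemiring k] (v : Fin 15 → k) :
    (∑ i, v i • mon4 k i).IsHomogeneous 4 := by
  refine IsHomogeneous.sum _ _ _ fun j _ => ?_
  rw [mon4_eq_monomial, smul_monomial]
  refine isHomogeneous_monomial _ ?_
  rw [Finsupp.degree_eq_sum]
  exact sum_mon4Exponent j

theorem MvPolynomial.IsHomogeneous.eq_sum_smul_mon4 {k : Type*} [CommSemiring k]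
    {F : MvPolynomial (Fin 3) k} (hF : F.IsHomogeneous 4) :
    F = ∑ j, coeff (Finsupp.equivFunOnFinite.symm (mon4Exponent j)) F • mon4 k j := by
  ext d
  by_cases hd : d.degree = 4
  · obtain ⟨j, hj⟩ := exists_mon4Exponent_eq d (by rwa [← Finsupp.degree_eq_sum])
    obtain rfl : Finsupp.equivFunOnFinite.symm (mon4Exponent j) = d := by
      ext s; simp [hj]
    rw [coeff_sum_smul_mon4]
  · rw [hF.coeff_eq_zero hd, (isHomogeneous_sum_smul_mon4 _).coeff_eq_zero hd]

/-- The kernel of `Hmat R a` consists of the coefficient vectors of quartics that vanish at all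
nine points and whose derivatives in the two chosen directions vanish at the last three. -/
theorem Hmat_mulVec_eq_zero_iff {k : Type*} [CommSemiring k] (R : Fin 9 → Fin 3 → k)
    (a : Fin 3 → Equiv.Perm (Fin 3)) (v : Fin 15 → k) :
    (Hmat R a).mulVec v = 0 ↔
      (∀ i, eval (R i) (∑ j, v j • mon4 k j) = 0) ∧
      ∀ t : Fin 3,
        eval (R (Fin.natAdd 6 t)) (pderiv (a t 1) (∑ j, v j • mon4 k j)) = 0 ∧
        eval (R (Fin.natAdd 6 t)) (pderiv (a t 2) (∑ j, v j • mon4 k j)) = 0 := by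
  have hv (p : Fin 3 → k) : eval p (∑ j, v j • mon4 k j) = ∑ j, eval p (mon4 k j) * v j := by
    simp [map_sum, smul_eval, mul_comm]
  have hd (p : Fin 3 → k) (s : Fin 3) : eval p (pderiv s (∑ j, v j • mon4 k j)) =
      ∑ j, eval p (pderiv s (mon4 k j)) * v j := by
    simp [map_sum, smul_eval, mul_comm]
  simp only [hv, hd, funext_iff, Matrix.mulVec, dotProduct, Pi.zero_apply]
  constructor
  · intro h
    refine ⟨fun i => ?_, fun t => ?_⟩
    · simpa [Hmat] using h (Fin.castLE (by norm_num) i)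
    · fin_cases t
      · exact ⟨h 9, h 10⟩
      · exact ⟨h 11, h 12⟩
      · exact ⟨h 13, h 14⟩
  · rintro ⟨h, h'⟩ i
    by_cases hi : (i : ℕ) < 9
    · simpa [Hmat, hi] using h ⟨i, hi⟩
    · obtain rfl | rfl | rfl | rfl | rfl | rfl :
          i = 9 ∨ i = 10 ∨ i = 11 ∨ i = 12 ∨ i = 13 ∨ i = 14 := by omega
      · exact (h' 0).1
      · exact (h' 0).2
      · exact (h' 1).1
      · exact (h' 1).2
      · exact (h' 2).1
      · exact (h' 2).2

theorem MvPolynomial.IsHomogeneous.eval_pderiv_eq_zero {k : Type*} [CommRing k] [IsDomain k]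
    {F : MvPolynomial (Fin 3) k} {n : ℕ} (hF : F.IsHomogeneous n) {p : Fin 3 → k}
    (a : Equiv.Perm (Fin 3)) (hp : p (a 0) ≠ 0) (h0 : eval p F = 0)
    (h1 : eval p (pderiv (a 1) F) = 0) (h2 : eval p (pderiv (a 2) F) = 0) (s : Fin 3) :
    eval p (pderiv s F) = 0 := by
  have euler := congrArg (eval p) hF.sum_X_mul_pderiv
  rw [← Equiv.sum_comp a, Fin.sum_univ_three] at euler
  simp only [map_add, map_mul, eval_X, map_nsmul, h0, h1, h2, mul_zero, add_zero, smul_zero,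
    mul_eq_zero, hp, false_or] at euler
  obtain ⟨u, rfl⟩ := a.surjective s
  fin_cases u
  · exact euler
  · exact h1
  · exact h2

/-- If a nonzero homogeneous quartic vanishes at `R₁, …, R₉` and is singular at each of
`R₇, R₈, R₉`, then `det H = 0`; conversely, if for each `i ∈ {7,8,9}` the `αᵢ`-coordinate of
`Rᵢ` is nonzero and `det H = 0`, then such a quartic exists. -/
theorem stmt_15 {k : Type*} [Field k] [IsAlgClosed k]
    (R : Fin 9 → Fin 3 → k) (hR : ∀ i, R i ≠ 0) (a : Fin 3 → Equiv.Perm (Fin 3)) :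
    ((∃ F : MvPolynomial (Fin 3) k, F ≠ 0 ∧ F.IsHomogeneous 4 ∧
        (∀ i, MvPolynomial.eval (R i) F = 0) ∧
        (∀ t : Fin 3, ∀ s : Fin 3,
          MvPolynomial.eval (R (Fin.natAdd 6 t)) (pderiv s F) = 0)) →
      (Hmat R a).det = 0) ∧
    ((∀ t : Fin 3, R (Fin.natAdd 6 t) (a t 0) ≠ 0) → (Hmat R a).det = 0 →
      ∃ F : MvPolynomial (Fin 3) k, F ≠ 0 ∧ F.IsHomogeneous 4 ∧
        (∀ i, MvPolynomial.eval (R i) F = 0) ∧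
        (∀ t : Fin 3, ∀ s : Fin 3,
          MvPolynomial.eval (R (Fin.natAdd 6 t)) (pderiv s F) = 0)) := by
  constructor
  · rintro ⟨F, hF0, hF, hv, hs⟩
    refine Matrix.exists_mulVec_eq_zero_iff.mp
      ⟨fun j => coeff (Finsupp.equivFunOnFinite.symm (mon4Exponent j)) F, fun h => hF0 ?_, ?_⟩
    · rw [hF.eq_sum_smul_mon4]
      exact Finset.sum_eq_zero fun j _ => by rw [congrFun h j, Pi.zero_apply, zero_smul]
    · rw [Hmat_mulVec_eq_zero_iff, ← hF.eq_sum_smul_mon4]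
      exact ⟨hv, fun t => ⟨hs t _, hs t _⟩⟩
  · intro ha hdet
    obtain ⟨v, hv0, hv⟩ := Matrix.exists_mulVec_eq_zero_iff.mpr hdet
    rw [Hmat_mulVec_eq_zero_iff] at hv
    have hF := isHomogeneous_sum_smul_mon4 v
    refine ⟨∑ j, v j • mon4 k j, fun h => hv0 ?_, hF, hv.1, fun t s =>
      hF.eval_pderiv_eq_zero (a t) (ha t) (hv.1 _) (hv.2 t).1 (hv.2 t).2 s⟩
    ext j
    rw [← coeff_sum_smul_mon4 v j, h, coeff_zero, Pi.zero_apply]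
end

section
/- Let R₁, …, R₇ be seven distinct points of ℙ²(k) such that no three of R₁, …, R₆ are collinear and R₁, …, R₆ do not lie on a common conic, and such that the line L through R₁ and R₇ contains none of R₂, …, R₆. Then there is a cubic containing all seven points that is singular at R₁, it is unique up to a nonzero scalar multiple of its defining polynomial, and its defining polynomial is not divisible by a linear form defining L (i.e. the cubic does not contain L). -/
open MvPolynomial

/-- Three points of `ℙ²(k)` (represented by vectors in `k³`) are collinear: they lie on a
common line, i.e. there is a nonzero homogeneous linear form vanishing at all three. -/
def Collinear3 {k : Type*} [CommSemiring k] (P Q R : Fin 3 → k) : Prop :=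
  ∃ L : MvPolynomial (Fin 3) k, L ≠ 0 ∧ L.IsHomogeneous 1 ∧
    MvPolynomial.eval P L = 0 ∧ MvPolynomial.eval Q L = 0 ∧ MvPolynomial.eval R L = 0

/-- Induction for cubic forms: sums and scalar multiples of products of three variables. -/
theorem MvPolynomial.IsHomogeneous.cubic_induction {σ k : Type*} [CommSemiring k]
    {p : MvPolynomial σ k → Prop} (zero : p 0) (add : ∀ F G, p F → p G → p (F + G))
    (mul : ∀ (r : k) a b c, p (C r * (X a * X b * X c)))
    {F : MvPolynomial σ k} (hF : F.IsHomogeneous 3) : p F := by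
  classical
  rw [F.as_sum]
  refine Finset.sum_induction _ p add zero fun m hm => ?_
  have hdeg : Multiset.card (Finsupp.toMultiset m) = 3 := by
    rw [Finsupp.card_toMultiset, hF.degree_eq_sum_deg_support hm]; rfl
  obtain ⟨a, b, c, habc⟩ := Multiset.card_eq_three.mp hdeg
  have hprod : monomial m (1 : k) = X a * X b * X c := by
    have hm : m = Finsupp.single a 1 + Finsupp.single b 1 + Finsupp.single c 1 := by
      rw [← Finsupp.toMultiset_toFinsupp m, habc, Multiset.insert_eq_cons, Multiset.insert_eq_cons,
        ← Multiset.singleton_add, ← Multiset.singleton_add]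
      simp only [map_add, Multiset.toFinsupp_singleton, add_assoc]
    rw [hm]
    simp only [X, monomial_mul, mul_one]
  rw [← mul_one (coeff m F), ← C_mul_monomial, hprod]
  exact mul _ a b c

/-- The restriction of a cubic form to the line through two points. -/
theorem MvPolynomial.IsHomogeneous.eval_smul_add_smul_of_cubic {σ k : Type*} [Fintype σ]
    [CommRing k] {F : MvPolynomial σ k} (hF : F.IsHomogeneous 3) (s t : k) (P Q : σ → k) :
    eval (s • P + t • Q) F = s ^ 3 * eval P F + s ^ 2 * t * ∑ i, eval P (pderiv i F) * Q i +
      s * t ^ 2 * ∑ i, eval Q (pderiv i F) * P i + t ^ 3 * eval Q F := by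
  classical
  refine hF.cubic_induction (p := fun F => eval (s • P + t • Q) F = s ^ 3 * eval P F +
      s ^ 2 * t * ∑ i, eval P (pderiv i F) * Q i +
      s * t ^ 2 * ∑ i, eval Q (pderiv i F) * P i + t ^ 3 * eval Q F)
    (by simp) (fun F G h₁ h₂ => ?_) (fun r a b c => ?_)
  · simp only [map_add, h₁, h₂, add_mul, Finset.sum_add_distrib]
    ring
  · simp only [map_mul, eval_C, eval_X, Pi.add_apply, Pi.smul_apply, smul_eq_mul, pderiv_mul,
      pderiv_C, pderiv_X, map_add, map_zero, Pi.single_apply, apply_ite (eval _),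
      zero_mul, mul_ite, ite_mul, mul_one, mul_zero, one_mul, zero_add, add_mul, mul_add,
      Finset.sum_add_distrib, Finset.sum_ite_eq, Finset.mem_univ, if_true]
    ring

/-- A polynomial is congruent modulo `ℓ` to its composition with a substitution that is the
identity modulo `ℓ`. -/
theorem MvPolynomial.dvd_sub_aeval_X_sub {σ k : Type*} [CommRing k] (F ℓ : MvPolynomial σ k)
    (b : σ → k) : ℓ ∣ F - aeval (fun i => X i - C (b i) * ℓ) F := by
  induction F using MvPolynomial.induction_on with
  | C a => simp
  | add p q hp hq =>
    rw [map_add, add_sub_add_comm]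
    exact dvd_add hp hq
  | mul_X p i hp =>
    obtain ⟨d, hd⟩ := hp
    refine ⟨d * X i + aeval (fun i => X i - C (b i) * ℓ) p * C (b i), ?_⟩
    rw [map_mul, aeval_X]
    linear_combination X i * hd

theorem MvPolynomial.IsHomogeneous.eval_eq_sum_mul_eval_pderiv {σ k : Type*} [Fintype σ]
    [CommSemiring k] {ℓ : MvPolynomial σ k} (hℓ : ℓ.IsHomogeneous 1) (v w : σ → k) :
    eval v ℓ = ∑ i, v i * eval w (pderiv i ℓ) := by
  classical
  have hmem : ℓ ∈ Submodule.span k (Set.range X) := by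
    rwa [← homogeneousSubmodule_one_eq_span_X]
  refine Submodule.span_induction (p := fun ℓ _ => eval v ℓ = ∑ i, v i * eval w (pderiv i ℓ))
    ?_ (by simp) (fun p q _ _ hp hq => ?_) (fun a p _ hp => ?_) hmem
  · rintro _ ⟨i, rfl⟩
    simp [pderiv_X, Pi.single_apply, apply_ite (eval w)]
  · simp [hp, hq, mul_add, Finset.sum_add_distrib]
  · simp [hp, Finset.mul_sum, mul_left_comm]

theorem MvPolynomial.IsHomogeneous.exists_isHomogeneous_eq_mul {σ k : Type*} [CommRing k]
    {F ℓ : MvPolynomial σ k} {m n : ℕ} (hF : F.IsHomogeneous (m + n)) (hℓ : ℓ.IsHomogeneous m)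
    (h : ℓ ∣ F) : ∃ Q : MvPolynomial σ k, Q.IsHomogeneous n ∧ F = ℓ * Q := by
  classical
  let := MvPolynomial.gradedAlgebra (σ := σ) (R := k)
  obtain ⟨Q, rfl⟩ := h
  refine ⟨_, (DirectSum.decompose (homogeneousSubmodule σ k) Q n).2, ?_⟩
  have := DirectSum.coe_decompose_mul_add_of_left_mem (homogeneousSubmodule σ k) (j := n) (b := Q)
    hℓ
  rw [DirectSum.decompose_of_mem_same _ hF] at this
  exact this

/-- There is a cubic through seven given points that is singular at the first one. -/
theorem exists_cubic_singular_at_zero {k : Type*} [Field k] (R : Fin 7 → Fin 3 → k)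
    (hR0 : R 0 ≠ 0) :
    ∃ F : MvPolynomial (Fin 3) k,
      F ≠ 0 ∧ F.IsHomogeneous 3 ∧ (∀ i, MvPolynomial.eval (R i) F = 0) ∧
        (∀ t : Fin 3, MvPolynomial.eval (R 0) (pderiv t F) = 0) := by
  classical
  obtain ⟨j, hj⟩ := Function.ne_iff.mp hR0
  let e : (Fin 3 → ℕ) ≃ (Fin 3 →₀ ℕ) := Finsupp.equivFunOnFinite.symm
  let I := {x // x ∈ Finset.Nat.antidiagonalTuple 3 3}
  let Φ : (I → k) →ₗ[k] MvPolynomial (Fin 3) k :=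
    Fintype.linearCombination k fun d : I => monomial (e d) 1
  let E : MvPolynomial (Fin 3) k →ₗ[k] (Fin 7 → k) × ({t // t ≠ j} → k) :=
    (LinearMap.pi fun i => (aeval (R i)).toLinearMap).prod
      (LinearMap.pi fun t => (aeval (R 0)).toLinearMap ∘ₗ (pderiv t.1).toLinearMap)
  have hcard : Fintype.card I = 10 := by
    rw [Fintype.card_coe]; decide
  have hker : LinearMap.ker (E ∘ₗ Φ) ≠ ⊥ := by
    apply LinearMap.ker_ne_bot_of_finrank_lt
    simp [hcard]
  obtain ⟨c, hc, hc0⟩ := Submodule.exists_mem_ne_zero_of_ne_bot hker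
  have hE : E (Φ c) = 0 := hc
  have hΦ : Φ c = ∑ d : I, monomial (e d) (c d) := by
    simp [Φ, Fintype.linearCombination_apply, smul_monomial]
  have hhom : (Φ c).IsHomogeneous 3 := by
    rw [hΦ]
    refine IsHomogeneous.sum _ _ _ fun d _ => isHomogeneous_monomial _ ?_
    rw [Finsupp.degree_eq_sum]
    exact Finset.Nat.mem_antidiagonalTuple.mp d.2
  have hev : ∀ i, eval (R i) (Φ c) = 0 := fun i => by
    simpa [E, aeval_eq_eval] using congrFun (congrArg Prod.fst hE) i
  have hd : ∀ t ≠ j, eval (R 0) (pderiv t (Φ c)) = 0 := fun t ht => by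
    simpa [E, aeval_eq_eval] using congrFun (congrArg Prod.snd hE) ⟨t, ht⟩
  refine ⟨Φ c, fun h => hc0 ?_, hhom, hev, fun t => ?_⟩
  · funext d
    have := congrArg (coeff (e d)) h
    rw [hΦ, coeff_sum, Finset.sum_eq_single d] at this
    · simpa using this
    · intro b _ hb
      rw [coeff_monomial, if_neg (fun h => hb (Subtype.ext (e.injective h)))]
    · simp
  · by_cases ht : t = j
    · have := congrArg (eval (R 0)) hhom.sum_X_mul_pderiv
      rw [map_sum, Finset.sum_eq_single j (fun b _ hb => by rw [map_mul, hd b hb, mul_zero])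
        (by simp), map_mul, eval_X, map_nsmul, hev, smul_zero] at this
      subst ht
      exact (mul_eq_zero.mp this).resolve_left hj
    · exact hd t ht

theorem crossProduct_ne_zero {k : Type*} [Field k] {P Q : Fin 3 → k} (hP : P ≠ 0)
    (hPQ : ¬ ∃ c : k, Q = c • P) : crossProduct P Q ≠ 0 := by
  rw [crossProduct_ne_zero_iff_linearIndependent, LinearIndependent.pair_iff' hP]
  exact fun a ha => hPQ ⟨a, ha.symm⟩

/-- The linear form defining the line through `P` and `Q`, with coefficients `P × Q`. -/
noncomputable def lineForm {k : Type*} [CommRing k] (P Q : Fin 3 → k) : MvPolynomial (Fin 3) k :=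
  ∑ i, C (crossProduct P Q i) * X i

theorem lineForm_isHomogeneous {k : Type*} [CommRing k] (P Q : Fin 3 → k) :
    (lineForm P Q).IsHomogeneous 1 :=
  IsHomogeneous.sum _ _ _ fun _ _ => isHomogeneous_C_mul_X _ _

theorem eval_lineForm {k : Type*} [CommRing k] (P Q v : Fin 3 → k) :
    eval v (lineForm P Q) = ∑ i, crossProduct P Q i * v i := by
  simp [lineForm]

/-- A polynomial vanishing on the line through `P` and `Q` is divisible by its linear form. -/
theorem lineForm_dvd {k : Type*} [Field k] [Infinite k] {P Q : Fin 3 → k}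
    (hPQ : crossProduct P Q ≠ 0) {F : MvPolynomial (Fin 3) k}
    (h : ∀ s t : k, eval (s • P + t • Q) F = 0) : lineForm P Q ∣ F := by
  classical
  obtain ⟨j, hj⟩ := Function.ne_iff.mp hPQ
  let b : Fin 3 → k := Pi.single j (crossProduct P Q j)⁻¹
  have hb : eval b (lineForm P Q) = 1 := by
    rw [eval_lineForm, Finset.sum_eq_single j (fun i _ hi => by simp [b, hi]) (by simp)]
    simpa [b] using mul_inv_cancel₀ hj
  have hzero : aeval (fun i => X i - C (b i) * lineForm P Q) F = 0 := by
    refine MvPolynomial.funext fun v => ?_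
    rw [map_zero, ← h (eval b (lineForm v Q)) (eval b (lineForm P v)), aeval_def, eval_eval₂]
    rw [show (eval v).comp (algebraMap k (MvPolynomial (Fin 3) k)) = RingHom.id k by ext; simp]
    change eval _ F = eval _ F
    congr 2
    funext i
    rw [eval_lineForm] at hb
    simp only [map_sub, map_mul, eval_X, eval_C, eval_lineForm, Pi.add_apply, Pi.smul_apply,
      smul_eq_mul]
    simp only [Fin.sum_univ_three, cross_apply] at hb ⊢
    fin_cases i <;> simp at hb ⊢ <;> linear_combination -v _ * hb
  have hdvd := dvd_sub_aeval_X_sub F (lineForm P Q) b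
  rwa [hzero, sub_zero] at hdvd

theorem lineForm_ne_zero {k : Type*} [CommRing k] {P Q : Fin 3 → k} (h : crossProduct P Q ≠ 0) :
    lineForm P Q ≠ 0 := by
  classical
  obtain ⟨j, hj⟩ := Function.ne_iff.mp h
  intro h0
  apply hj
  simpa [eval_lineForm, Pi.single_apply] using congrArg (eval (Pi.single j 1)) h0




/-- Let `R₁, …, R₇` be seven distinct points of `ℙ²(k)` such that no three of `R₁, …, R₆` are
collinear, `R₁, …, R₆` do not lie on a common conic, and any line through `R₁` and `R₇`
contains none of `R₂, …, R₆`. Then there is a cubic through all seven points singular at `R₁`,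
unique up to a nonzero scalar, and not containing the line through `R₁` and `R₇`. -/
theorem stmt_17 {k : Type*} [Field k] [IsAlgClosed k]
    (R : Fin 7 → Fin 3 → k) (hR0 : ∀ i, R i ≠ 0)
    (hdist : ∀ i j, i ≠ j → ¬ ∃ c : k, R j = c • R i)
    (hnoline : ∀ i j l : Fin 7, i ≠ j → i ≠ l → j ≠ l → i ≠ 6 → j ≠ 6 → l ≠ 6 →
      ¬ Collinear3 (R i) (R j) (R l))
    (hnoconic : ¬ ∃ G : MvPolynomial (Fin 3) k, G ≠ 0 ∧ G.IsHomogeneous 2 ∧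
      ∀ i : Fin 7, i ≠ 6 → MvPolynomial.eval (R i) G = 0)
    (hL : ∀ ℓ : MvPolynomial (Fin 3) k, ℓ ≠ 0 → ℓ.IsHomogeneous 1 →
      MvPolynomial.eval (R 0) ℓ = 0 → MvPolynomial.eval (R 6) ℓ = 0 →
      ∀ i : Fin 7, i ≠ 0 → i ≠ 6 → MvPolynomial.eval (R i) ℓ ≠ 0) :
    ∃ F : MvPolynomial (Fin 3) k,
      (F ≠ 0 ∧ F.IsHomogeneous 3 ∧ (∀ i, MvPolynomial.eval (R i) F = 0) ∧
        (∀ t : Fin 3, MvPolynomial.eval (R 0) (pderiv t F) = 0)) ∧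
      (∀ G : MvPolynomial (Fin 3) k, G ≠ 0 → G.IsHomogeneous 3 →
        (∀ i, MvPolynomial.eval (R i) G = 0) →
        (∀ t : Fin 3, MvPolynomial.eval (R 0) (pderiv t G) = 0) →
        ∃ c : k, c ≠ 0 ∧ G = c • F) ∧
      (∀ ℓ : MvPolynomial (Fin 3) k, ℓ ≠ 0 → ℓ.IsHomogeneous 1 →
        MvPolynomial.eval (R 0) ℓ = 0 → MvPolynomial.eval (R 6) ℓ = 0 → ¬ ℓ ∣ F) := by
  classical
  have hnodvd : ∀ ℓ : MvPolynomial (Fin 3) k, ℓ ≠ 0 → ℓ.IsHomogeneous 1 → eval (R 0) ℓ = 0 →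
      eval (R 6) ℓ = 0 → ∀ F : MvPolynomial (Fin 3) k, F ≠ 0 → F.IsHomogeneous 3 →
      (∀ i, eval (R i) F = 0) → (∀ t, eval (R 0) (pderiv t F) = 0) → ¬ ℓ ∣ F := by
    intro ℓ hℓ0 hℓ hℓP hℓQ F hF0 hF hFR hFd hdvd
    obtain ⟨Q, hQ, rfl⟩ := IsHomogeneous.exists_isHomogeneous_eq_mul (n := 2) hF hℓ hdvd
    refine hnoconic ⟨Q, right_ne_zero_of_mul hF0, hQ, fun i hi => ?_⟩
    by_cases hi0 : i = 0
    · subst hi0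
      by_contra hQ0
      refine hL ℓ hℓ0 hℓ hℓP hℓQ 1 (by decide) (by decide) ?_
      have hd : ∀ t, eval (R 0) (pderiv t ℓ) = 0 := fun t => by
        have := hFd t
        rw [pderiv_mul, map_add, map_mul, map_mul, hℓP, zero_mul, add_zero] at this
        exact (mul_eq_zero.mp this).resolve_right hQ0
      rw [hℓ.eval_eq_sum_mul_eval_pderiv _ (R 0)]
      simp [hd]
    · have := hFR i
      rw [map_mul] at this
      exact (mul_eq_zero.mp this).resolve_left (hL ℓ hℓ0 hℓ hℓP hℓQ i hi0 hi)
  have hcross := crossProduct_ne_zero (hR0 0) (hdist 0 6 (by decide))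
  have hP : eval (R 0) (lineForm (R 0) (R 6)) = 0 := by
    simp [eval_lineForm, Fin.sum_univ_three, cross_apply]; ring
  have hQ : eval (R 6) (lineForm (R 0) (R 6)) = 0 := by
    simp [eval_lineForm, Fin.sum_univ_three, cross_apply]; ring
  have hzero : ∀ F : MvPolynomial (Fin 3) k, F.IsHomogeneous 3 → (∀ i, eval (R i) F = 0) →
      (∀ t, eval (R 0) (pderiv t F) = 0) → eval (R 0 + R 6) F = 0 → F = 0 := by
    intro F hF hFR hFd hs
    by_contra hF0
    refine hnodvd _ (lineForm_ne_zero hcross) (lineForm_isHomogeneous _ _) hP hQ F hF0 hF hFR hFd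
      (lineForm_dvd hcross fun s t => ?_)
    have key := fun s t => hF.eval_smul_add_smul_of_cubic s t (R 0) (R 6)
    simp only [hFR, hFd, mul_zero, zero_mul, Finset.sum_const_zero, zero_add, add_zero] at key
    have h1 := key 1 1
    rw [one_smul, one_smul, hs] at h1
    rw [key, mul_assoc]
    linear_combination -s * t ^ 2 * h1
  obtain ⟨F, hF0, hF, hFR, hFd⟩ := exists_cubic_singular_at_zero R (hR0 0)
  refine ⟨F, ⟨hF0, hF, hFR, hFd⟩, fun G hG0 hG hGR hGd => ?_,
    fun ℓ h₁ h₂ h₃ h₄ => hnodvd ℓ h₁ h₂ h₃ h₄ F hF0 hF hFR hFd⟩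
  have hFs : eval (R 0 + R 6) F ≠ 0 := fun h => hF0 (hzero F hF hFR hFd h)
  have hGs : eval (R 0 + R 6) G ≠ 0 := fun h => hG0 (hzero G hG hGR hGd h)
  refine ⟨eval (R 0 + R 6) G / eval (R 0 + R 6) F, div_ne_zero hGs hFs, ?_⟩
  rw [← sub_eq_zero, smul_eq_C_mul]
  refine hzero _ (hG.sub (hF.C_mul _)) (fun i => by simp [hGR, hFR])
    (fun t => by simp [hGd, hFd]) ?_
  simp [div_mul_cancel₀ _ hFs]
end

section
/- Assume char(k) ≠ 2. Let Q₁, …, Q₈ be eight points of ℙ²(k) in general position, and suppose the four lines L₁ (through Q₁ and Q₂), L₂ (through Q₃ and Q₄), L₃ (through Q₅ and Q₆), and L₄ (through Q₇ and Q₈) all pass through a common point P. Then there do not exist nonzero homogeneous cubics F, G, H ∈ k[x, y, z] such that: F vanishes at Q₁, …, Q₆, Q₈ and is singular at Q₈; G vanishes at Q₁, …, Q₇ and is singular at Q₇; H vanishes at Q₁, …, Q₅, Q₇, Q₈ and is singular at Q₅; and F(P) = G(P) = H(P) = 0. -/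
open MvPolynomial

/-- Eight points of `ℙ²(k)` (represented by vectors in `k³`) are in general position: no three
lie on a common line, no six lie on a common conic, and no cubic contains all eight with a
singularity at one of them. -/
def GenPos8 (k : Type*) [CommSemiring k] (Q : Fin 8 → Fin 3 → k) : Prop :=
  (∀ i j l : Fin 8, i ≠ j → i ≠ l → j ≠ l →
    ¬ ∃ L : MvPolynomial (Fin 3) k, L ≠ 0 ∧ L.IsHomogeneous 1 ∧
      MvPolynomial.eval (Q i) L = 0 ∧ MvPolynomial.eval (Q j) L = 0 ∧
      MvPolynomial.eval (Q l) L = 0) ∧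
  (∀ s : Finset (Fin 8), s.card = 6 →
    ¬ ∃ F : MvPolynomial (Fin 3) k, F ≠ 0 ∧ F.IsHomogeneous 2 ∧
      ∀ i ∈ s, MvPolynomial.eval (Q i) F = 0) ∧
  (∀ j : Fin 8, ¬ ∃ F : MvPolynomial (Fin 3) k, F ≠ 0 ∧ F.IsHomogeneous 3 ∧
    (∀ i, MvPolynomial.eval (Q i) F = 0) ∧
    ∀ t : Fin 3, MvPolynomial.eval (Q j) (pderiv t F) = 0)

theorem quadratic_coeffs_proportional {k : Type*} [Field k] {a b c f g h z z' : k} (hz : z ≠ z')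
    (h₁ : a * z ^ 2 + b * z + c = 0) (h₂ : a * z' ^ 2 + b * z' + c = 0)
    (h₃ : f * z ^ 2 + g * z + h = 0) (h₄ : f * z' ^ 2 + g * z' + h = 0) :
    a * g = f * b ∧ a * h = f * c := by
  have hb : a * (z + z') + b = 0 :=
    mul_left_cancel₀ (sub_ne_zero.2 hz) (by linear_combination h₁ - h₂)
  have hg : f * (z + z') + g = 0 :=
    mul_left_cancel₀ (sub_ne_zero.2 hz) (by linear_combination h₃ - h₄)
  constructor
  · linear_combination a * hg - f * hb
  · linear_combination a * h₃ - f * h₁ - z * (a * hg - f * hb)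

/-- A quartic polynomial vanishing at three distinct points is divisible by the corresponding
linear factors. -/
theorem quartic_coeffs_of_roots {k : Type*} [Field k] {p q r t u a b c : k}
    (hab : a ≠ b) (hac : a ≠ c) (hbc : b ≠ c)
    (ha : p * a ^ 4 + q * a ^ 3 + r * a ^ 2 + t * a + u = 0)
    (hb : p * b ^ 4 + q * b ^ 3 + r * b ^ 2 + t * b + u = 0)
    (hc : p * c ^ 4 + q * c ^ 3 + r * c ^ 2 + t * c + u = 0) :
    r = p * (a * b + a * c + b * c) - (q + p * (a + b + c)) * (a + b + c) ∧
    t = (q + p * (a + b + c)) * (a * b + a * c + b * c) - p * (a * b * c) ∧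
    u = -(q + p * (a + b + c)) * (a * b * c) := by
  have e₁ : p * (a ^ 3 + a ^ 2 * b + a * b ^ 2 + b ^ 3) + q * (a ^ 2 + a * b + b ^ 2) +
      r * (a + b) + t = 0 :=
    mul_left_cancel₀ (sub_ne_zero.2 hab) (by linear_combination ha - hb)
  have e₂ : p * (a ^ 3 + a ^ 2 * c + a * c ^ 2 + c ^ 3) + q * (a ^ 2 + a * c + c ^ 2) +
      r * (a + c) + t = 0 :=
    mul_left_cancel₀ (sub_ne_zero.2 hac) (by linear_combination ha - hc)
  have hr : r = p * (a * b + a * c + b * c) - (q + p * (a + b + c)) * (a + b + c) :=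
    mul_left_cancel₀ (sub_ne_zero.2 hbc) (by linear_combination e₁ - e₂)
  subst hr
  have ht : t = (q + p * (a + b + c)) * (a * b + a * c + b * c) - p * (a * b * c) := by
    linear_combination e₁
  subst ht
  exact ⟨rfl, rfl, by linear_combination ha⟩

/-- Dehomogenised with `P` the point at infinity on the `z`-axis and the line at infinity tangent
at `P`: if `C` and `F` are cubics through `P` and through two points on each of three lines through
`P`, and `F` is singular at a point `(s, w)` of `C`, then the tangent lines of `C` at `P` and
`(s, w)` meet on `C`. -/
theorem tangents_meet_on_cubic {k : Type*} [Field k]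
    {a b₀ b₁ b₂ c₀ c₁ c₂ c₃ f₀ f₁ g₀ g₁ g₂ h₀ h₁ h₂ h₃ s w : k} {x z z' : Fin 3 → k}
    (hf : f₀ * s + f₁ ≠ 0) (hx : Function.Injective x) (hs : ∀ i, s ≠ x i)
    (hz : ∀ i, z i ≠ z' i)
    (hC : ∀ i, a * z i ^ 2 + (b₀ * x i ^ 2 + b₁ * x i + b₂) * z i +
      (c₀ * x i ^ 3 + c₁ * x i ^ 2 + c₂ * x i + c₃) = 0)
    (hC' : ∀ i, a * z' i ^ 2 + (b₀ * x i ^ 2 + b₁ * x i + b₂) * z' i +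
      (c₀ * x i ^ 3 + c₁ * x i ^ 2 + c₂ * x i + c₃) = 0)
    (hF : ∀ i, (f₀ * x i + f₁) * z i ^ 2 + (g₀ * x i ^ 2 + g₁ * x i + g₂) * z i +
      (h₀ * x i ^ 3 + h₁ * x i ^ 2 + h₂ * x i + h₃) = 0)
    (hF' : ∀ i, (f₀ * x i + f₁) * z' i ^ 2 + (g₀ * x i ^ 2 + g₁ * x i + g₂) * z' i +
      (h₀ * x i ^ 3 + h₁ * x i ^ 2 + h₂ * x i + h₃) = 0)
    (hCs : a * w ^ 2 + (b₀ * s ^ 2 + b₁ * s + b₂) * w +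
      (c₀ * s ^ 3 + c₁ * s ^ 2 + c₂ * s + c₃) = 0)
    (hFs : (f₀ * s + f₁) * w ^ 2 + (g₀ * s ^ 2 + g₁ * s + g₂) * w +
      (h₀ * s ^ 3 + h₁ * s ^ 2 + h₂ * s + h₃) = 0)
    (hFx : f₀ * w ^ 2 + (2 * g₀ * s + g₁) * w + (3 * h₀ * s ^ 2 + 2 * h₁ * s + h₂) = 0)
    (hFz : 2 * (f₀ * s + f₁) * w + (g₀ * s ^ 2 + g₁ * s + g₂) = 0) :
    b₀ * ((2 * b₀ * s + b₁) * w + (3 * c₀ * s ^ 2 + 2 * c₁ * s + c₂)) -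
      c₀ * (2 * a * w + (b₀ * s ^ 2 + b₁ * s + b₂)) = 0 := by
  have key i := quadratic_coeffs_proportional (hz i) (hC i) (hC' i) (hF i) (hF' i)
  have h01 : x 0 ≠ x 1 := hx.ne (by decide)
  have h02 : x 0 ≠ x 2 := hx.ne (by decide)
  have h12 : x 1 ≠ x 2 := hx.ne (by decide)
  have hg (i) : (0 : k) * x i ^ 4 + (-f₀ * b₀) * x i ^ 3 + (a * g₀ - f₀ * b₁ - f₁ * b₀) * x i ^ 2 +
      (a * g₁ - f₀ * b₂ - f₁ * b₁) * x i + (a * g₂ - f₁ * b₂) = 0 := by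
    linear_combination (key i).1
  have hh (i) : (-f₀ * c₀) * x i ^ 4 + (a * h₀ - f₀ * c₁ - f₁ * c₀) * x i ^ 3 +
      (a * h₁ - f₀ * c₂ - f₁ * c₁) * x i ^ 2 +
      (a * h₂ - f₀ * c₃ - f₁ * c₂) * x i + (a * h₃ - f₁ * c₃) = 0 := by
    linear_combination (key i).2
  obtain ⟨k₂, k₁, k₀⟩ := quartic_coeffs_of_roots h01 h02 h12 (hg 0) (hg 1) (hg 2)
  obtain ⟨l₂, l₁, l₀⟩ := quartic_coeffs_of_roots h01 h02 h12 (hh 0) (hh 1) (hh 2)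
  set e := x 0 + x 1 + x 2
  set n := a * h₀ - f₀ * c₁ - f₁ * c₀ + -f₀ * c₀ * e with hn
  have hD : (s - x 0) * (s - x 1) * (s - x 2) ≠ 0 :=
    mul_ne_zero (mul_ne_zero (sub_ne_zero.2 (hs 0)) (sub_ne_zero.2 (hs 1))) (sub_ne_zero.2 (hs 2))
  have hN : -f₀ * b₀ * w + -f₀ * c₀ * s + n = 0 := by
    refine (mul_eq_zero.1 ?_).resolve_left hD
    linear_combination a * hFs - (f₀ * s + f₁) * hCs - w * (s ^ 2 * k₂ + s * k₁ + k₀) -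
      (s ^ 2 * l₂ + s * l₁ + l₀) + s ^ 3 * hn
  have hx' : (f₀ * s + f₁) * ((2 * b₀ * s + b₁) * w + (3 * c₀ * s ^ 2 + 2 * c₁ * s + c₂)) =
      (s - x 0) * (s - x 1) * (s - x 2) * (f₀ * c₀) := by
    linear_combination a * hFx - f₀ * hCs - w * (2 * s * k₂ + k₁) - (2 * s * l₂ + l₁) +
      3 * s ^ 2 * hn -
      ((s - x 1) * (s - x 2) + (s - x 0) * (s - x 2) + (s - x 0) * (s - x 1)) * hN
  have hz' : (f₀ * s + f₁) * (2 * a * w + (b₀ * s ^ 2 + b₁ * s + b₂)) =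
      (s - x 0) * (s - x 1) * (s - x 2) * (f₀ * b₀) := by
    linear_combination a * hFz - (s ^ 2 * k₂ + s * k₁ + k₀)
  exact mul_left_cancel₀ hf (by linear_combination b₀ * hx' - c₀ * hz')

/-- No three of the eight points are collinear and no six lie on a conic, in terms of the
coefficients of the lines and conics. -/
structure LineConicGeneral {k : Type*} [Field k] (Q : Fin 8 → Fin 3 → k) : Prop where
  line : ∀ i j l : Fin 8, i ≠ j → i ≠ l → j ≠ l → ∀ a b c : k,
    a * Q i 0 + b * Q i 1 + c * Q i 2 = 0 → a * Q j 0 + b * Q j 1 + c * Q j 2 = 0 →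
    a * Q l 0 + b * Q l 1 + c * Q l 2 = 0 → a = 0 ∧ b = 0 ∧ c = 0
  conic : ∀ s : Finset (Fin 8), s.card = 6 → ∀ a b₀ b₁ c₀ c₁ c₂ : k,
    (∀ i ∈ s, a * Q i 2 ^ 2 + (b₀ * Q i 0 + b₁ * Q i 1) * Q i 2 +
      (c₀ * Q i 0 ^ 2 + c₁ * Q i 0 * Q i 1 + c₂ * Q i 1 ^ 2) = 0) →
    a = 0 ∧ b₀ = 0 ∧ b₁ = 0 ∧ c₀ = 0 ∧ c₁ = 0 ∧ c₂ = 0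

namespace LineConicGeneral

variable {k : Type*} [Field k] {Q : Fin 8 → Fin 3 → k}

theorem fst_ne (hQ : LineConicGeneral Q) (hy : ∀ i, Q i 1 = 1) {i j l : Fin 8} (hij : i ≠ j)
    (hil : i ≠ l) (hjl : j ≠ l) (h : Q i 0 = Q j 0) : Q i 0 ≠ Q l 0 := fun h' =>
  one_ne_zero (hQ.line i j l hij hil hjl 1 (-Q i 0) 0 (by rw [hy]; ring)
    (by rw [hy, h]; ring) (by rw [hy, h']; ring)).1

theorem snd_ne (hQ : LineConicGeneral Q) (hy : ∀ i, Q i 1 = 1) {i j : Fin 8} (hij : i ≠ j)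
    (h : Q i 0 = Q j 0) : Q i 2 ≠ Q j 2 := fun h' => by
  obtain ⟨l, hil, hjl⟩ : ∃ l, i ≠ l ∧ j ≠ l := (by decide : ∀ i j : Fin 8, ∃ l, i ≠ l ∧ j ≠ l) i j
  have h₁ := hQ.line i j l hij hil hjl (Q l 2 - Q i 2) (Q i 2 * Q l 0 - Q i 0 * Q l 2)
    (Q i 0 - Q l 0) (by rw [hy]; ring) (by rw [hy, ← h, ← h']; ring) (by rw [hy]; ring)
  exact hQ.fst_ne hy hij hil hjl h (sub_eq_zero.1 h₁.2.2)

/-- Version of `tangents_meet_on_cubic` for eight points in the affine chart `y = 1`, of which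
`n` and `m` lie on the line through `P` that contains the singular point. -/
theorem tangents_meet (hQ : LineConicGeneral Q) (hy : ∀ i, Q i 1 = 1)
    {a b₀ b₁ b₂ c₀ c₁ c₂ c₃ f₀ f₁ g₀ g₁ g₂ h₀ h₁ h₂ h₃ : k}
    (hC : ∀ i, a * Q i 2 ^ 2 + (b₀ * Q i 0 ^ 2 + b₁ * Q i 0 + b₂) * Q i 2 +
      (c₀ * Q i 0 ^ 3 + c₁ * Q i 0 ^ 2 + c₂ * Q i 0 + c₃) = 0)
    {n m : Fin 8} (hnm : n ≠ m) (hnm' : Q n 0 = Q m 0) {i j : Fin 3 → Fin 8}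
    (hij : ∀ t, i t ≠ j t) (hij' : ∀ t, Q (i t) 0 = Q (j t) 0)
    (hi : ∀ t u, t ≠ u → i t ≠ i u ∧ j t ≠ i u)
    (hni : ∀ t, n ≠ i t ∧ m ≠ i t) (hmj : ∀ t, m ≠ j t)
    (hF : ∀ l, l ≠ m → (f₀ * Q l 0 + f₁) * Q l 2 ^ 2 +
      (g₀ * Q l 0 ^ 2 + g₁ * Q l 0 + g₂) * Q l 2 +
      (h₀ * Q l 0 ^ 3 + h₁ * Q l 0 ^ 2 + h₂ * Q l 0 + h₃) = 0)
    (hFx : f₀ * Q n 2 ^ 2 + (2 * g₀ * Q n 0 + g₁) * Q n 2 +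
      (3 * h₀ * Q n 0 ^ 2 + 2 * h₁ * Q n 0 + h₂) = 0)
    (hFz : 2 * (f₀ * Q n 0 + f₁) * Q n 2 + (g₀ * Q n 0 ^ 2 + g₁ * Q n 0 + g₂) = 0)
    (hF0 : ¬ (f₀ = 0 ∧ f₁ = 0 ∧ g₀ = 0 ∧ g₁ = 0 ∧ g₂ = 0 ∧ h₀ = 0 ∧ h₁ = 0 ∧ h₂ = 0 ∧ h₃ = 0)) :
    b₀ * ((2 * b₀ * Q n 0 + b₁) * Q n 2 + (3 * c₀ * Q n 0 ^ 2 + 2 * c₁ * Q n 0 + c₂)) -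
      c₀ * (2 * a * Q n 2 + (b₀ * Q n 0 ^ 2 + b₁ * Q n 0 + b₂)) = 0 := by
  have hf : f₀ * Q n 0 + f₁ ≠ 0 := by
    intro hf
    set s := Q n 0
    have hg : g₀ * s ^ 2 + g₁ * s + g₂ = 0 := by linear_combination hFz - 2 * Q n 2 * hf
    have hh : h₀ * s ^ 3 + h₁ * s ^ 2 + h₂ * s + h₃ = 0 := by
      linear_combination hF n hnm - Q n 2 ^ 2 * hf - Q n 2 * hg
    obtain ⟨rfl, rfl, e₁, rfl, e₂, e₃⟩ := hQ.conic {n, m}ᶜ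
      (by rw [Finset.card_compl, Finset.card_pair hnm]; rfl)
      f₀ g₀ (g₁ + s * g₀) h₀ (h₁ + s * h₀) (h₂ + s * h₁ + s ^ 2 * h₀) fun l hl => by
        simp only [Finset.mem_compl, Finset.mem_insert, Finset.mem_singleton, not_or] at hl
        have hs : s ≠ Q l 0 := hQ.fst_ne hy hnm (Ne.symm hl.1) (Ne.symm hl.2) hnm'
        refine mul_left_cancel₀ (sub_ne_zero.2 hs.symm) ?_
        rw [hy]
        linear_combination hF l hl.2 - Q l 2 ^ 2 * hf - Q l 2 * hg - hh
    obtain rfl : g₁ = 0 := by linear_combination e₁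
    obtain rfl : h₁ = 0 := by linear_combination e₂
    obtain rfl : h₂ = 0 := by linear_combination e₃
    exact hF0 ⟨rfl, by linear_combination hf, rfl, rfl, by linear_combination hg, rfl, rfl, rfl,
      by linear_combination hh⟩
  refine tangents_meet_on_cubic (x := fun t => Q (i t) 0) (z := fun t => Q (i t) 2)
    (z' := fun t => Q (j t) 2) hf ?_ (fun t => hQ.fst_ne hy hnm (hni t).1 (hni t).2 hnm')
    (fun t => hQ.snd_ne hy (hij t) (hij' t)) (fun t => hC _) (fun t => ?_)
    (fun t => hF _ (hni t).2.symm) (fun t => ?_) (hC n) (hF n hnm) hFx hFz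
  · intro t u htu
    by_contra h
    exact hQ.fst_ne hy (hij t) (hi t u h).1 (hi t u h).2 (hij' t) htu
  · simp only [hij' t]
    exact hC (j t)
  · simp only [hij' t]
    exact hF (j t) (hmj t).symm

/-- If `C` is a cubic through `P` and eight points on four lines through `P`, tangent to the line
at infinity at `P`, then the tangent lines at the points `4`, `6` and `7` cannot all meet the
tangent line at `P` on `C`. -/
theorem not_tangents_meet (hQ : LineConicGeneral Q) (hy : ∀ i, Q i 1 = 1) (h2 : (2 : k) ≠ 0)
    (h01 : Q 0 0 = Q 1 0) (h23 : Q 2 0 = Q 3 0) (h45 : Q 4 0 = Q 5 0) (h67 : Q 6 0 = Q 7 0)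
    {a b₀ b₁ b₂ c₀ c₁ c₂ c₃ : k}
    (hC0 : ¬ (a = 0 ∧ b₀ = 0 ∧ b₁ = 0 ∧ b₂ = 0 ∧ c₀ = 0 ∧ c₁ = 0 ∧ c₂ = 0 ∧ c₃ = 0))
    (hC : ∀ i, a * Q i 2 ^ 2 + (b₀ * Q i 0 ^ 2 + b₁ * Q i 0 + b₂) * Q i 2 +
      (c₀ * Q i 0 ^ 3 + c₁ * Q i 0 ^ 2 + c₂ * Q i 0 + c₃) = 0)
    (hE : ∀ n ∈ ({4, 6, 7} : Finset (Fin 8)),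
      b₀ * ((2 * b₀ * Q n 0 + b₁) * Q n 2 + (3 * c₀ * Q n 0 ^ 2 + 2 * c₁ * Q n 0 + c₂)) -
      c₀ * (2 * a * Q n 2 + (b₀ * Q n 0 ^ 2 + b₁ * Q n 0 + b₂)) = 0) : False := by
  have z01 := hQ.snd_ne hy (by decide) h01
  have z23 := hQ.snd_ne hy (by decide) h23
  have z45 := hQ.snd_ne hy (by decide) h45
  have z67 := hQ.snd_ne hy (by decide) h67
  have x02 : Q 0 0 ≠ Q 2 0 := hQ.fst_ne hy (by decide) (by decide) (by decide) h01
  have x04 : Q 0 0 ≠ Q 4 0 := hQ.fst_ne hy (by decide) (by decide) (by decide) h01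
  have x06 : Q 0 0 ≠ Q 6 0 := hQ.fst_ne hy (by decide) (by decide) (by decide) h01
  have x24 : Q 2 0 ≠ Q 4 0 := hQ.fst_ne hy (by decide) (by decide) (by decide) h23
  have x26 : Q 2 0 ≠ Q 6 0 := hQ.fst_ne hy (by decide) (by decide) (by decide) h23
  have x46 : Q 4 0 ≠ Q 6 0 := hQ.fst_ne hy (by decide) (by decide) (by decide) h45
  have ha : a ≠ 0 := by
    rintro rfl
    have key (i j : Fin 8) (h : Q i 0 = Q j 0) (hz : Q i 2 ≠ Q j 2) :
        b₀ * Q i 0 ^ 2 + b₁ * Q i 0 + b₂ = 0 ∧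
        c₀ * Q i 0 ^ 3 + c₁ * Q i 0 ^ 2 + c₂ * Q i 0 + c₃ = 0 := by
      have hj := hC j
      rw [← h] at hj
      have hb : b₀ * Q i 0 ^ 2 + b₁ * Q i 0 + b₂ = 0 :=
        mul_left_cancel₀ (sub_ne_zero.2 hz) (by linear_combination hC i - hj)
      exact ⟨hb, by linear_combination hC i - Q i 2 * hb⟩
    have k0 := key 0 1 h01 z01
    have k2 := key 2 3 h23 z23
    have k4 := key 4 5 h45 z45
    have k6 := key 6 7 h67 z67
    obtain ⟨e₀, e₁, e₂⟩ := quartic_coeffs_of_roots (p := 0) (q := 0) (r := b₀) (t := b₁)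
      (u := b₂) x02 x04 x24
      (by linear_combination k0.1) (by linear_combination k2.1) (by linear_combination k4.1)
    obtain ⟨d₁, d₂, d₃⟩ := quartic_coeffs_of_roots (p := 0) (q := c₀) (r := c₁) (t := c₂)
      (u := c₃) x02 x04 x24
      (by linear_combination k0.2) (by linear_combination k2.2) (by linear_combination k4.2)
    have d₀ : c₀ = 0 := mul_left_cancel₀ (mul_ne_zero (mul_ne_zero (sub_ne_zero.2 x06)
      (sub_ne_zero.2 x26)) (sub_ne_zero.2 x46)) (by
        linear_combination Q 6 0 ^ 2 * d₁ + Q 6 0 * d₂ + d₃ - k6.2)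
    subst d₀
    exact hC0 ⟨rfl, by linear_combination e₀, by linear_combination e₁, by linear_combination e₂,
      rfl, by linear_combination d₁, by linear_combination d₂, by linear_combination d₃⟩
  have E4 := hE 4 (by simp)
  have E6 := hE 6 (by simp)
  have E7 := hE 7 (by simp)
  rw [← h67] at E7
  have A : 2 * b₀ ^ 2 * Q 6 0 + b₀ * b₁ - 2 * a * c₀ = 0 :=
    mul_left_cancel₀ (sub_ne_zero.2 z67) (by linear_combination E6 - E7)
  have hb : b₀ ≠ 0 := by
    rintro rfl
    have hc : c₀ = 0 := by
      simpa [h2, ha] using A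
    subst hc
    refine ha (hQ.conic {0, 1, 2, 3, 4, 5} rfl a b₁ b₂ c₁ c₂ c₃ fun i _ => ?_).1
    rw [hy]
    linear_combination hC i
  obtain ⟨l, hl⟩ : ∃ l, b₀ * l + c₀ = 0 := ⟨-c₀ / b₀, by field_simp; ring⟩
  obtain ⟨m, hm⟩ : ∃ m, m = Q 4 2 - l * Q 4 0 := ⟨_, rfl⟩
  set p₂ := a * l ^ 2 + b₁ * l + b₀ * m + c₁ with hp₂
  set p₁ := 2 * a * l * m + b₁ * m + b₂ * l + c₂ with hp₁
  have d4 : 2 * p₂ * Q 4 0 + p₁ = 0 := by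
    refine mul_left_cancel₀ hb ?_
    rw [hp₂, hp₁, hm]
    linear_combination E4 + (2 * a * Q 4 2 + b₀ * Q 4 0 ^ 2 + b₁ * Q 4 0 + b₂) * hl -
      3 * b₀ * Q 4 0 ^ 2 * hl
  have d6 : 2 * p₂ * Q 6 0 + p₁ = 0 := by
    refine mul_left_cancel₀ hb ?_
    rw [hp₂, hp₁]
    linear_combination E6 + (l * Q 6 0 + m - Q 6 2) * A +
      (2 * a * (l * Q 6 0 + m) + b₀ * Q 6 0 ^ 2 + b₁ * Q 6 0 + b₂) * hl -
      3 * b₀ * Q 6 0 ^ 2 * hl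
  have p₂0 : p₂ = 0 := mul_left_cancel₀ (mul_ne_zero h2 (sub_ne_zero.2 x46))
    (by linear_combination d4 - d6)
  have p₁0 : p₁ = 0 := by linear_combination d4 - 2 * Q 4 0 * p₂0
  have p₀0 : a * m ^ 2 + b₂ * m + c₃ = 0 := by
    linear_combination hC 4 - Q 4 0 ^ 2 * p₂0 - Q 4 0 * p₁0 - Q 4 0 ^ 3 * hl +
      (a * (Q 4 2 + l * Q 4 0 + m) + b₀ * Q 4 0 ^ 2 + b₁ * Q 4 0 + b₂) * hm
  have key (i j : Fin 8) (h : Q i 0 = Q j 0) (hz : Q i 2 ≠ Q j 2) :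
      l * Q i 0 + m * Q i 1 + (-1) * Q i 2 = 0 ∨ l * Q j 0 + m * Q j 1 + (-1) * Q j 2 = 0 := by
    have hi := hC i
    have hj := hC j
    rw [← h] at hj ⊢
    rw [hy, hy]
    have e : a * (Q i 2 + Q j 2) + (b₀ * Q i 0 ^ 2 + b₁ * Q i 0 + b₂) = 0 :=
      mul_left_cancel₀ (sub_ne_zero.2 hz) (by linear_combination hi - hj)
    refine mul_eq_zero.1 (mul_left_cancel₀ ha ?_)
    linear_combination Q i 0 ^ 3 * hl + Q i 0 ^ 2 * p₂0 + Q i 0 * p₁0 + p₀0 - hi -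
      (l * Q i 0 + m - Q i 2) * e
  have fin (i j n : Fin 8) (hij : i ≠ j) (hin : i ≠ n) (hjn : j ≠ n)
      (hi : l * Q i 0 + m * Q i 1 + (-1) * Q i 2 = 0)
      (hj : l * Q j 0 + m * Q j 1 + (-1) * Q j 2 = 0)
      (hn : l * Q n 0 + m * Q n 1 + (-1) * Q n 2 = 0) : False :=
    neg_ne_zero.2 one_ne_zero (hQ.line i j n hij hin hjn l m (-1) hi hj hn).2.2
  rcases key 0 1 h01 z01 with h | h <;> rcases key 2 3 h23 z23 with h' | h' <;>
    rcases key 4 5 h45 z45 with h'' | h'' <;>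
    exact fin _ _ _ (by decide) (by decide) (by decide) h h' h''

/-- If eight points in general position lie on a cubic which passes through `P` and is tangent to
the line `y = 0` there, and each of them lies on a line through `P` and another one, then none of
them lies on the line `y = 0`. -/
theorem snd_coord_ne_zero (hQ : LineConicGeneral Q) {σ : Fin 8 → Fin 8} (hσ : ∀ i, i ≠ σ i)
    (hσ' : ∀ i, ∃ m, i ≠ m ∧ i ≠ σ m)
    (hl : ∀ i, ∃ l₀ l₁, ¬ (l₀ = 0 ∧ l₁ = 0) ∧ l₀ * Q i 0 + l₁ * Q i 1 = 0 ∧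
      l₀ * Q (σ i) 0 + l₁ * Q (σ i) 1 = 0) {a b₀ b₁ b₂ c₀ c₁ c₂ c₃ : k}
    (hC0 : ¬ (a = 0 ∧ b₀ = 0 ∧ b₁ = 0 ∧ b₂ = 0 ∧ c₀ = 0 ∧ c₁ = 0 ∧ c₂ = 0 ∧ c₃ = 0))
    (hC : ∀ i, a * Q i 1 * Q i 2 ^ 2 +
      (b₀ * Q i 0 ^ 2 + b₁ * Q i 0 * Q i 1 + b₂ * Q i 1 ^ 2) * Q i 2 +
      (c₀ * Q i 0 ^ 3 + c₁ * Q i 0 ^ 2 * Q i 1 + c₂ * Q i 0 * Q i 1 ^ 2 + c₃ * Q i 1 ^ 3) = 0)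
    (i : Fin 8) : Q i 1 ≠ 0 := by
  have hx (n : Fin 8) (hy : Q n 1 = 0) : Q n 0 ≠ 0 := by
    intro hx
    obtain ⟨m, hnm, hnm'⟩ := hσ' n
    obtain ⟨l₀, l₁, h0, h, h'⟩ := hl m
    obtain ⟨rfl, rfl, -⟩ := hQ.line n m (σ m) hnm hnm' (hσ m) l₀ l₁ 0 (by rw [hx, hy]; ring)
      (by linear_combination h) (by linear_combination h')
    exact h0 ⟨rfl, rfl⟩
  intro hi
  obtain ⟨l₀, l₁, h0, h, h'⟩ := hl i
  have hij := hσ i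
  set j := σ i
  obtain rfl : l₀ = 0 := mul_left_cancel₀ (hx i hi) (by linear_combination h - l₁ * hi)
  have hj : Q j 1 = 0 := by simpa [show l₁ ≠ 0 by simpa using h0] using h'
  have hm (m : Fin 8) (him : i ≠ m) (hjm : j ≠ m) : Q m 1 ≠ 0 := fun hm =>
    one_ne_zero (hQ.line i j m hij him hjm 0 1 0 (by rw [hi]; ring) (by rw [hj]; ring)
      (by rw [hm]; ring)).2.1
  have hdet : Q i 0 * Q j 2 - Q j 0 * Q i 2 ≠ 0 := by
    intro hd
    obtain ⟨m, him, hjm⟩ := (by decide : ∀ i j : Fin 8, ∃ l, i ≠ l ∧ j ≠ l) i j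
    have h₁ := hQ.line i j m hij him hjm (-Q i 2 * Q m 1) (Q i 2 * Q m 0 - Q i 0 * Q m 2)
      (Q i 0 * Q m 1) (by rw [hi]; ring) (by rw [hj]; linear_combination Q m 1 * hd) (by ring)
    exact mul_ne_zero (hx i hi) (hm m him hjm) h₁.2.2
  have key (n : Fin 8) (hn : Q n 1 = 0) : b₀ * Q n 2 + c₀ * Q n 0 = 0 := by
    have := hC n
    rw [hn] at this
    exact mul_left_cancel₀ (pow_ne_zero 2 (hx n hn)) (by linear_combination this)
  obtain rfl : b₀ = 0 := mul_left_cancel₀ hdet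
    (by linear_combination Q i 0 * key j hj - Q j 0 * key i hi)
  obtain rfl : c₀ = 0 := mul_left_cancel₀ (hx i hi) (by linear_combination key i hi)
  obtain ⟨rfl, rfl, rfl, rfl, rfl, rfl⟩ := hQ.conic {i, j}ᶜ
    (by rw [Finset.card_compl, Finset.card_pair hij]; rfl) a b₁ b₂ c₁ c₂ c₃ fun m hm' => by
      simp only [Finset.mem_compl, Finset.mem_insert, Finset.mem_singleton, not_or] at hm'
      exact mul_left_cancel₀ (hm m (Ne.symm hm'.1) (Ne.symm hm'.2)) (by linear_combination hC m)
  exact hC0 ⟨rfl, rfl, rfl, rfl, rfl, rfl, rfl, rfl⟩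

end LineConicGeneral

namespace MvPolynomial

theorem IsHomogeneous.eval_smul {σ R : Type*} [CommSemiring R] {F : MvPolynomial σ R} {n : ℕ}
    (hF : F.IsHomogeneous n) (c : R) (v : σ → R) : eval (c • v) F = c ^ n * eval v F := by
  simp only [eval_eq, Finset.mul_sum]
  refine Finset.sum_congr rfl fun d hd => ?_
  have : ∑ i ∈ d.support, d i = n := (hF.degree_eq_sum_deg_support hd).symm
  simp only [Pi.smul_apply, smul_eq_mul, mul_pow, Finset.prod_mul_distrib,
    Finset.prod_pow_eq_pow_sum, this]
  ring

variable {σ τ R : Type*} [CommSemiring R] [Fintype σ]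

theorem eval_bind₁_toMvPolynomial (M : Matrix τ σ R) (v : σ → R) (F : MvPolynomial τ R) :
    eval v (bind₁ M.toMvPolynomial F) = eval (M.mulVec v) F := by
  rw [← aeval_eq_eval, aeval_bind₁]
  simp [aeval_eq_eval, Matrix.toMvPolynomial_eval_eq_apply]

theorem IsHomogeneous.bind₁_toMvPolynomial {F : MvPolynomial τ R} {n : ℕ} (hF : F.IsHomogeneous n)
    (M : Matrix τ σ R) : (bind₁ M.toMvPolynomial F).IsHomogeneous n := by
  simpa using hF.aeval _ (n := 1) M.toMvPolynomial_isHomogeneous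

theorem pderiv_toMvPolynomial [DecidableEq σ] (M : Matrix τ σ R) (s : τ) (t : σ) :
    pderiv t (M.toMvPolynomial s) = C (M s t) := by
  classical
  simp [Matrix.toMvPolynomial, ← C_mul_X_eq_monomial, pderiv_X, Pi.single_apply]

theorem eval_pderiv_bind₁_toMvPolynomial [DecidableEq σ] [Fintype τ] (M : Matrix τ σ R) (t : σ)
    (v : σ → R) (F : MvPolynomial τ R) :
    eval v (pderiv t (bind₁ M.toMvPolynomial F)) =
      ∑ s, eval (M.mulVec v) (pderiv s F) * M s t := by
  classical
  induction F using MvPolynomial.induction_on with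
  | C a => simp
  | add p q hp hq => simp [hp, hq, add_mul, Finset.sum_add_distrib]
  | mul_X p n hp =>
    simp only [map_mul, bind₁_X_right, Derivation.leibniz, smul_eq_mul, map_add, hp,
      pderiv_toMvPolynomial, eval_C, eval_bind₁_toMvPolynomial, Matrix.toMvPolynomial_eval_eq_apply,
      add_mul, Finset.sum_add_distrib, pderiv_X, Pi.single_apply, eval_X, Finset.mul_sum]
    congr 1
    · simp [apply_ite (eval _)]
    · exact Finset.sum_congr rfl fun _ _ => by ring

theorem IsHomogeneous.exists_linear_coeffs {R : Type*} [CommRing R] {L : MvPolynomial (Fin 3) R}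
    (hL : L.IsHomogeneous 1) : ∃ l : Fin 3 → R, L = ∑ i, C (l i) * X i := by
  have := (mem_homogeneousSubmodule 1 L).2 hL
  rw [homogeneousSubmodule_one_eq_span_X, Submodule.mem_span_range_iff_exists_fun] at this
  obtain ⟨l, hl⟩ := this
  exact ⟨l, by simp [← hl, smul_eq_C_mul]⟩

/-- The exponents of the ten cubic monomials in three variables. -/
def cubicExponent : Fin 10 → Fin 3 → ℕ :=
  ![![0, 0, 3], ![1, 0, 2], ![0, 1, 2], ![2, 0, 1], ![1, 1, 1], ![0, 2, 1],
    ![3, 0, 0], ![2, 1, 0], ![1, 2, 0], ![0, 3, 0]]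

/-- The ten cubic monomials in three variables. -/
noncomputable def cubicMonomial (R : Type*) [CommSemiring R] (i : Fin 10) :
    MvPolynomial (Fin 3) R :=
  monomial (Finsupp.equivFunOnFinite.symm (cubicExponent i)) 1

theorem cubicMonomial_eq (R : Type*) [CommSemiring R] (i : Fin 10) :
    cubicMonomial R i =
      X 0 ^ cubicExponent i 0 * X 1 ^ cubicExponent i 1 * X 2 ^ cubicExponent i 2 := by
  rw [cubicMonomial, monomial_eq, Finsupp.prod_fintype _ _ (by simp)]
  simp [Fin.prod_univ_three]

theorem isHomogeneous_cubicMonomial (R : Type*) [CommSemiring R] (i : Fin 10) :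
    (cubicMonomial R i).IsHomogeneous 3 := by
  refine isHomogeneous_monomial _ ?_
  rw [Finsupp.degree_eq_sum]
  exact (by decide : ∀ i, ∑ t, cubicExponent i t = 3) i

theorem linearIndependent_cubicMonomial (R : Type*) [CommSemiring R] :
    LinearIndependent R (cubicMonomial R) := by
  have h : Function.Injective cubicExponent := by decide
  have := (basisMonomials (Fin 3) R).linearIndependent.comp _
    (Finsupp.equivFunOnFinite.symm.injective.comp h)
  rw [coe_basisMonomials] at this
  exact this

theorem IsHomogeneous.exists_cubic_coeffs {R : Type*} [CommRing R] {F : MvPolynomial (Fin 3) R}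
    (hF : F.IsHomogeneous 3) : ∃ c : Fin 10 → R, ∑ i, c i • cubicMonomial R i = F := by
  rw [← Submodule.mem_span_range_iff_exists_fun, F.as_sum]
  refine Submodule.sum_mem _ fun d hd => ?_
  have h3 : ∑ t, d t = 3 := by
    rw [← Finsupp.degree_eq_sum]
    by_contra h
    exact mem_support_iff.1 hd (hF.coeff_eq_zero h)
  rw [Fin.sum_univ_three] at h3
  obtain ⟨i, hi⟩ : ∃ i, cubicExponent i = d := by
    have key : ∀ a < 4, ∀ b < 4, ∀ c < 4, a + b + c = 3 →
      ∃ i, cubicExponent i = ![a, b, c] := by decide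
    obtain ⟨i, hi⟩ := key (d 0) (by omega) (d 1) (by omega) (d 2) (by omega) h3
    exact ⟨i, hi.trans (List.ofFn_injective (by simp))⟩
  rw [← mul_one (coeff d F), ← smul_eq_mul, ← smul_monomial]
  exact Submodule.smul_mem _ _ (Submodule.subset_span ⟨i, by simp [cubicMonomial, hi]⟩)

/-- Through any nine points of the plane there is a cubic. -/
theorem exists_cubic_of_nine_points {k : Type*} [Field k] (R : Fin 9 → Fin 3 → k) :
    ∃ F : MvPolynomial (Fin 3) k, F ≠ 0 ∧ F.IsHomogeneous 3 ∧ ∀ i, eval (R i) F = 0 := by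
  let f : (Fin 10 → k) →ₗ[k] Fin 9 → k :=
    (LinearMap.pi fun i => (aeval (R i)).toLinearMap) ∘ₗ
      Fintype.linearCombination k (cubicMonomial k)
  obtain ⟨c, hc, hc0⟩ := (Submodule.ne_bot_iff _).1 (f.ker_ne_bot_of_finrank_lt (by simp))
  refine ⟨∑ i, c i • cubicMonomial k i, fun h => hc0 ?_, ?_, fun i => ?_⟩
  · exact _root_.funext (Fintype.linearIndependent_iff.1 (linearIndependent_cubicMonomial k) c h)
  · exact IsHomogeneous.sum _ _ _ fun i _ => by
      simpa [smul_eq_C_mul] using (isHomogeneous_cubicMonomial k i).C_mul (c i)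
  · simpa [f, Fintype.linearCombination_apply, aeval_eq_eval] using congr_fun hc i

/-- A cubic form and its derivatives along the first and last coordinate, in terms of
coefficients. -/
theorem IsHomogeneous.exists_eval_cubic {R : Type*} [CommRing R] {F : MvPolynomial (Fin 3) R}
    (hF : F.IsHomogeneous 3) (hF0 : F ≠ 0) : ∃ p f₀ f₁ g₀ g₁ g₂ h₀ h₁ h₂ h₃ : R,
    ¬ (p = 0 ∧ f₀ = 0 ∧ f₁ = 0 ∧ g₀ = 0 ∧ g₁ = 0 ∧ g₂ = 0 ∧ h₀ = 0 ∧ h₁ = 0 ∧ h₂ = 0 ∧ h₃ = 0) ∧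
    (∀ v, eval v F = p * v 2 ^ 3 + (f₀ * v 0 + f₁ * v 1) * v 2 ^ 2 +
      (g₀ * v 0 ^ 2 + g₁ * v 0 * v 1 + g₂ * v 1 ^ 2) * v 2 +
      (h₀ * v 0 ^ 3 + h₁ * v 0 ^ 2 * v 1 + h₂ * v 0 * v 1 ^ 2 + h₃ * v 1 ^ 3)) ∧
    (∀ v, eval v (pderiv 0 F) = f₀ * v 2 ^ 2 + (2 * g₀ * v 0 + g₁ * v 1) * v 2 +
      (3 * h₀ * v 0 ^ 2 + 2 * h₁ * v 0 * v 1 + h₂ * v 1 ^ 2)) ∧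
    (∀ v, eval v (pderiv 2 F) = 3 * p * v 2 ^ 2 + 2 * (f₀ * v 0 + f₁ * v 1) * v 2 +
      (g₀ * v 0 ^ 2 + g₁ * v 0 * v 1 + g₂ * v 1 ^ 2)) := by
  obtain ⟨c, rfl⟩ := hF.exists_cubic_coeffs
  refine ⟨c 0, c 1, c 2, c 3, c 4, c 5, c 6, c 7, c 8, c 9, fun h => hF0 ?_, fun v => ?_,
    fun v => ?_, fun v => ?_⟩
  · refine Finset.sum_eq_zero fun i _ => ?_
    have : c i = 0 := by fin_cases i <;> simp_all
    rw [this, zero_smul]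
  all_goals
    simp [Fin.sum_univ_succ, cubicMonomial_eq, cubicExponent, smul_eq_C_mul, pderiv_X]
    ring

end MvPolynomial

/-- Coordinates in which a given point is the last basis vector and a given linear form vanishes
on the first one. -/
theorem exists_adapted_coordinates {k : Type*} [Field k] {P : Fin 3 → k} (hP : P ≠ 0)
    (g : Fin 3 → k) : ∃ A B : Matrix (Fin 3) (Fin 3) k, A * B = 1 ∧ B * A = 1 ∧
      A.mulVec (Pi.single 2 1) = P ∧ ∑ s, g s * A s 0 = 0 := by
  let f : (Fin 3 → k) →ₗ[k] k := Fintype.linearCombination k g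
  obtain ⟨v, hv, hvP⟩ : ∃ v ∈ LinearMap.ker f, v ∉ Submodule.span k {P} := by
    refine SetLike.not_le_iff_exists.1 fun h => ?_
    have h₁ := Submodule.finrank_mono h
    have h₂ := f.finrank_range_add_finrank_ker
    have h₃ := (LinearMap.range f).finrank_le
    rw [finrank_span_singleton hP] at h₁
    simp at h₂ h₃
    omega
  have hli : LinearIndependent k ![P, v] := (LinearIndependent.pair_iff' hP).2 fun a ha =>
    hvP (Submodule.mem_span_singleton.2 ⟨a, ha⟩)
  obtain ⟨e, he⟩ := exists_linearIndependent_cons_of_lt_finrank hli (by simp)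
  have he' := he.comp ![2, 0, 1] (by decide)
  let A : Matrix (Fin 3) (Fin 3) k := Matrix.of fun s t => ![v, e, P] t s
  have hA : IsUnit A := by
    rw [← Matrix.linearIndependent_cols_iff_isUnit]
    have h : A.col = Fin.cons e ![P, v] ∘ ![2, 0, 1] := by
      ext t s
      fin_cases t <;> rfl
    exact h ▸ he'
  obtain ⟨B, hAB, hBA⟩ := isUnit_iff_exists.1 hA
  refine ⟨A, B, hAB, hBA, ?_, ?_⟩
  · ext s
    simp [A]
  · simpa [f, Fintype.linearCombination_apply, A, mul_comm] using hv

/-- General position is invariant under changes of coordinates and rescaling of the vectors. -/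
theorem GenPos8.lineConicGeneral {k : Type*} [Field k] {Q Q' : Fin 8 → Fin 3 → k}
    (hQ : GenPos8 k Q) {M N : Matrix (Fin 3) (Fin 3) k} (hMN : M * N = 1) {c : Fin 8 → k}
    (hQ' : ∀ i, M.mulVec (Q i) = c i • Q' i) : LineConicGeneral Q' := by
  have hv (n : ℕ) (F : MvPolynomial (Fin 3) k) (hF : F.IsHomogeneous n) (i : Fin 8)
      (h : eval (Q' i) F = 0) : eval (Q i) (bind₁ M.toMvPolynomial F) = 0 := by
    rw [eval_bind₁_toMvPolynomial, hQ', hF.eval_smul, h, mul_zero]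
  have h0 (F : MvPolynomial (Fin 3) k) (h : bind₁ M.toMvPolynomial F = 0) (v : Fin 3 → k) :
      eval v F = 0 := by
    simpa [eval_bind₁_toMvPolynomial, hMN] using congr_arg (eval (N.mulVec v)) h
  constructor
  · intro i j l hij hil hjl a b c hi hj hl
    have hF : (C a * X 0 + C b * X 1 + C c * X 2 : MvPolynomial (Fin 3) k).IsHomogeneous 1 :=
      (((isHomogeneous_X _ _).C_mul a).add ((isHomogeneous_X _ _).C_mul b)).add
        ((isHomogeneous_X _ _).C_mul c)
    by_contra hne
    refine hQ.1 i j l hij hil hjl ⟨_, fun h => hne ?_, hF.bind₁_toMvPolynomial M,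
      hv _ _ hF _ (by simpa using hi), hv _ _ hF _ (by simpa using hj),
      hv _ _ hF _ (by simpa using hl)⟩
    have e₀ := h0 _ h ![1, 0, 0]
    have e₁ := h0 _ h ![0, 1, 0]
    have e₂ := h0 _ h ![0, 0, 1]
    simp at e₀ e₁ e₂
    exact ⟨e₀, e₁, e₂⟩
  · intro s hs a b₀ b₁ c₀ c₁ c₂ hi
    have hX (t u : Fin 3) (a : k) : (C a * (X t * X u)).IsHomogeneous 2 :=
      ((isHomogeneous_X _ t).mul (isHomogeneous_X _ u)).C_mul a
    have hF := (((((hX 2 2 a).add (hX 0 2 b₀)).add (hX 1 2 b₁)).add (hX 0 0 c₀)).add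
      (hX 0 1 c₁)).add (hX 1 1 c₂)
    by_contra hne
    refine hQ.2.1 s hs ⟨_, fun h => hne ?_, hF.bind₁_toMvPolynomial M,
      fun i his => hv _ _ hF _ ?_⟩
    · have e₀ := h0 _ h ![1, 0, 0]
      have e₁ := h0 _ h ![0, 1, 0]
      have e₂ := h0 _ h ![0, 0, 1]
      have e₃ := h0 _ h ![1, 1, 0]
      have e₄ := h0 _ h ![1, 0, 1]
      have e₅ := h0 _ h ![0, 1, 1]
      simp at e₀ e₁ e₂ e₃ e₄ e₅
      simp_all
    · simp only [map_add, map_mul, eval_C, eval_X]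
      linear_combination hi i his

/-- The coefficients of a cubic through `P` in coordinates for which `P` is the last basis
vector. -/
theorem exists_cubic_coeffs_in_coordinates {k : Type*} [Field k] [Infinite k]
    {A B : Matrix (Fin 3) (Fin 3) k} (hAB : A * B = 1) {F : MvPolynomial (Fin 3) k}
    (hF : F.IsHomogeneous 3) (hF0 : F ≠ 0) (hP : eval (A.mulVec (Pi.single 2 1)) F = 0) :
    ∃ f₀ f₁ g₀ g₁ g₂ h₀ h₁ h₂ h₃ : k,
    ¬ (f₀ = 0 ∧ f₁ = 0 ∧ g₀ = 0 ∧ g₁ = 0 ∧ g₂ = 0 ∧ h₀ = 0 ∧ h₁ = 0 ∧ h₂ = 0 ∧ h₃ = 0) ∧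
    (∀ v, (f₀ * v 0 + f₁ * v 1) * v 2 ^ 2 +
      (g₀ * v 0 ^ 2 + g₁ * v 0 * v 1 + g₂ * v 1 ^ 2) * v 2 +
      (h₀ * v 0 ^ 3 + h₁ * v 0 ^ 2 * v 1 + h₂ * v 0 * v 1 ^ 2 + h₃ * v 1 ^ 3) =
        eval (A.mulVec v) F) ∧
    (∀ v, f₀ * v 2 ^ 2 + (2 * g₀ * v 0 + g₁ * v 1) * v 2 +
      (3 * h₀ * v 0 ^ 2 + 2 * h₁ * v 0 * v 1 + h₂ * v 1 ^ 2) =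
        ∑ s, eval (A.mulVec v) (pderiv s F) * A s 0) ∧
    (∀ v, 2 * (f₀ * v 0 + f₁ * v 1) * v 2 + (g₀ * v 0 ^ 2 + g₁ * v 0 * v 1 + g₂ * v 1 ^ 2) =
        ∑ s, eval (A.mulVec v) (pderiv s F) * A s 2) := by
  have hF0' : bind₁ A.toMvPolynomial F ≠ 0 := fun h => hF0 <| MvPolynomial.funext fun v => by
    simpa [eval_bind₁_toMvPolynomial, hAB] using congr_arg (eval (B.mulVec v)) h
  obtain ⟨p, f₀, f₁, g₀, g₁, g₂, h₀, h₁, h₂, h₃, hne, e, e₀, e₂⟩ :=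
    (hF.bind₁_toMvPolynomial A).exists_eval_cubic hF0'
  simp only [eval_bind₁_toMvPolynomial, eval_pderiv_bind₁_toMvPolynomial] at e e₀ e₂
  have hp := e (Pi.single 2 1)
  rw [hP] at hp
  obtain rfl : p = 0 := by simpa [eq_comm] using hp
  exact ⟨f₀, f₁, g₀, g₁, g₂, h₀, h₁, h₂, h₃, fun h => hne ⟨rfl, h⟩,
    fun v => by rw [e]; ring, fun v => (e₀ v).symm, fun v => by rw [e₂]; ring⟩

/-- The coefficients of a line through `P` in coordinates for which `P` is the last basis
vector. -/
theorem exists_line_coeffs_in_coordinates {k : Type*} [Field k] [Infinite k]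
    {A B : Matrix (Fin 3) (Fin 3) k} (hAB : A * B = 1) {L : MvPolynomial (Fin 3) k}
    (hL : L.IsHomogeneous 1) (hL0 : L ≠ 0) (hP : eval (A.mulVec (Pi.single 2 1)) L = 0) :
    ∃ l₀ l₁ : k, ¬ (l₀ = 0 ∧ l₁ = 0) ∧ ∀ v, l₀ * v 0 + l₁ * v 1 = eval (A.mulVec v) L := by
  obtain ⟨l, hl⟩ := (hL.bind₁_toMvPolynomial A).exists_linear_coeffs
  have e (v : Fin 3 → k) : eval (A.mulVec v) L = l 0 * v 0 + l 1 * v 1 + l 2 * v 2 := by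
    rw [← eval_bind₁_toMvPolynomial, hl]
    simp [Fin.sum_univ_three]
  have h2 : l 2 = 0 := by simpa using (e (Pi.single 2 1)).symm.trans hP
  refine ⟨l 0, l 1, fun h => hL0 <| MvPolynomial.funext fun v => ?_, fun v => by rw [e, h2]; ring⟩
  simpa [hAB, h, h2] using e (B.mulVec v)

/-- (char k ≠ 2.) Let `Q₁, …, Q₈` be eight points in general position such that the lines
`L₁` (through `Q₁, Q₂`), `L₂` (through `Q₃, Q₄`), `L₃` (through `Q₅, Q₆`), `L₄` (through
`Q₇, Q₈`) all pass through a common point `P`. Then there are no cubics `F` (through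
`Q₁,…,Q₆,Q₈`, singular at `Q₈`), `G` (through `Q₁,…,Q₇`, singular at `Q₇`), and `H` (through
`Q₁,…,Q₅,Q₇,Q₈`, singular at `Q₅`) all passing through `P`. -/
theorem stmt_18 {k : Type*} [Field k] [IsAlgClosed k] (hchar : ringChar k ≠ 2)
    (Q : Fin 8 → Fin 3 → k) (hQ0 : ∀ i, Q i ≠ 0) (hgen : GenPos8 k Q)
    (P : Fin 3 → k) (hP : P ≠ 0)
    (L1 L2 L3 L4 : MvPolynomial (Fin 3) k)
    (hL1 : L1 ≠ 0 ∧ L1.IsHomogeneous 1 ∧ MvPolynomial.eval (Q 0) L1 = 0 ∧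
      MvPolynomial.eval (Q 1) L1 = 0 ∧ MvPolynomial.eval P L1 = 0)
    (hL2 : L2 ≠ 0 ∧ L2.IsHomogeneous 1 ∧ MvPolynomial.eval (Q 2) L2 = 0 ∧
      MvPolynomial.eval (Q 3) L2 = 0 ∧ MvPolynomial.eval P L2 = 0)
    (hL3 : L3 ≠ 0 ∧ L3.IsHomogeneous 1 ∧ MvPolynomial.eval (Q 4) L3 = 0 ∧
      MvPolynomial.eval (Q 5) L3 = 0 ∧ MvPolynomial.eval P L3 = 0)
    (hL4 : L4 ≠ 0 ∧ L4.IsHomogeneous 1 ∧ MvPolynomial.eval (Q 6) L4 = 0 ∧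
      MvPolynomial.eval (Q 7) L4 = 0 ∧ MvPolynomial.eval P L4 = 0) :
    ¬ ∃ F G H : MvPolynomial (Fin 3) k,
      (F ≠ 0 ∧ F.IsHomogeneous 3 ∧ (∀ i : Fin 8, i ≠ 6 → MvPolynomial.eval (Q i) F = 0) ∧
        (∀ t : Fin 3, MvPolynomial.eval (Q 7) (pderiv t F) = 0)) ∧
      (G ≠ 0 ∧ G.IsHomogeneous 3 ∧ (∀ i : Fin 8, i ≠ 7 → MvPolynomial.eval (Q i) G = 0) ∧
        (∀ t : Fin 3, MvPolynomial.eval (Q 6) (pderiv t G) = 0)) ∧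
      (H ≠ 0 ∧ H.IsHomogeneous 3 ∧ (∀ i : Fin 8, i ≠ 5 → MvPolynomial.eval (Q i) H = 0) ∧
        (∀ t : Fin 3, MvPolynomial.eval (Q 4) (pderiv t H) = 0)) ∧
      MvPolynomial.eval P F = 0 ∧ MvPolynomial.eval P G = 0 ∧ MvPolynomial.eval P H = 0 := by
  rintro ⟨F, G, H, ⟨hF0, hF, hFQ, hFs⟩, ⟨hG0, hG, hGQ, hGs⟩, ⟨hH0, hH, hHQ, hHs⟩, hFP, hGP, hHP⟩
  obtain ⟨D, hD0, hD, hDR⟩ := exists_cubic_of_nine_points (Fin.cons P Q)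
  have hDP : eval P D = 0 := hDR 0
  have hDQ (i : Fin 8) : eval (Q i) D = 0 := hDR i.succ
  obtain ⟨A, B, hAB, hBA, rfl, hg⟩ :=
    exists_adapted_coordinates hP fun s => eval P (pderiv s D)
  obtain ⟨t, a, b₀, b₁, b₂, c₀, c₁, c₂, c₃, hC0, hC, ht, -⟩ :=
    exists_cubic_coeffs_in_coordinates hAB hD hD0 hDP
  obtain rfl : t = 0 := by simpa using (ht (Pi.single 2 1)).trans hg
  have hAQ (i : Fin 8) : A.mulVec (B.mulVec (Q i)) = Q i := by simp [hAB]
  have hline (i j : Fin 8) (L : MvPolynomial (Fin 3) k) (hL : L ≠ 0 ∧ L.IsHomogeneous 1 ∧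
      eval (Q i) L = 0 ∧ eval (Q j) L = 0 ∧ eval (A.mulVec (Pi.single 2 1)) L = 0) :
      ∃ l₀ l₁, ¬ (l₀ = 0 ∧ l₁ = 0) ∧ l₀ * B.mulVec (Q i) 0 + l₁ * B.mulVec (Q i) 1 = 0 ∧
        l₀ * B.mulVec (Q j) 0 + l₁ * B.mulVec (Q j) 1 = 0 := by
    obtain ⟨hL0, hL, hi, hj, hLP⟩ := hL
    obtain ⟨l₀, l₁, h0, h⟩ := exists_line_coeffs_in_coordinates hAB hL hL0 hLP
    exact ⟨l₀, l₁, h0, by rw [h, hAQ, hi], by rw [h, hAQ, hj]⟩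
  have hl : ∀ i, ∃ l₀ l₁, ¬ (l₀ = 0 ∧ l₁ = 0) ∧
      l₀ * B.mulVec (Q i) 0 + l₁ * B.mulVec (Q i) 1 = 0 ∧
      l₀ * B.mulVec (Q (![1, 0, 3, 2, 5, 4, 7, 6] i)) 0 +
        l₁ * B.mulVec (Q (![1, 0, 3, 2, 5, 4, 7, 6] i)) 1 = 0 := by
    have swap {L : MvPolynomial (Fin 3) k} {i j : Fin 8} (hL : L ≠ 0 ∧ L.IsHomogeneous 1 ∧
        eval (Q i) L = 0 ∧ eval (Q j) L = 0 ∧ eval (A.mulVec (Pi.single 2 1)) L = 0) :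
        L ≠ 0 ∧ L.IsHomogeneous 1 ∧
        eval (Q j) L = 0 ∧ eval (Q i) L = 0 ∧ eval (A.mulVec (Pi.single 2 1)) L = 0 := by tauto
    intro i
    fin_cases i
    exacts [hline 0 1 L1 hL1, hline 1 0 L1 (swap hL1), hline 2 3 L2 hL2, hline 3 2 L2 (swap hL2),
      hline 4 5 L3 hL3, hline 5 4 L3 (swap hL3), hline 6 7 L4 hL4, hline 7 6 L4 (swap hL4)]
  have hy : ∀ i, B.mulVec (Q i) 1 ≠ 0 :=
    (hgen.lineConicGeneral hBA (c := 1) (Q' := fun i => B.mulVec (Q i))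
      (by simp)).snd_coord_ne_zero (by decide) (by decide) hl
      (by simpa using hC0) fun i => by
        linear_combination (hC (B.mulVec (Q i))).trans ((hAQ i).symm ▸ hDQ i)
  set w : Fin 8 → Fin 3 → k := fun i => (B.mulVec (Q i) 1)⁻¹ • B.mulVec (Q i) with hw
  have hw1 (i : Fin 8) : w i 1 = 1 := inv_mul_cancel₀ (hy i)
  have hAw (i : Fin 8) : A.mulVec (w i) = (B.mulVec (Q i) 1)⁻¹ • Q i := by
    rw [hw, Matrix.mulVec_smul, hAQ]
  have hgenw : LineConicGeneral w := hgen.lineConicGeneral hBA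
    (c := fun i => B.mulVec (Q i) 1) fun i => by simp [hw, hy]
  have hfst (i : Fin 8) : w i 0 = w (![1, 0, 3, 2, 5, 4, 7, 6] i) 0 := by
    obtain ⟨l₀, l₁, h0, h, h'⟩ := hl i
    have hi := hy i
    have hj := hy (![1, 0, 3, 2, 5, 4, 7, 6] i)
    have hl₀ : l₀ ≠ 0 := by
      rintro rfl
      simp_all
    simp only [hw, Pi.smul_apply, smul_eq_mul]
    field_simp
    refine mul_left_cancel₀ hl₀ ?_
    linear_combination B.mulVec (Q (![1, 0, 3, 2, 5, 4, 7, 6] i)) 1 * h - B.mulVec (Q i) 1 * h'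
  have heval (F : MvPolynomial (Fin 3) k) {d : ℕ} (hF : F.IsHomogeneous d) (i : Fin 8)
      (h : eval (Q i) F = 0) : eval (A.mulVec (w i)) F = 0 := by
    rw [hAw, hF.eval_smul, h, mul_zero]
  have hCw (i : Fin 8) : a * w i 2 ^ 2 + (b₀ * w i 0 ^ 2 + b₁ * w i 0 + b₂) * w i 2 +
      (c₀ * w i 0 ^ 3 + c₁ * w i 0 ^ 2 + c₂ * w i 0 + c₃) = 0 := by
    have := hC (w i)
    rw [heval D hD i (hDQ i), hw1] at this
    linear_combination this
  have hE (F : MvPolynomial (Fin 3) k) (hF : F.IsHomogeneous 3) (hF0 : F ≠ 0)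
      (hFP : eval (A.mulVec (Pi.single 2 1)) F = 0) (n m : Fin 8)
      (hFQ : ∀ i, i ≠ m → eval (Q i) F = 0) (hFs : ∀ t, eval (Q n) (pderiv t F) = 0)
      (hnm : n ≠ m) (hnm' : w n 0 = w m 0) (i j : Fin 3 → Fin 8)
      (hij : ∀ t, i t ≠ j t) (hij' : ∀ t, j t = ![1, 0, 3, 2, 5, 4, 7, 6] (i t))
      (hi : ∀ t u, t ≠ u → i t ≠ i u ∧ j t ≠ i u)
      (hni : ∀ t, n ≠ i t ∧ m ≠ i t) (hmj : ∀ t, m ≠ j t) :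
      b₀ * ((2 * b₀ * w n 0 + b₁) * w n 2 + (3 * c₀ * w n 0 ^ 2 + 2 * c₁ * w n 0 + c₂)) -
        c₀ * (2 * a * w n 2 + (b₀ * w n 0 ^ 2 + b₁ * w n 0 + b₂)) = 0 := by
    obtain ⟨f₀, f₁, g₀, g₁, g₂, h₀, h₁, h₂, h₃, hne, e, e₀, e₂⟩ :=
      exists_cubic_coeffs_in_coordinates hAB hF hF0 hFP
    have hs (t : Fin 3) : ∑ s, eval (A.mulVec (w n)) (pderiv s F) * A s t = 0 :=
      Finset.sum_eq_zero fun s _ => by rw [heval _ hF.pderiv n (hFs s), zero_mul]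
    have k₀ := e₀ (w n)
    have k₂ := e₂ (w n)
    rw [hs, hw1] at k₀ k₂
    refine hgenw.tangents_meet hw1 hCw hnm hnm' hij (fun t => by rw [hij', ← hfst]) hi hni hmj
      (fun l hl => ?_) ?_ ?_ hne
    · have := e (w l)
      rw [heval F hF l (hFQ l hl), hw1] at this
      linear_combination this
    · linear_combination k₀
    · linear_combination k₂
  refine hgenw.not_tangents_meet hw1 (Ring.two_ne_zero hchar) (hfst 0) (hfst 2) (hfst 4) (hfst 6)
    (by simpa using hC0) hCw fun n hn => ?_
  simp only [Finset.mem_insert, Finset.mem_singleton] at hn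
  obtain rfl | rfl | rfl := hn
  · exact hE H hH hH0 hHP 4 5 hHQ hHs (by decide) (hfst 4) ![0, 2, 6] ![1, 3, 7]
      (by decide) (by decide) (by decide) (by decide) (by decide)
  · exact hE G hG hG0 hGP 6 7 hGQ hGs (by decide) (hfst 6) ![0, 2, 4] ![1, 3, 5]
      (by decide) (by decide) (by decide) (by decide) (by decide)
  · exact hE F hF hF0 hFP 7 6 hFQ hFs (by decide) (hfst 7) ![0, 2, 4] ![1, 3, 5]
      (by decide) (by decide) (by decide) (by decide) (by decide)
end
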